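/- Let α ∈ (0,1) and p > 1 be real, and consider case abs, n(x) = |x|^p. Then there exist a speed c with 0 < c < (p/(p−1))·∫_{−π}^{π}|K_α(x)|dx and a nontrivial steady solution φ with speed c such that: φ is even (φ(−x) = φ(x) for all x); φ(0) = μ and φ(x) ≤ μ for all x; φ is globally α-Hölder continuous, i.e. there is C > 0 with |φ(x) − φ(y)| ≤ C·|x − y|^α for all x, y; φ is strictly increasing on (−π,0); φ is infinitely differentiable on an open neighbourhood of −π and at every point of (−π,0) ∪ (0,π) except possibly at the points where φ vanishes; and there exist δ, c₁, c₂ > 0 such that c₁·|x|^α ≤ μ − φ(x) ≤ c₂·|x|^α for all |x| ≤ δ. -/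

import Mathlib

open Real MeasureTheory Set Filter Topology

/-- The periodic convolution kernel `K_α`: equal to the explicit integral
representation for `x ∉ 2πℤ` and to `0` on `2πℤ`. -/
noncomputable def Kker (α x : ℝ) : ℝ :=
  letI : Decidable (∃ k : ℤ, x = 2 * π * k) := Classical.propDecidable _
  if ∃ k : ℤ, x = 2 * π * k then 0
  else (1 / (π * Real.Gamma α)) *
    ∫ t in Set.Ioi (0:ℝ),
      t ^ (α - 1) * (Real.exp t * Real.cos x - 1) /
        (1 - 2 * Real.exp t * Real.cos x + Real.exp (2 * t))

/-- A steady travelling-wave solution of speed `c` with nonlinearity `n`: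
a continuous, `2π`-periodic, zero-mean function `φ` satisfying the steady
convolution equation. -/
def IsSteadySolution (α c : ℝ) (n φ : ℝ → ℝ) : Prop :=
  Continuous φ ∧ Function.Periodic φ (2 * π) ∧
  (∫ y in (-π)..π, φ y) = 0 ∧
  ∀ x : ℝ, (∫ y in (-π)..π, Kker α (x - y) * φ y) =
    c * φ x - n (φ x) + (1 / (2 * π)) * ∫ y in (-π)..π, n (φ y)

/-- Case abs nonlinearity `n(x) = |x|^p`. -/
noncomputable def nAbs (p x : ℝ) : ℝ := |x| ^ p
/-- Case sgn nonlinearity `n(x) = x·|x|^(p-1)`. -/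
noncomputable def nSgn (p x : ℝ) : ℝ := x * |x| ^ (p - 1)
/-- Derivative of the case abs nonlinearity, `n′(x) = p·x·|x|^(p-2)`. -/
noncomputable def nAbs' (p x : ℝ) : ℝ := p * x * |x| ^ (p - 2)
/-- Derivative of the case sgn nonlinearity, `n′(x) = p·|x|^(p-1)`. -/
noncomputable def nSgn' (p x : ℝ) : ℝ := p * |x| ^ (p - 1)

namespace HW

set_option linter.unusedSectionVars false

section scarf
variable {X I L : Type*} [Fintype X] [DecidableEq X] [Fintype I] [DecidableEq I] [LinearOrder L]

/-- Domination predicate of Scarf's lemma. -/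
def ScDom (r : I → X → L) (B : Finset (X ⊕ I)) : Prop :=
  ∀ y : X, ∃ i : I, Sum.inr i ∉ B ∧ ∀ a, Sum.inl a ∈ B → r i y ≤ r i a

noncomputable instance (r : I → X → L) : DecidablePred (ScDom r) := Classical.decPred _

lemma ScDom.mono {r : I → X → L} {B B' : Finset (X ⊕ I)} (h : ScDom r B') (hB : B ⊆ B') :
    ScDom r B := by
  intro y
  obtain ⟨i, hi, h2⟩ := h y
  exact ⟨i, fun h => hi (hB h), fun a ha => h2 a (hB ha)⟩

/-- abstract Sperner count inside a cell -/
lemma cell_count {Y : Type*} [DecidableEq Y] (c : Y → I) (i0 : I) (B : Finset Y)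
    (hB : B.card = Fintype.card I) (hn : B.image c ≠ Finset.univ) :
    Even ((B.filter (fun y => (B.erase y).image c = Finset.univ.erase i0)).card) := by
  by_cases h : ∃ y0 ∈ B, (B.erase y0).image c = Finset.univ.erase i0
  · obtain ⟨y0, hy0, h0⟩ := h
    have hcard : ((B.erase y0).image c).card = (B.erase y0).card := by
      rw [h0, Finset.card_erase_of_mem (Finset.mem_univ _), Finset.card_erase_of_mem hy0, hB,
        Finset.card_univ]
    have hinj := Finset.card_image_iff.1 hcard
    have hc0 : c y0 ≠ i0 := by
      intro hc
      apply hn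
      have : B.image c = insert (c y0) ((B.erase y0).image c) := by
        rw [← Finset.image_insert, Finset.insert_erase hy0]
      rw [this, h0, hc, Finset.insert_erase (Finset.mem_univ _)]
    have : c y0 ∈ (B.erase y0).image c := by rw [h0]; simp [hc0]
    obtain ⟨y1, hy1, hc1⟩ := Finset.mem_image.1 this
    have hy1' := Finset.mem_erase.1 hy1
    have key : B.filter (fun y => (B.erase y).image c = Finset.univ.erase i0) = {y0, y1} := by
      ext y
      simp only [Finset.mem_filter, Finset.mem_insert, Finset.mem_singleton]
      constructor
      · rintro ⟨hy, hyc⟩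
        by_contra hcon
        push Not at hcon
        have hcard2 : ((B.erase y).image c).card = (B.erase y).card := by
          rw [hyc, Finset.card_erase_of_mem (Finset.mem_univ _), Finset.card_erase_of_mem hy, hB,
            Finset.card_univ]
        have hinj2 := Finset.card_image_iff.1 hcard2
        exact hy1'.1 (hinj2 (by simp [hy1'.2, hcon.2.symm]) (by simp [hy0, hcon.1.symm]) hc1)
      · rintro (rfl | rfl)
        · exact ⟨hy0, h0⟩
        · refine ⟨hy1'.2, ?_⟩
          rw [← h0]
          ext i
          simp only [Finset.mem_image, Finset.mem_erase]
          constructor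
          · rintro ⟨z, ⟨hz, hzB⟩, rfl⟩
            by_cases hz0 : z = y0
            · exact ⟨y, hy1', by rw [hz0, hc1]⟩
            · exact ⟨z, ⟨hz0, hzB⟩, rfl⟩
          · rintro ⟨z, ⟨hz, hzB⟩, rfl⟩
            by_cases hz0 : z = y
            · exact ⟨y0, ⟨hy1'.1.symm, hy0⟩, by rw [hz0, hc1]⟩
            · exact ⟨z, ⟨hz0, hzB⟩, rfl⟩
    rw [key, Finset.card_pair hy1'.1.symm]
    exact even_two
  · push Not at h
    rw [Finset.filter_false_of_mem h]
    simp

/-- a door with no `X`-element is contained in exactly one cell -/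
lemma door_bdry (r : I → X → L) (hr : ∀ i, Function.Injective (r i)) [Nonempty X] (i0 : I) :
    ((Finset.univ : Finset (X ⊕ I)).filter (fun y => y ∉ (Finset.univ.erase i0).image Sum.inr ∧
      ScDom r (insert y ((Finset.univ.erase i0).image Sum.inr)))).card = 1 := by
  obtain ⟨x, -, hx⟩ := Finset.exists_max_image (Finset.univ : Finset X) (r i0)
    Finset.univ_nonempty
  rw [Finset.card_eq_one]
  refine ⟨Sum.inl x, ?_⟩
  ext y
  simp only [Finset.mem_filter, Finset.mem_univ, true_and, Finset.mem_singleton]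
  constructor
  · rintro ⟨h1, h2⟩
    rcases y with y | j
    · obtain ⟨i, hi, hi2⟩ := h2 x
      have : i = i0 := by
        by_contra hne
        exact hi (by simp [hne])
      subst this
      have := hi2 y (by simp)
      have := hr i (le_antisymm (hx y (Finset.mem_univ _)) this)
      rw [this]
    · exfalso
      have : j = i0 := by
        by_contra hne
        exact h1 (by simp [hne])
      subst this
      obtain ⟨i, hi, hi2⟩ := h2 x
      apply hi
      by_cases h : i = j <;> simp [h]
  · rintro rfl
    refine ⟨by simp, ?_⟩
    intro y
    refine ⟨i0, by simp, ?_⟩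
    intro a ha
    have : a = x := by simpa using ha
    subst this
    exact hx y (Finset.mem_univ _)

/-- an interior door is contained in exactly two cells -/
lemma door_int (r : I → X → L) (hr : ∀ i, Function.Injective (r i)) (B : Finset (X ⊕ I))
    (hD : ScDom r B) (hc : B.card + 1 = Fintype.card I) (hA : ∃ a, Sum.inl a ∈ B) :
    ((Finset.univ : Finset (X ⊕ I)).filter (fun y => y ∉ B ∧ ScDom r (insert y B))).card = 2 := by
  classical
  set A : Finset X := Finset.univ.filter (fun a => Sum.inl a ∈ B) with hAdef
  set C : Finset I := Finset.univ.filter (fun i => Sum.inr i ∉ B) with hCdef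
  have memA : ∀ a, a ∈ A ↔ Sum.inl a ∈ B := by simp [hAdef]
  have memC : ∀ i, i ∈ C ↔ Sum.inr i ∉ B := by simp [hCdef]
  have hAne : A.Nonempty := by obtain ⟨a, ha⟩ := hA; exact ⟨a, (memA a).2 ha⟩
  -- cardinalities
  have hcard : C.card = A.card + 1 := by
    have h1 : B = A.image Sum.inl ∪ (Finset.univ \ C).image Sum.inr := by
      ext y
      rcases y with y | y <;> simp [memA, memC]
    have h2 : B.card = A.card + (Finset.univ \ C).card := by
      rw [h1, Finset.card_union_of_disjoint, Finset.card_image_of_injective _ Sum.inl_injective,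
        Finset.card_image_of_injective _ Sum.inr_injective]
      rw [Finset.disjoint_left]
      simp
    have h3 := Finset.card_sdiff_add_card_eq_card (Finset.subset_univ C)
    rw [Finset.card_univ] at h3
    omega
  have hmin : ∀ k : I, ∃ a ∈ A, ∀ b ∈ A, r k a ≤ r k b := fun k =>
    Finset.exists_min_image A (r k) hAne
  choose m hmA hm using hmin
  have hDom : ∀ y, ∃ i ∈ C, r i y ≤ r i (m i) := by
    intro y
    obtain ⟨i, hi, h2⟩ := hD y
    exact ⟨i, (memC i).2 hi, h2 _ ((memA _).1 (hmA i))⟩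
  have hsurj : ∀ a ∈ A, ∃ i ∈ C, m i = a := by
    intro a ha
    obtain ⟨i, hi, h2⟩ := hDom a
    exact ⟨i, hi, hr i (le_antisymm (hm i a ha) h2)⟩
  -- collision
  obtain ⟨i, hi, j, hj, hij, hmij⟩ : ∃ i ∈ C, ∃ j ∈ C, i ≠ j ∧ m i = m j :=
    Finset.exists_ne_map_eq_of_card_lt_of_maps_to (by omega) (fun k _ => hmA k)
  have hinj_aux : ∀ i ∈ C, ∀ j ∈ C, i ≠ j → m i = m j → Set.InjOn m (C.erase i : Finset I) := by
    intro i hi j hj hij hmij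
    apply Finset.card_image_iff.1
    have : (C.erase i).image m = A := by
      ext a
      simp only [Finset.mem_image, Finset.mem_erase]
      constructor
      · rintro ⟨k, -, rfl⟩; exact hmA k
      · intro ha
        obtain ⟨k, hk, hka⟩ := hsurj a ha
        by_cases hki : k = i
        · exact ⟨j, ⟨hij.symm, hj⟩, by rw [← hmij, ← hki, hka]⟩
        · exact ⟨k, ⟨hki, hk⟩, hka⟩
    rw [this, Finset.card_erase_of_mem hi]; omega
  have hinj_i := hinj_aux i hi j hj hij hmij
  have hinj_j := hinj_aux j hj i hi hij.symm hmij.symm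
  -- if m restricted to C \ k is onto A then k ∈ {i,j}
  have hk_ij : ∀ k ∈ C, (∀ a ∈ A, ∃ l ∈ C, l ≠ k ∧ m l = a) → k = i ∨ k = j := by
    intro k hk h
    obtain ⟨l, hl, hlk, hml⟩ := h (m k) (hmA k)
    by_contra hcon
    push Not at hcon
    by_cases hli : l = i
    · subst hli
      exact hlk (hinj_j (by simp [hl, hij]) (by simp [hk, hcon.2]) hml)
    · exact hlk (hinj_i (by simp [hl, hli]) (by simp [hk, hcon.1]) hml)
  -- classification of extensions
  let P : I → X ⊕ I → Prop := fun k y =>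
    match y with
    | Sum.inl x => (∀ l ∈ C, l ≠ k → r l (m l) < r l x) ∧
        (∀ z, (∀ l ∈ C, l ≠ k → r l (m l) < r l z) → r k z ≤ r k x)
    | Sum.inr l => l = k ∧ ∀ z, ¬ (∀ l ∈ C, l ≠ k → r l (m l) < r l z)
  have hPex : ∀ k, ∃ y, P k y := by
    intro k
    by_cases hM : ∃ z, (∀ l ∈ C, l ≠ k → r l (m l) < r l z)
    · obtain ⟨z, hz⟩ := hM
      obtain ⟨x, hx, hx2⟩ := Finset.exists_max_image
        (Finset.univ.filter (fun z => (∀ l ∈ C, l ≠ k → r l (m l) < r l z))) (r k)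
        ⟨z, by simpa using hz⟩
      refine ⟨Sum.inl x, by simpa using hx, ?_⟩
      intro z hz
      exact hx2 z (by simpa using hz)
    · push Not at hM
      exact ⟨Sum.inr k, rfl, fun z h => by
        obtain ⟨l, h1, h2, h3⟩ := hM z
        exact absurd (h l h1 h2) (not_lt.2 h3)⟩
  have hPuniq : ∀ k y y', P k y → P k y' → y = y' := by
    intro k y y' h h'
    rcases y with x | l <;> rcases y' with x' | l'
    · exact congrArg _ (hr k (le_antisymm (h'.2 x h.1) (h.2 x' h'.1)))
    · exact absurd h.1 (h'.2 x)
    · exact absurd h'.1 (h.2 x')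
    · rw [h.1, h'.1]
  -- key facts: for x with P-like property, m k of the erased index
  have hnotA : ∀ k ∈ C, (k = i ∨ k = j) → ∀ x, (∀ l ∈ C, l ≠ k → r l (m l) < r l x) → x ∉ A := by
    intro k hk hkij x hx hxA
    obtain ⟨l, hl, hlx⟩ := hsurj x hxA
    by_cases hlk : l = k
    · subst hlk
      rcases hkij with rfl | rfl
      · have := hx j hj hij.symm
        rw [← hmij, hlx] at this
        exact lt_irrefl _ this
      · have := hx i hi hij
        rw [hmij, hlx] at this
        exact lt_irrefl _ this
    · have := hx l hl hlk
      rw [hlx] at this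
      exact lt_irrefl _ this
  have hP_to : ∀ k ∈ C, (k = i ∨ k = j) → ∀ y, P k y → y ∉ B ∧ ScDom r (insert y B) := by
    intro k hk hkij y hy
    rcases y with x | l
    · have hxA := hnotA k hk hkij x hy.1
      refine ⟨fun h => hxA ((memA x).2 h), ?_⟩
      intro z
      by_cases hz : ∀ l ∈ C, l ≠ k → r l (m l) < r l z
      · refine ⟨k, by simpa using (memC k).1 hk, ?_⟩
        intro a ha
        have hzx := hy.2 z hz
        rcases Finset.mem_insert.1 ha with h | h
        · rw [Sum.inl_injective h]; exact hzx
        · -- z vs a : by domination of z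
          obtain ⟨l, hl, hlz⟩ := hDom z
          by_cases hlk : l = k
          · subst hlk
            exact hlz.trans (hm l a ((memA a).2 h))
          · exact absurd (hz l hl hlk) (not_lt.2 hlz)
      · push Not at hz
        obtain ⟨l, hl, hlk, hlz⟩ := hz
        refine ⟨l, by simpa using (memC l).1 hl, ?_⟩
        intro a ha
        rcases Finset.mem_insert.1 ha with h | h
        · rw [Sum.inl_injective h]; exact hlz.trans (hy.1 l hl hlk).le
        · exact hlz.trans (hm l a ((memA a).2 h))
    · obtain ⟨rfl, hy2⟩ := hy
      refine ⟨(memC l).1 hk, ?_⟩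
      intro z
      have := hy2 z
      push Not at this
      obtain ⟨q, hq, hql, hqz⟩ := this
      refine ⟨q, by simpa [hql] using (memC q).1 hq, ?_⟩
      intro a ha
      exact hqz.trans (hm q a ((memA a).2 (by simpa using ha)))
  have hP_from : ∀ y, y ∉ B → ScDom r (insert y B) → ∃ k, (k = i ∨ k = j) ∧ P k y := by
    intro y hyB hy
    rcases y with x | k
    · have hxA : x ∉ A := fun h => hyB ((memA x).1 h)
      -- dominating index for x
      obtain ⟨k, hkB, hk2⟩ := hy x
      have hkC : k ∈ C := (memC k).2 (by simpa using hkB)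
      have hxk : ∀ a ∈ A, r k x ≤ r k a := fun a ha =>
        hk2 a (Finset.mem_insert_of_mem ((memA a).1 ha))
      -- each a in A is min for some index, necessarily ≠ k
      have hs : ∀ a ∈ A, ∃ l ∈ C, l ≠ k ∧ m l = a ∧ r l a < r l x := by
        intro a ha
        obtain ⟨l, hlB, hl2⟩ := hy a
        have hlC : l ∈ C := (memC l).2 (by simpa using hlB)
        have hax : r l a ≤ r l x := hl2 x (Finset.mem_insert_self _ _)
        have hne : a ≠ x := fun h => hxA (h ▸ ha)
        have hax' : r l a < r l x := lt_of_le_of_ne hax (fun h => hne (hr l h))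
        refine ⟨l, hlC, ?_, ?_, hax'⟩
        · rintro rfl
          exact absurd (hxk a ha) (not_le.2 hax')
        · exact hr l (le_antisymm (hm l a ha)
            (hl2 _ (Finset.mem_insert_of_mem ((memA _).1 (hmA l)))))
      have hkij := hk_ij k hkC (fun a ha => by
        obtain ⟨l, h1, h2, h3, -⟩ := hs a ha
        exact ⟨l, h1, h2, h3⟩)
      have hinjk : Set.InjOn m (C.erase k : Finset I) := by
        rcases hkij with rfl | rfl
        · exact hinj_i
        · exact hinj_j
      have hlt : ∀ l ∈ C, l ≠ k → r l (m l) < r l x := by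
        intro l hl hlk
        obtain ⟨l', h1, h2, h3, h4⟩ := hs (m l) (hmA l)
        have : l' = l := hinjk (by simp [h1, h2]) (by simp [hl, hlk]) h3
        rw [this] at h4
        exact h4
      refine ⟨k, hkij, hlt, ?_⟩
      intro z hz
      obtain ⟨l, hlB, hl2⟩ := hy z
      have hlC : l ∈ C := (memC l).2 (by simpa using hlB)
      by_cases hlk : l = k
      · subst hlk
        exact hl2 x (Finset.mem_insert_self _ _)
      · exact absurd (hz l hlC hlk)
          (not_lt.2 (hl2 _ (Finset.mem_insert_of_mem ((memA _).1 (hmA l)))))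
    · have hkC : k ∈ C := (memC k).2 hyB
      have hs : ∀ a : X, ∃ l ∈ C, l ≠ k ∧ r l a ≤ r l (m l) := by
        intro a
        obtain ⟨l, hlB, hl2⟩ := hy a
        have h' : l ≠ k ∧ Sum.inr l ∉ B := by
          simpa [not_or] using hlB
        exact ⟨l, (memC l).2 h'.2, h'.1,
          hl2 _ (Finset.mem_insert_of_mem ((memA _).1 (hmA l)))⟩
      refine ⟨k, hk_ij k hkC ?_, rfl, ?_⟩
      · intro a ha
        obtain ⟨l, h1, h2, h3⟩ := hs a
        exact ⟨l, h1, h2, hr l (le_antisymm (hm l a ha) h3)⟩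
      · intro z hz
        obtain ⟨l, h1, h2, h3⟩ := hs z
        exact absurd (hz l h1 h2) (not_lt.2 h3)
  obtain ⟨yi, hyi⟩ := hPex i
  obtain ⟨yj, hyj⟩ := hPex j
  have hne : yi ≠ yj := by
    rintro rfl
    rcases yi with x | l
    · obtain ⟨l, hl, hlx⟩ := hDom x
      have h1 := hyi.1
      have h2 := hyj.1
      by_cases hli : l = i
      · subst hli
        exact absurd (h2 l hl hij) (not_lt.2 hlx)
      · exact absurd (h1 l hl hli) (not_lt.2 hlx)
    · exact hij (hyi.1.symm.trans hyj.1)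
  rw [Finset.card_eq_two]
  refine ⟨yi, yj, hne, ?_⟩
  ext y
  simp only [Finset.mem_filter, Finset.mem_univ, true_and, Finset.mem_insert,
    Finset.mem_singleton]
  constructor
  · rintro ⟨h1, h2⟩
    obtain ⟨k, hk, hP⟩ := hP_from y h1 h2
    rcases hk with rfl | rfl
    · exact Or.inl (hPuniq _ _ _ hP hyi)
    · exact Or.inr (hPuniq _ _ _ hP hyj)
  · rintro (rfl | rfl)
    · exact hP_to i hi (Or.inl rfl) _ hyi
    · exact hP_to j hj (Or.inr rfl) _ hyj

/-- Scarf's lemma. -/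
lemma scarf (r : I → X → L) (hr : ∀ i, Function.Injective (r i)) [Nonempty X] [Nonempty I]
    (c : X → I) : ∃ A : Finset X, A.Nonempty ∧
      ∀ y : X, ∃ i ∈ A.image c, ∀ a ∈ A, r i y ≤ r i a := by
  classical
  obtain ⟨i0⟩ := ‹Nonempty I›
  let c' : X ⊕ I → I := Sum.elim c id
  -- a rainbow cell is enough
  suffices hs : ∃ B : Finset (X ⊕ I), ScDom r B ∧ B.card = Fintype.card I ∧
      B.image c' = Finset.univ by
    obtain ⟨B, hD, hc, hB⟩ := hs
    have hinj : Set.InjOn c' B := by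
      apply Finset.card_image_iff.1
      rw [hB, hc, Finset.card_univ]
    refine ⟨Finset.univ.filter (fun a => Sum.inl a ∈ B), ?_, ?_⟩
    · by_contra hne
      rw [Finset.not_nonempty_iff_eq_empty, Finset.filter_eq_empty_iff] at hne
      obtain ⟨x⟩ := ‹Nonempty X›
      obtain ⟨i, hi, -⟩ := hD x
      have : i ∈ B.image c' := by rw [hB]; simp
      obtain ⟨y, hy, hyi⟩ := Finset.mem_image.1 this
      rcases y with y | y
      · exact hne (Finset.mem_univ y) hy
      · have : y = i := hyi
        exact hi (this ▸ hy)
    · intro y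
      obtain ⟨i, hi, hi2⟩ := hD y
      refine ⟨i, ?_, fun a ha => hi2 a (by simpa using ha)⟩
      have : i ∈ B.image c' := by rw [hB]; simp
      obtain ⟨z, hz, hzi⟩ := Finset.mem_image.1 this
      rcases z with z | z
      · exact Finset.mem_image.2 ⟨z, by simpa using hz, hzi⟩
      · have : z = i := hzi
        exact absurd (this ▸ hz) hi
  by_contra hcon
  push Not at hcon
  -- double counting
  let cells : Finset (Finset (X ⊕ I)) :=
    Finset.univ.filter (fun B => ScDom r B ∧ B.card = Fintype.card I)
  let doors : Finset (Finset (X ⊕ I)) :=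
    Finset.univ.filter (fun B => ScDom r B ∧ B.image c' = Finset.univ.erase i0 ∧
      B.card + 1 = Fintype.card I)
  let S : Finset ((Finset (X ⊕ I)) × (X ⊕ I)) := (cells ×ˢ Finset.univ).filter
    (fun q => q.2 ∈ q.1 ∧ (q.1.erase q.2).image c' = Finset.univ.erase i0)
  let S' : Finset ((Finset (X ⊕ I)) × (X ⊕ I)) := (doors ×ˢ Finset.univ).filter
    (fun q => q.2 ∉ q.1 ∧ ScDom r (insert q.2 q.1))
  have hSS : S.card = S'.card := by
    refine Finset.card_bij' (fun q _ => (q.1.erase q.2, q.2)) (fun q _ => (insert q.2 q.1, q.2))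
      ?_ ?_ ?_ ?_
    · rintro ⟨B, y⟩ h
      simp only [S, S', cells, doors, Finset.mem_filter, Finset.mem_product, Finset.mem_univ,
        true_and, and_true] at h ⊢
      obtain ⟨⟨hD, hB⟩, hy, hc⟩ := h
      refine ⟨⟨hD.mono (Finset.erase_subset _ _), hc, ?_⟩, by simp, ?_⟩
      · rw [Finset.card_erase_add_one hy, hB]
      · rwa [Finset.insert_erase hy]
    · rintro ⟨B, y⟩ h
      simp only [S, S', cells, doors, Finset.mem_filter, Finset.mem_product, Finset.mem_univ,
        true_and, and_true] at h ⊢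
      obtain ⟨⟨hD, hc, hB⟩, hy, hc2⟩ := h
      refine ⟨⟨hc2, ?_⟩, by simp, ?_⟩
      · rw [Finset.card_insert_of_notMem hy, hB]
      · rwa [Finset.erase_insert hy]
    · rintro ⟨B, y⟩ h
      simp only [S, Finset.mem_filter] at h
      simp [Finset.insert_erase h.2.1]
    · rintro ⟨B, y⟩ h
      simp only [S', Finset.mem_filter] at h
      simp [Finset.erase_insert h.2.1]
  have hS : Even S.card := by
    have : S.card = ∑ B ∈ cells, (B.filter
        (fun y => (B.erase y).image c' = Finset.univ.erase i0)).card := by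
      rw [Finset.card_filter, Finset.sum_product]
      refine Finset.sum_congr rfl fun B _ => ?_
      rw [← Finset.card_filter]
      congr 1
      ext y
      simp
    rw [this]
    refine Finset.even_sum _ fun B hB => ?_
    have hB' : ScDom r B ∧ B.card = Fintype.card I := by simpa [cells] using hB
    exact cell_count c' i0 B hB'.2 (hcon B hB'.1 hB'.2)
  have hS' : Odd S'.card := by
    have : S'.card = ∑ B ∈ doors, ((Finset.univ : Finset (X ⊕ I)).filter
        (fun y => y ∉ B ∧ ScDom r (insert y B))).card := by
      rw [Finset.card_filter, Finset.sum_product]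
      refine Finset.sum_congr rfl fun B _ => ?_
      rw [← Finset.card_filter]
    set B0 : Finset (X ⊕ I) := (Finset.univ.erase i0).image Sum.inr with hB0
    have hB0d : B0 ∈ doors := by
      simp only [doors, Finset.mem_filter, Finset.mem_univ, true_and]
      refine ⟨?_, ?_, ?_⟩
      · intro y
        exact ⟨i0, by simp [hB0], fun a ha => by simp [hB0] at ha⟩
      · rw [hB0, Finset.image_image]
        have : c' ∘ Sum.inr = id := rfl
        rw [this, Finset.image_id]
      · rw [hB0, Finset.card_image_of_injective _ Sum.inr_injective,
          Finset.card_erase_add_one (Finset.mem_univ _), Finset.card_univ]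
    rw [this, ← Finset.add_sum_erase _ _ hB0d, door_bdry r hr i0]
    rw [add_comm]
    refine Even.add_one (Finset.even_sum _ fun B hB => ?_)
    obtain ⟨hne, hB⟩ := Finset.mem_erase.1 hB
    have hB' : ScDom r B ∧ B.image c' = Finset.univ.erase i0 ∧ B.card + 1 = Fintype.card I := by
      simpa [doors] using hB
    rw [door_int r hr B hB'.1 hB'.2.2]
    · exact even_two
    · by_contra hA
      push Not at hA
      apply hne
      refine Finset.eq_of_subset_of_card_le ?_ ?_
      · intro y hy
        rcases y with y | y
        · exact absurd hy (hA y)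
        · have : y ∈ B.image c' := Finset.mem_image.2 ⟨_, hy, rfl⟩
          rw [hB'.2.1] at this
          exact Finset.mem_image.2 ⟨y, this, rfl⟩
      · rw [hB0, Finset.card_image_of_injective _ Sum.inr_injective,
          Finset.card_erase_of_mem (Finset.mem_univ _), Finset.card_univ]
        omega
  rw [hSS] at hS
  exact (Nat.not_even_iff_odd.2 hS') hS

end scarf

/-- Approximate Brouwer on the simplex. -/
lemma brouwer_approx {I : Type*} [Fintype I] [Nonempty I] (f : (I → ℝ) → (I → ℝ))
    (hf : ContinuousOn f (stdSimplex ℝ I)) (hm : ∀ x ∈ stdSimplex ℝ I, f x ∈ stdSimplex ℝ I)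
    (ε : ℝ) (hε : 0 < ε) : ∃ x ∈ stdSimplex ℝ I, ∀ i, x i - ε ≤ f x i := by
  classical
  have huc := (isCompact_stdSimplex ℝ I).uniformContinuousOn_of_continuous hf
  rw [Metric.uniformContinuousOn_iff] at huc
  obtain ⟨δ, hδ, huc⟩ := huc (ε / 2) (by positivity)
  set n := Fintype.card I with hn
  have hnpos : 0 < n := Fintype.card_pos
  obtain ⟨M, hM⟩ := exists_nat_gt (n / (min δ (ε / 2)))
  have hmin : 0 < min δ (ε / 2) := lt_min hδ (by positivity)
  have hM0 : (0 : ℝ) < M := lt_of_le_of_lt (by positivity) hM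
  have hM0' : 0 < M := by exact_mod_cast hM0
  have hnM : (n : ℝ) / M < min δ (ε / 2) := by
    rw [div_lt_iff₀ hmin] at hM
    rw [div_lt_iff₀ hM0]
    linarith
  let X := {k : I → ℕ // k ∈ Finset.piAntidiag (Finset.univ : Finset I) M}
  have hXsum : ∀ k : X, ∑ i, k.1 i = M := fun k => (Finset.mem_piAntidiag.1 k.2).1
  have mkX : ∀ k : I → ℕ, ∑ i, k i = M → k ∈ Finset.piAntidiag (Finset.univ : Finset I) M :=
    fun k hk => Finset.mem_piAntidiag.2 ⟨hk, by simp⟩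
  obtain ⟨i1⟩ := ‹Nonempty I›
  haveI : Nonempty I := ⟨i1⟩
  haveI : Nonempty X := ⟨⟨Pi.single i1 M, mkX _ (by simp)⟩⟩
  let pt : X → (I → ℝ) := fun k i => (k.1 i : ℝ) / M
  have hpt : ∀ k, pt k ∈ stdSimplex ℝ I := by
    intro k
    refine ⟨fun i => by positivity, ?_⟩
    simp only [pt]
    rw [← Finset.sum_div, ← Nat.cast_sum, hXsum, div_self hM0.ne']
  have hcol : ∀ k : X, ∃ i, pt k i ≤ f (pt k) i := by
    intro k
    by_contra hcon
    push Not at hcon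
    have h1 := (hpt k).2
    have h2 := (hm _ (hpt k)).2
    have : ∑ i, f (pt k) i < ∑ i, pt k i :=
      Finset.sum_lt_sum_of_nonempty Finset.univ_nonempty (fun i _ => hcon i)
    linarith
  choose c hc using hcol
  let e := Fintype.equivFin X
  let r : I → X → ℕ ×ₗ Fin (Fintype.card X) := fun i k => toLex (k.1 i, e k)
  have hr : ∀ i, Function.Injective (r i) := by
    intro i k k' h
    have : (k.1 i, e k) = (k'.1 i, e k') := toLex.injective h
    exact e.injective (Prod.ext_iff.1 this).2
  have hrlt : ∀ i (k k' : X), r i k ≤ r i k' → k.1 i ≤ k'.1 i := by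
    intro i k k' h
    have := (Prod.Lex.le_iff.1 h)
    rcases this with h | h
    · exact le_of_lt h
    · exact le_of_eq h.1
  obtain ⟨A, ⟨a0, ha0⟩, hdom⟩ := scarf r hr c
  set C := A.image c with hC
  have hCne : C.Nonempty := ⟨c a0, Finset.mem_image_of_mem _ ha0⟩
  have hmn : ∀ i : I, ∃ b ∈ A, ∀ a ∈ A, b.1 i ≤ a.1 i := fun i =>
    Finset.exists_min_image A (fun a => a.1 i) ⟨a0, ha0⟩
  choose b hbA hb using hmn
  -- the sum of minima is large
  have hsum : M < ∑ i ∈ C, (b i).1 i + n := by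
    by_contra hcon
    push Not at hcon
    have hCn : C.card ≤ n := Finset.card_le_univ C
    obtain ⟨j, hj⟩ := hCne
    set s := ∑ i ∈ C, ((b i).1 i + 1) with hs
    have hs' : s = ∑ i ∈ C, (b i).1 i + C.card := by
      rw [hs, Finset.sum_add_distrib]; simp
    have hsM : s ≤ M := by omega
    let y : I → ℕ := fun i => (if i ∈ C then (b i).1 i + 1 else 0) + (if i = j then M - s else 0)
    have hy : ∑ i, y i = M := by
      simp only [y, Finset.sum_add_distrib]
      rw [Finset.sum_ite_eq' Finset.univ j, if_pos (Finset.mem_univ _),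
        Finset.sum_ite_mem, Finset.univ_inter]
      rw [← hs]; omega
    obtain ⟨i, hi, hi2⟩ := hdom ⟨y, mkX y hy⟩
    have h1 := hrlt i _ _ (hi2 (b i) (hbA i))
    simp only [y, if_pos hi] at h1
    omega
  have hclose : ∀ a ∈ A, (∀ i ∈ C, (a.1 i : ℝ) ≤ (b i).1 i + n) ∧ ∀ i, i ∉ C → (a.1 i : ℝ) ≤ n := by
    intro a ha
    have h1 := hXsum a
    have hsplit : ∑ i ∈ C, a.1 i + ∑ i ∈ Cᶜ, a.1 i = M := by
      rw [Finset.sum_add_sum_compl, h1]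
    have hle : ∀ i ∈ C, (b i).1 i ≤ a.1 i := fun i _ => hb i a ha
    constructor
    · intro i hi
      have h2 : ∑ k ∈ C.erase i, (b k).1 k ≤ ∑ k ∈ C.erase i, a.1 k :=
        Finset.sum_le_sum fun k hk => hle k (Finset.mem_of_mem_erase hk)
      have h3 := Finset.add_sum_erase C (fun k => (b k).1 k) hi
      have h4 := Finset.add_sum_erase C (fun k => a.1 k) hi
      have : a.1 i ≤ (b i).1 i + n := by omega
      exact_mod_cast this
    · intro i hi
      have h2 : ∑ k ∈ C, (b k).1 k ≤ ∑ k ∈ C, a.1 k := Finset.sum_le_sum hle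
      have h3 : a.1 i ≤ ∑ k ∈ Cᶜ, a.1 k :=
        Finset.single_le_sum (f := fun k => a.1 k) (fun _ _ => Nat.zero_le _) (by simpa using hi)
      have : a.1 i ≤ n := by omega
      exact_mod_cast this
  refine ⟨pt a0, hpt a0, ?_⟩
  intro i
  by_cases hi : i ∈ C
  · obtain ⟨a, haA, hai⟩ := Finset.mem_image.1 hi
    have hd : dist (pt a) (pt a0) < δ := by
      rw [dist_pi_lt_iff hδ]
      intro k
      have hlt : (n : ℝ) / M < δ := hnM.trans_le (min_le_left _ _)
      refine lt_of_le_of_lt ?_ hlt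
      rw [Real.dist_eq]
      simp only [pt]
      rw [← sub_div, abs_div, abs_of_pos hM0]
      gcongr
      rw [abs_sub_le_iff]
      by_cases hk : k ∈ C
      · have h1 := (hclose a haA).1 k hk
        have h2 := (hclose a0 ha0).1 k hk
        have h3 : ((b k).1 k : ℝ) ≤ a.1 k := by exact_mod_cast hb k a haA
        have h4 : ((b k).1 k : ℝ) ≤ a0.1 k := by exact_mod_cast hb k a0 ha0
        constructor <;> linarith
      · have h1 := (hclose a haA).2 k hk
        have h2 := (hclose a0 ha0).2 k hk
        have h3 : (0 : ℝ) ≤ a.1 k := by positivity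
        have h4 : (0 : ℝ) ≤ a0.1 k := by positivity
        constructor <;> linarith
    have hfd := huc _ (hpt a) _ (hpt a0) hd
    have h1 : |f (pt a) i - f (pt a0) i| < ε / 2 := by
      rw [← Real.dist_eq]; exact lt_of_le_of_lt (dist_le_pi_dist _ _ i) hfd
    have h2 := hc a
    rw [hai] at h2
    have h3 := (abs_lt.1 h1)
    have h4 := (hclose a0 ha0).1 i hi
    have h5 : ((b i).1 i : ℝ) ≤ a.1 i := by exact_mod_cast hb i a haA
    have h6 : pt a0 i ≤ pt a i + n / M := by
      simp only [pt]
      rw [← add_div]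
      gcongr
      linarith
    have h7 := hnM.trans_le (min_le_right _ _)
    linarith [h3.1, h3.2]
  · have h2 := (hclose a0 ha0).2 i hi
    have h3 := (hm _ (hpt a0)).1 i
    have h4 : pt a0 i ≤ n / M := by
      simp only [pt]; gcongr
    have h7 := hnM.trans_le (min_le_right _ _)
    linarith

lemma brouwer {I : Type*} [Fintype I] [Nonempty I] (f : (I → ℝ) → (I → ℝ))
    (hf : ContinuousOn f (stdSimplex ℝ I)) (hm : ∀ x ∈ stdSimplex ℝ I, f x ∈ stdSimplex ℝ I) :
    ∃ x ∈ stdSimplex ℝ I, f x = x := by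
  classical
  have hne : (stdSimplex ℝ I).Nonempty := by
    obtain ⟨i⟩ := ‹Nonempty I›
    exact ⟨_, single_mem_stdSimplex ℝ i⟩
  have hcont : ContinuousOn (fun x => ∑ i, |f x i - x i|) (stdSimplex ℝ I) := by
    refine continuousOn_finsetSum _ fun i _ => ?_
    have h1 : ContinuousOn (fun x => f x i) (stdSimplex ℝ I) :=
      (continuous_apply i).comp_continuousOn hf
    exact (h1.sub (continuous_apply i).continuousOn).abs
  obtain ⟨x, hx, hmin⟩ := (isCompact_stdSimplex ℝ I).exists_isMinOn hne hcont
  refine ⟨x, hx, ?_⟩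
  have hzero : ∑ i, |f x i - x i| ≤ 0 := by
    refine le_of_forall_pos_le_add fun ε hε => ?_
    set n : ℝ := (Fintype.card I : ℝ) with hn
    have hn0 : 0 < n := by rw [hn]; exact Nat.cast_pos.2 Fintype.card_pos
    obtain ⟨y, hy, hyf⟩ := brouwer_approx f hf hm (ε / (2 * n)) (by positivity)
    have h1 : ∑ i, |f x i - x i| ≤ ∑ i, |f y i - y i| := hmin hy
    have h2 : ∀ i, |f y i - y i| ≤ (f y i - y i) + 2 * (ε / (2 * n)) := by
      intro i
      have := hyf i
      rcases abs_cases (f y i - y i) with h | h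
      · rw [h.1]
        have : 0 < ε / (2 * n) := by positivity
        linarith
      · rw [h.1]; linarith
    have h3 : ∑ i, |f y i - y i| ≤ ∑ i, ((f y i - y i) + 2 * (ε / (2 * n))) :=
      Finset.sum_le_sum fun i _ => h2 i
    rw [Finset.sum_add_distrib, Finset.sum_sub_distrib, (hm y hy).2, hy.2] at h3
    simp only [Finset.sum_const, Finset.card_univ, nsmul_eq_mul, ← hn] at h3
    have : n * (2 * (ε / (2 * n))) = ε := by field_simp
    linarith
  have hz : ∀ i, |f x i - x i| = 0 := by
    intro i
    have := Finset.single_le_sum (f := fun i => |f x i - x i|) (fun i _ => abs_nonneg _)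
      (Finset.mem_univ i)
    exact le_antisymm (this.trans hzero) (abs_nonneg _)
  funext i
  have := abs_eq_zero.1 (hz i)
  linarith

/-- Schauder's fixed point theorem. -/
theorem schauder {E : Type*} [NormedAddCommGroup E] [NormedSpace ℝ E] (S : Set E)
    (hS : IsCompact S) (hconv : Convex ℝ S) (hne : S.Nonempty) (f : E → E)
    (hf : ContinuousOn f S) (hm : MapsTo f S S) : ∃ x ∈ S, f x = x := by
  classical
  have hcont : ContinuousOn (fun x => ‖f x - x‖) S := (hf.sub continuousOn_id).norm
  obtain ⟨x, hx, hmin⟩ := hS.exists_isMinOn hne hcont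
  refine ⟨x, hx, ?_⟩
  have hzero : ‖f x - x‖ ≤ 0 := by
    refine le_of_forall_pos_le_add fun ε hε => ?_
    rw [zero_add]
    obtain ⟨t, htS, htf, hcov⟩ := hS.finite_cover_balls hε
    haveI : Fintype t := htf.fintype
    have hcov' : ∀ y ∈ S, ∃ i : t, dist y i < ε := by
      intro y hy
      obtain ⟨z, hz, hz2⟩ := mem_iUnion₂.1 (hcov hy)
      exact ⟨⟨z, hz⟩, hz2⟩
    haveI : Nonempty t := by
      obtain ⟨y, hy⟩ := hne
      obtain ⟨i, -⟩ := hcov' y hy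
      exact ⟨i⟩
    let q : t → E → ℝ := fun i y => max 0 (ε - dist y i)
    let Q : E → ℝ := fun y => ∑ i, q i y
    have hq0 : ∀ i y, 0 ≤ q i y := fun i y => le_max_left _ _
    have hqc : ∀ i, Continuous (q i) := fun i => by simp only [q]; fun_prop
    have hQc : Continuous Q := by simp only [Q]; exact continuous_finsetSum _ fun i _ => hqc i
    have hQpos : ∀ y ∈ S, 0 < Q y := by
      intro y hy
      obtain ⟨i, hi⟩ := hcov' y hy
      refine Finset.sum_pos' (fun i _ => hq0 i y) ⟨i, Finset.mem_univ _, ?_⟩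
      exact lt_max_of_lt_right (by linarith)
    let σ : (t → ℝ) → E := fun w => ∑ i, w i • (i : E)
    have hσc : Continuous σ := by simp only [σ]; fun_prop
    have hσS : ∀ w ∈ stdSimplex ℝ t, σ w ∈ S := fun w hw =>
      hconv.sum_mem (fun i _ => hw.1 i) hw.2 (fun i _ => htS i.2)
    let F : (t → ℝ) → (t → ℝ) := fun w i => q i (f (σ w)) / Q (f (σ w))
    obtain ⟨w, hw, hFw⟩ := brouwer F (by
      rw [continuousOn_pi]
      intro i
      have h1 : ContinuousOn (fun w => f (σ w)) (stdSimplex ℝ t) :=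
        hf.comp hσc.continuousOn hσS
      refine ((hqc i).comp_continuousOn h1).div (hQc.comp_continuousOn h1) ?_
      intro w hw
      exact (hQpos _ (hm (hσS w hw))).ne') (by
      intro w hw
      have hQ := hQpos _ (hm (hσS w hw))
      refine ⟨fun i => div_nonneg (hq0 _ _) hQ.le, ?_⟩
      simp only [F]
      rw [← Finset.sum_div]
      exact div_self hQ.ne')
    have hle : ‖f x - x‖ ≤ ‖f (σ w) - σ w‖ := hmin (hσS w hw)
    refine hle.trans ?_
    set y := f (σ w) with hy
    have hyS : y ∈ S := hm (hσS w hw)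
    have hσw : y - σ w = ∑ i, w i • (y - (i : E)) := by
      simp only [smul_sub, Finset.sum_sub_distrib, ← Finset.sum_smul, hw.2, one_smul, σ]
    rw [hσw]
    calc ‖∑ i, w i • (y - (i : E))‖ ≤ ∑ i, ‖w i • (y - (i : E))‖ := norm_sum_le _ _
      _ ≤ ∑ i, w i * ε := by
          refine Finset.sum_le_sum fun i _ => ?_
          rw [norm_smul, Real.norm_eq_abs, abs_of_nonneg (hw.1 i)]
          by_cases hi : dist y i < ε
          · rw [dist_eq_norm] at hi
            exact mul_le_mul_of_nonneg_left hi.le (hw.1 i)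
          · have : w i = 0 := by
              rw [← hFw]
              simp only [F, q, ← hy]
              rw [max_eq_left (by linarith [not_lt.1 hi]), zero_div]
            simp [this]
      _ = ε := by rw [← Finset.sum_mul, hw.2, one_mul]
  exact sub_eq_zero.1 (norm_eq_zero.1 (le_antisymm hzero (norm_nonneg _)))

end HW

namespace HW

theorem normSq_exp_sub_one (w : ℂ) : ‖Complex.exp w - 1‖ ^ 2
    = (Real.exp w.re) ^ 2 - 2 * Real.exp w.re * Real.cos w.im + 1 := by
  rw [← Complex.normSq_eq_norm_sq, Complex.normSq_apply]
  simp only [Complex.sub_re, Complex.sub_im, Complex.exp_re, Complex.exp_im, Complex.one_re,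
    Complex.one_im]
  nlinarith [Real.sin_sq_add_cos_sq w.im]

theorem normSq_lower (r c m : ℝ) (hr : 0 ≤ r) (hm2 : m ≤ 1) (hc : c ≤ 1 - m) :
    m * (1 + r ^ 2) ≤ r ^ 2 - 2 * r * c + 1 := by
  nlinarith [sq_nonneg (r - 1), mul_nonneg hr (sub_nonneg.2 hc), mul_nonneg (sub_nonneg.2 hm2) (sq_nonneg (r-1))]

/-- The complex integrand. -/
noncomputable def fk (α : ℝ) (ζ : ℂ) (t : ℝ) : ℂ :=
  ((t ^ (α - 1) : ℝ) : ℂ) * (Complex.exp (t - Complex.I * ζ) - 1)⁻¹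

/-- Its derivative. -/
noncomputable def fk' (α : ℝ) (ζ : ℂ) (t : ℝ) : ℂ :=
  ((t ^ (α - 1) : ℝ) : ℂ) * (Complex.I * Complex.exp (t - Complex.I * ζ) /
    (Complex.exp (t - Complex.I * ζ) - 1) ^ 2)

/-- The holomorphic extension of the kernel. -/
noncomputable def Fk (α : ℝ) (ζ : ℂ) : ℂ := ∫ t in Ioi (0:ℝ), fk α ζ t

theorem arg_re (ζ : ℂ) (t : ℝ) : ((t:ℂ) - Complex.I * ζ).re = t + ζ.im := by simp
theorem arg_im (ζ : ℂ) (t : ℝ) : ((t:ℂ) - Complex.I * ζ).im = - ζ.re := by simp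

theorem den_lower (m : ℝ) (hm : 0 < m) (hm2 : m ≤ 1) (ζ : ℂ) (hc : Real.cos ζ.re ≤ 1 - m) (t : ℝ) :
    m * (1 + (Real.exp (t + ζ.im)) ^ 2) ≤ ‖Complex.exp (t - Complex.I * ζ) - 1‖ ^ 2 := by
  rw [normSq_exp_sub_one, arg_re, arg_im, Real.cos_neg]
  exact normSq_lower _ _ _ (Real.exp_pos _).le hm2 hc

theorem den_ne (ζ : ℂ) (hc : Real.cos ζ.re < 1) (t : ℝ) :
    Complex.exp (t - Complex.I * ζ) - 1 ≠ 0 := by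
  intro h
  have h1 := normSq_exp_sub_one (t - Complex.I * ζ)
  rw [h, arg_re, arg_im, Real.cos_neg] at h1
  simp at h1
  nlinarith [Real.exp_pos (t + ζ.im), sq_nonneg (Real.exp (t + ζ.im) - 1)]

theorem fk_bound (α m : ℝ) (hm : 0 < m) (hm2 : m ≤ 1) (ζ : ℂ) (hc : Real.cos ζ.re ≤ 1 - m) (t : ℝ)
    (ht : 0 < t) : ‖fk α ζ t‖ ≤ m⁻¹ * Real.exp (-ζ.im) * (Real.exp (-t) * t ^ (α - 1)) := by
  have h1 := den_lower m hm hm2 ζ hc t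
  set N := ‖Complex.exp (t - Complex.I * ζ) - 1‖ with hN
  have hE : 0 < Real.exp (t + ζ.im) := Real.exp_pos _
  have hN0 : 0 ≤ N := norm_nonneg _
  have h2 : m * Real.exp (t + ζ.im) ≤ N := by
    apply le_of_sq_le_sq _ hN0
    nlinarith [mul_pos hE hE, mul_pos hm (mul_pos hE hE)]
  have h3 : 0 < m * Real.exp (t + ζ.im) := by positivity
  rw [fk, norm_mul, norm_inv, ← hN, Complex.norm_real, Real.norm_of_nonneg (by positivity)]
  have h4 : N⁻¹ ≤ m⁻¹ * Real.exp (-ζ.im) * Real.exp (-t) := by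
    calc N⁻¹ ≤ (m * Real.exp (t + ζ.im))⁻¹ := inv_anti₀ h3 h2
      _ = _ := by rw [mul_inv, ← Real.exp_neg, mul_assoc, ← Real.exp_add]; ring_nf
  have h5 : 0 ≤ t ^ (α - 1) := by positivity
  nlinarith [mul_le_mul_of_nonneg_left h4 h5]

theorem fk'_bound (α m : ℝ) (hm : 0 < m) (hm2 : m ≤ 1) (ζ : ℂ) (hc : Real.cos ζ.re ≤ 1 - m) (t : ℝ)
    (ht : 0 < t) : ‖fk' α ζ t‖ ≤ m⁻¹ * Real.exp (-ζ.im) * (Real.exp (-t) * t ^ (α - 1)) := by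
  have h1 := den_lower m hm hm2 ζ hc t
  have hE : 0 < Real.exp (t + ζ.im) := Real.exp_pos _
  rw [fk', norm_mul, norm_div, norm_pow, norm_mul, Complex.norm_I, one_mul, Complex.norm_exp,
    arg_re, Complex.norm_real, Real.norm_of_nonneg (by positivity)]
  set N := ‖Complex.exp (t - Complex.I * ζ) - 1‖ ^ 2 with hN
  have h3 : 0 < m * (1 + (Real.exp (t + ζ.im)) ^ 2) := by positivity
  have h4 : Real.exp (t + ζ.im) / N ≤ m⁻¹ * Real.exp (-ζ.im) * Real.exp (-t) := by
    calc Real.exp (t + ζ.im) / N ≤ Real.exp (t + ζ.im) / (m * (Real.exp (t + ζ.im) * Real.exp (t + ζ.im))) := by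
          gcongr
          nlinarith
      _ = m⁻¹ * (Real.exp (t + ζ.im))⁻¹ := by field_simp
      _ = _ := by rw [← Real.exp_neg, mul_assoc, ← Real.exp_add]; ring_nf
  have h5 : 0 ≤ t ^ (α - 1) := by positivity
  nlinarith [mul_le_mul_of_nonneg_left h4 h5]

theorem gamma_int (α : ℝ) (hα : 0 < α) :
    IntegrableOn (fun t : ℝ => Real.exp (-t) * t ^ (α - 1)) (Ioi 0) :=
  Real.GammaIntegral_convergent hα

theorem fk_meas (α : ℝ) (ζ : ℂ) : Measurable (fk α ζ) := by
  unfold fk; fun_prop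
theorem fk'_meas (α : ℝ) (ζ : ℂ) : Measurable (fk' α ζ) := by
  unfold fk'; fun_prop

theorem fk_integrable (α : ℝ) (hα : 0 < α) (ζ : ℂ) (hc : Real.cos ζ.re < 1) :
    IntegrableOn (fk α ζ) (Ioi 0) := by
  have hm : 0 < min 1 (1 - Real.cos ζ.re) := lt_min one_pos (by linarith)
  refine Integrable.mono' ((gamma_int α hα).const_mul ((min 1 (1 - Real.cos ζ.re))⁻¹ * Real.exp (-ζ.im)))
    (fk_meas α ζ).aestronglyMeasurable ?_
  filter_upwards [ae_restrict_mem measurableSet_Ioi] with t ht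
  exact fk_bound α _ hm (min_le_left _ _) ζ (by linarith [min_le_right 1 (1 - Real.cos ζ.re)]) t ht

theorem fk_hasDeriv (α : ℝ) (ζ : ℂ) (hc : Real.cos ζ.re < 1) (t : ℝ) :
    HasDerivAt (fun z => fk α z t) (fk' α ζ t) ζ := by
  unfold fk fk'
  have h1 : HasDerivAt (fun z : ℂ => (t:ℂ) - Complex.I * z) (- (Complex.I * 1)) ζ :=
    ((hasDerivAt_id ζ).const_mul Complex.I).const_sub _
  have h2 := ((h1.cexp.sub_const 1).inv (den_ne ζ hc t)).const_mul ((t ^ (α - 1) : ℝ) : ℂ)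
  refine h2.congr_deriv ?_
  ring

theorem Fk_hasDeriv (α : ℝ) (hα : 0 < α) (ζ : ℂ) (hc : Real.cos ζ.re < 1) :
    HasDerivAt (Fk α) (∫ t in Ioi (0:ℝ), fk' α ζ t) ζ := by
  set m := min 1 ((1 - Real.cos ζ.re)/2) with hmdef
  have hm : 0 < m := lt_min one_pos (by linarith)
  have hU : {z : ℂ | Real.cos z.re < 1 - m ∧ -z.im < -ζ.im + 1} ∈ 𝓝 ζ := by
    apply IsOpen.mem_nhds
    · have h1 : Continuous fun z : ℂ => Real.cos z.re := Real.continuous_cos.comp Complex.continuous_re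
      have h2 : Continuous fun z : ℂ => -z.im := Complex.continuous_im.neg
      exact (isOpen_lt h1 continuous_const).inter (isOpen_lt h2 continuous_const)
    · constructor
      · have := min_le_right 1 ((1 - Real.cos ζ.re)/2)
        linarith
      · linarith
  refine (hasDerivAt_integral_of_dominated_loc_of_deriv_le
    (bound := fun t => m⁻¹ * Real.exp (-ζ.im + 1) * (Real.exp (-t) * t ^ (α - 1))) hU
    ?_ (fk_integrable α hα ζ hc) (fk'_meas α ζ).aestronglyMeasurable ?_ ?_ ?_).2
  · exact Eventually.of_forall fun z => (fk_meas α z).aestronglyMeasurable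
  · filter_upwards [ae_restrict_mem measurableSet_Ioi] with t ht z hz
    refine (fk'_bound α m hm (min_le_left _ _) z hz.1.le t ht).trans ?_
    have : 0 ≤ t ^ (α - 1) := Real.rpow_nonneg (le_of_lt ht) _
    have h2 := hz.2
    gcongr
  · exact (gamma_int α hα).const_mul _
  · refine Eventually.of_forall fun t z hz => fk_hasDeriv α z ?_ t
    linarith [hz.1]

theorem Fk_re (α x : ℝ) (hα : 0 < α) (hx : Real.cos x < 1) :
    (Fk α x).re = ∫ t in Set.Ioi (0:ℝ),
      t ^ (α - 1) * (Real.exp t * Real.cos x - 1) /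
        (1 - 2 * Real.exp t * Real.cos x + Real.exp (2 * t)) := by
  unfold Fk
  rw [← Complex.reCLM_apply, ← ContinuousLinearMap.integral_comp_comm _
    (fk_integrable α hα x (by simpa using hx))]
  refine integral_congr_ae (Eventually.of_forall fun t => ?_)
  simp only [fk, Complex.reCLM_apply, Complex.re_ofReal_mul, Complex.inv_re]
  rw [Complex.normSq_eq_norm_sq, normSq_exp_sub_one, mul_div_assoc, arg_re, arg_im]
  congr 2
  · simp [Complex.exp_re]
  · simp; rw [two_mul t, Real.exp_add]; ring

theorem cos_lt_one_of_mem (x : ℝ) (hx : x ∈ Ioo 0 (2 * π)) : Real.cos x < 1 := by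
  refine lt_of_le_of_ne (Real.cos_le_one x) fun h => ?_
  obtain ⟨k, hk⟩ := (Real.cos_eq_one_iff x).1 h
  have hpi := Real.pi_pos
  have h1 : (0:ℝ) < k := by
    by_contra hc; push Not at hc
    have := hx.1; nlinarith
  have h2 : (k:ℝ) < 1 := by
    by_contra hc; push Not at hc
    have := hx.2; nlinarith
  have h3 : (0:ℤ) < k := by exact_mod_cast h1
  have h4 : k < 1 := by exact_mod_cast h2
  omega

theorem Kker_eq (α x : ℝ) (hα : 0 < α) (hx : Real.cos x < 1) :
    Kker α x = (1 / (π * Real.Gamma α)) * (Fk α x).re := by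
  rw [Fk_re α x hα hx, Kker, if_neg]
  rintro ⟨k, hk⟩
  have : Real.cos x = 1 := (Real.cos_eq_one_iff x).2 ⟨k, by rw [hk]; ring⟩
  linarith

theorem Kker_even (α x : ℝ) : Kker α (-x) = Kker α x := by
  unfold Kker
  simp only [Real.cos_neg]
  congr 1
  apply propext
  constructor
  · rintro ⟨k, hk⟩; exact ⟨-k, by push_cast; linarith⟩
  · rintro ⟨k, hk⟩; exact ⟨-k, by push_cast; linarith⟩

theorem Kker_per (α x : ℝ) : Kker α (x + 2 * π) = Kker α x := by
  unfold Kker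
  simp only [Real.cos_add_two_pi]
  congr 1
  apply propext
  constructor
  · rintro ⟨k, hk⟩; exact ⟨k - 1, by push_cast; linarith⟩
  · rintro ⟨k, hk⟩; exact ⟨k + 1, by push_cast; linarith⟩

/-- The strip where the extension is holomorphic. -/
def Strip : Set ℂ := {z : ℂ | Real.cos z.re < 1}

theorem strip_open : IsOpen Strip :=
  isOpen_lt (Real.continuous_cos.comp Complex.continuous_re) continuous_const

theorem Fk_diff (α : ℝ) (hα : 0 < α) : DifferentiableOn ℂ (Fk α) Strip := fun z hz =>
  (Fk_hasDeriv α hα z hz).differentiableAt.differentiableWithinAt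

theorem mem_strip {x : ℝ} (hx : x ∈ Ioo 0 (2 * π)) : (x : ℂ) ∈ Strip := by
  simpa [Strip] using cos_lt_one_of_mem x hx

/-- normalisation constant -/
noncomputable def cG (α : ℝ) : ℝ := 1 / (π * Real.Gamma α)

theorem cG_pos (α : ℝ) (hα : 0 < α) : 0 < cG α := by
  have := Real.Gamma_pos_of_pos hα
  unfold cG; positivity

theorem Kker_hasDeriv (α : ℝ) (hα : 0 < α) (x : ℝ) (hx : x ∈ Ioo 0 (2 * π)) :
    HasDerivAt (Kker α) (cG α * (deriv (Fk α) x).re) x := by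
  have h1 : HasDerivAt (Fk α) (deriv (Fk α) x) (x:ℂ) :=
    ((Fk_diff α hα).differentiableAt (strip_open.mem_nhds (mem_strip hx))).hasDerivAt
  refine ((h1.real_of_complex).const_mul (cG α)).congr_of_eventuallyEq ?_
  filter_upwards [isOpen_Ioo.mem_nhds hx] with y hy
  exact Kker_eq α y hα (cos_lt_one_of_mem y hy)

theorem Kker_hasDeriv2 (α : ℝ) (hα : 0 < α) (x : ℝ) (hx : x ∈ Ioo 0 (2 * π)) :
    HasDerivAt (deriv (Kker α)) (cG α * (deriv (deriv (Fk α)) x).re) x := by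
  have h0 : DifferentiableOn ℂ (deriv (Fk α)) Strip := (Fk_diff α hα).deriv strip_open
  have h1 : HasDerivAt (deriv (Fk α)) (deriv (deriv (Fk α)) x) (x:ℂ) :=
    (h0.differentiableAt (strip_open.mem_nhds (mem_strip hx))).hasDerivAt
  refine ((h1.real_of_complex).const_mul (cG α)).congr_of_eventuallyEq ?_
  filter_upwards [isOpen_Ioo.mem_nhds hx] with y hy
  exact (Kker_hasDeriv α hα y hy).deriv

theorem Kker_smooth (α : ℝ) (hα : 0 < α) :
    ContDiffOn ℝ (⊤ : ℕ∞) (Kker α) (Ioo 0 (2 * π)) := by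
  have h1 : ContDiffOn ℂ (⊤ : ℕ∞) (Fk α) Strip := (Fk_diff α hα).contDiffOn strip_open
  have h2 : ContDiffOn ℝ (⊤ : ℕ∞) (Fk α) Strip := h1.restrict_scalars ℝ
  have h3 : ContDiffOn ℝ (⊤ : ℕ∞) (fun x : ℝ => (Fk α x)) (Ioo 0 (2 * π)) :=
    h2.comp (Complex.ofRealCLM.contDiff.contDiffOn) fun x hx => mem_strip hx
  have h4 : ContDiffOn ℝ (⊤ : ℕ∞) (fun x : ℝ => cG α * (Fk α x).re) (Ioo 0 (2 * π)) :=
    contDiffOn_const.mul (Complex.reCLM.contDiff.comp_contDiffOn h3)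
  exact h4.congr fun y hy => Kker_eq α y hα (cos_lt_one_of_mem y hy)

theorem Fk_small (α : ℝ) (hα : α ∈ Ioo (0:ℝ) 1) (x : ℝ) (hx : x ∈ Ioc (0:ℝ) 1) (ζ : ℂ)
    (h1 : x / 2 ≤ ζ.re) (h2 : ζ.re ≤ 3 * x / 2) (h3 : -(x / 2) ≤ ζ.im) :
    ‖Fk α ζ‖ ≤ (2 * π / α + 2 / (1 - α)) * x ^ (α - 1) := by
  obtain ⟨hα0, hα1⟩ := hα
  obtain ⟨hx0, hx1⟩ := hx
  have hpi := Real.pi_gt_three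
  have hcos : Real.cos ζ.re < 1 := cos_lt_one_of_mem _ ⟨by linarith, by linarith⟩
  have hInt0 := fk_integrable α hα0 ζ hcos
  have hA : ∀ t ∈ Ioc (0:ℝ) x, ‖fk α ζ t‖ ≤ (2 * π / x) * t ^ (α - 1) := by
    intro t ht
    have hs : x / π ≤ Real.sin ζ.re := by
      have := Real.mul_le_sin (x := ζ.re) (by linarith) (by linarith)
      have h5 : 2 / π * (x / 2) ≤ 2 / π * ζ.re := by gcongr
      calc x / π = 2 / π * (x / 2) := by ring
        _ ≤ _ := h5.trans this
    have hE : (1:ℝ) / 2 ≤ Real.exp (t + ζ.im) := by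
      have := Real.add_one_le_exp (t + ζ.im)
      linarith [ht.1]
    have hN : x / (2 * π) ≤ ‖Complex.exp (t - Complex.I * ζ) - 1‖ := by
      refine le_trans ?_ (Complex.abs_im_le_norm _)
      rw [Complex.sub_im, Complex.exp_im, arg_re, arg_im, Complex.one_im, sub_zero,
        Real.sin_neg, mul_neg, abs_neg]
      refine le_trans ?_ (le_abs_self _)
      calc x / (2 * π) = 1 / 2 * (x / π) := by ring
        _ ≤ _ := by gcongr
    rw [fk, norm_mul, norm_inv, Complex.norm_real, Real.norm_of_nonneg (Real.rpow_nonneg ht.1.le _),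
      mul_comm]
    have h6 : 0 < x / (2 * π) := by positivity
    have h7 := inv_anti₀ h6 hN
    rw [inv_div] at h7
    exact mul_le_mul_of_nonneg_right h7 (Real.rpow_nonneg ht.1.le _)
  have hB : ∀ t ∈ Ioi x, ‖fk α ζ t‖ ≤ 2 * t ^ (α - 2) := by
    intro t ht
    have ht' : x < t := ht
    have ht0 : 0 < t := hx0.trans ht'
    have hN : t / 2 ≤ ‖Complex.exp (t - Complex.I * ζ) - 1‖ := by
      have h5 := norm_sub_norm_le (Complex.exp (t - Complex.I * ζ)) 1
      rw [Complex.norm_exp, arg_re, norm_one] at h5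
      have := Real.add_one_le_exp (t + ζ.im)
      linarith
    rw [fk, norm_mul, norm_inv, Complex.norm_real, Real.norm_of_nonneg (Real.rpow_nonneg ht0.le _),
      mul_comm]
    have h7 := inv_anti₀ (by positivity) hN
    calc _ ≤ (t / 2)⁻¹ * t ^ (α - 1) := mul_le_mul_of_nonneg_right h7 (Real.rpow_nonneg ht0.le _)
      _ = 2 * t ^ (α - 2) := by
        rw [show α - 2 = (α - 1) - 1 by ring, Real.rpow_sub_one ht0.ne' (α - 1)]; field_simp
  have hsplit : Ioi (0:ℝ) = Ioc 0 x ∪ Ioi x := (Ioc_union_Ioi_eq_Ioi hx0.le).symm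
  have hdis : Disjoint (Ioc 0 x) (Ioi x) := Ioc_disjoint_Ioi le_rfl
  have i1 : IntegrableOn (fk α ζ) (Ioc 0 x) := hInt0.mono_set (by rw [hsplit]; exact subset_union_left)
  have i2 : IntegrableOn (fk α ζ) (Ioi x) := hInt0.mono_set (by rw [hsplit]; exact subset_union_right)
  have e1 : ∫ t in (0:ℝ)..x, t ^ (α - 1) = x ^ α / α := by
    rw [integral_rpow (Or.inl (by linarith))]
    rw [sub_add_cancel, Real.zero_rpow hα0.ne', sub_zero]
  have e2 : ∫ t in Ioi x, t ^ (α - 2) = x ^ (α - 1) / (1 - α) := by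
    rw [integral_Ioi_rpow_of_lt (by linarith) hx0, show α - 2 + 1 = α - 1 by ring,
      ← neg_sub α 1, div_neg, neg_div]
  have j1 : IntegrableOn (fun t : ℝ => (2 * π / x) * t ^ (α - 1)) (Ioc 0 x) := by
    rw [← intervalIntegrable_iff_integrableOn_Ioc_of_le hx0.le]
    exact (intervalIntegral.intervalIntegrable_rpow' (by linarith)).const_mul _
  have j2 : IntegrableOn (fun t : ℝ => 2 * t ^ (α - 2)) (Ioi x) :=
    (integrableOn_Ioi_rpow_of_lt (by linarith) hx0).const_mul _
  have b1 : ‖∫ t in Ioc 0 x, fk α ζ t‖ ≤ 2 * π / α * x ^ (α - 1) := by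
    refine (norm_integral_le_integral_norm _).trans ?_
    refine (setIntegral_mono_on i1.norm j1 measurableSet_Ioc hA).trans ?_
    rw [integral_const_mul, ← intervalIntegral.integral_of_le hx0.le, e1, Real.rpow_sub_one hx0.ne']
    apply le_of_eq; field_simp
  have b2 : ‖∫ t in Ioi x, fk α ζ t‖ ≤ 2 / (1 - α) * x ^ (α - 1) := by
    refine (norm_integral_le_integral_norm _).trans ?_
    refine (setIntegral_mono_on i2.norm j2 measurableSet_Ioi hB).trans ?_
    rw [integral_const_mul, e2]
    apply le_of_eq; ring
  rw [Fk, hsplit, setIntegral_union hdis measurableSet_Ioi i1 i2, add_mul]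
  exact (norm_add_le _ _).trans (add_le_add b1 b2)

theorem disc_bounds (x : ℝ) (ζ : ℂ) (h : dist ζ (x:ℂ) ≤ x / 2) :
    x / 2 ≤ ζ.re ∧ ζ.re ≤ 3 * x / 2 ∧ -(x / 2) ≤ ζ.im := by
  rw [Complex.dist_eq] at h
  have h1 := (Complex.abs_re_le_norm (ζ - x)).trans h
  have h2 := (Complex.abs_im_le_norm (ζ - x)).trans h
  simp only [Complex.sub_re, Complex.ofReal_re, Complex.sub_im, Complex.ofReal_im] at h1 h2
  rw [abs_le] at h1 h2
  refine ⟨by linarith, by linarith, by linarith⟩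

theorem Kker_bd1 (α : ℝ) (hα : α ∈ Ioo (0:ℝ) 1) : ∃ C > 0, ∀ x ∈ Ioc (0:ℝ) 1,
    |Kker α x| ≤ C * x ^ (α - 1) ∧ |deriv (Kker α) x| ≤ C * x ^ (α - 2) ∧
    |deriv (deriv (Kker α)) x| ≤ C * x ^ (α - 3) := by
  have h1α : 0 < 1 - α := by linarith [hα.2]
  have hα0 := hα.1
  have hG := cG_pos α hα0
  have hpi := Real.pi_gt_three
  set A := 2 * π / α + 2 / (1 - α) with hA
  have hA0 : 0 < A := by positivity
  refine ⟨8 * cG α * A, by positivity, fun x hx => ?_⟩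
  have hx0 := hx.1
  have hx2 : x ∈ Ioo 0 (2 * π) := ⟨hx.1, by linarith [hx.2]⟩
  have hsub : Metric.closedBall (x:ℂ) (x / 2) ⊆ Strip := by
    intro ζ hζ
    obtain ⟨a, b, c⟩ := disc_bounds x ζ hζ
    exact cos_lt_one_of_mem _ ⟨by linarith, by linarith [hx.2]⟩
  have hDC : DiffContOnCl ℂ (Fk α) (Metric.ball (x:ℂ) (x / 2)) := by
    refine ((Fk_diff α hα0).mono ?_).diffContOnCl
    rw [closure_ball _ (by linarith)]
    exact hsub
  have hbd : ∀ ζ ∈ Metric.sphere (x:ℂ) (x / 2), ‖Fk α ζ‖ ≤ A * x ^ (α - 1) := by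
    intro ζ hζ
    obtain ⟨a, b, c⟩ := disc_bounds x ζ (le_of_eq hζ)
    exact Fk_small α hα x hx ζ a b c
  have c0 : ‖Fk α x‖ ≤ A * x ^ (α - 1) :=
    Fk_small α hα x hx x (by simp; linarith) (by simp; linarith) (by simp; linarith)
  have c1 := Complex.norm_iteratedDeriv_le_of_forall_mem_sphere_norm_le 1 (by linarith) hDC hbd
  have c2 := Complex.norm_iteratedDeriv_le_of_forall_mem_sphere_norm_le 2 (by linarith) hDC hbd
  rw [iteratedDeriv_one] at c1
  rw [iteratedDeriv_succ, iteratedDeriv_one] at c2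
  have r1 : x ^ (α - 2) = x ^ (α - 1) / x := by
    rw [show α - 2 = (α - 1) - 1 by ring, Real.rpow_sub_one hx0.ne']
  have r2 : x ^ (α - 3) = x ^ (α - 1) / x / x := by
    rw [show α - 3 = (α - 1) - 1 - 1 by ring, Real.rpow_sub_one hx0.ne', Real.rpow_sub_one hx0.ne']
  have hX : 0 < x ^ (α - 1) := Real.rpow_pos_of_pos hx0 _
  have key : ∀ (z : ℂ) (B : ℝ), ‖z‖ ≤ B → |cG α * z.re| ≤ cG α * B := by
    intro z B hz
    rw [abs_mul, abs_of_pos hG]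
    exact mul_le_mul_of_nonneg_left ((Complex.abs_re_le_norm z).trans hz) hG.le
  refine ⟨?_, ?_, ?_⟩
  · rw [Kker_eq α x hα0 (cos_lt_one_of_mem x hx2)]
    refine (key _ _ c0).trans ?_
    nlinarith [mul_pos (mul_pos hG hA0) hX]
  · rw [(Kker_hasDeriv α hα0 x hx2).deriv, r1]
    refine (key _ _ c1).trans ?_
    have : cG α * (((Nat.factorial 1 : ℕ):ℝ) * (A * x ^ (α - 1)) / (x / 2) ^ 1) = 2 * cG α * A * (x ^ (α - 1) / x) := by
      simp; field_simp
    rw [this]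
    gcongr; norm_num
  · rw [(Kker_hasDeriv2 α hα0 x hx2).deriv, r2]
    refine (key _ _ c2).trans ?_
    have : cG α * (((Nat.factorial 2 : ℕ):ℝ) * (A * x ^ (α - 1)) / (x / 2) ^ 2) = 8 * cG α * A * (x ^ (α - 1) / x / x) := by
      simp; field_simp; norm_num
    rw [this]

end HW

namespace HW

/-- The properties of the kernel that are used. -/
structure GK (α : ℝ) (K : ℝ → ℝ) : Prop where
  even : ∀ x, K (-x) = K x
  per : ∀ x, K (x + 2 * π) = K x
  smooth : ContDiffOn ℝ (⊤ : ℕ∞) K (Ioo 0 (2 * π))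
  bd : ∃ C > 0, ∀ x ∈ Ioc (0:ℝ) (3 * π / 2), |K x| ≤ C * x ^ (α - 1) ∧
    |deriv K x| ≤ C * x ^ (α - 2) ∧ |deriv (deriv K) x| ≤ C * x ^ (α - 3)
  anti : StrictAntiOn K (Ioc 0 π)
  low : ∃ c > 0, ∃ δ > 0, ∀ x ∈ Ioc (0:ℝ) δ, ∀ z ∈ Icc x (3 * x / 2),
    c * x ^ (α - 1) ≤ K (z - x / 2) - K (z + x / 2)

theorem bd_extend (f : ℝ → ℝ) (hf : ContinuousOn f (Icc 1 (3 * π / 2))) (s : ℝ) (hs : s ≤ 0) (C : ℝ)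
    (hC : 0 < C)
    (h : ∀ x ∈ Ioc (0:ℝ) 1, |f x| ≤ C * x ^ s) :
    ∃ C' > 0, ∀ x ∈ Ioc (0:ℝ) (3 * π / 2), |f x| ≤ C' * x ^ s := by
  have hpi := Real.pi_gt_three
  obtain ⟨M, hM⟩ := isCompact_Icc.exists_bound_of_continuousOn hf
  have hP : 0 < (3 * π / 2) ^ s := by positivity
  have hM0 : 0 ≤ M := (norm_nonneg _).trans (hM 1 ⟨le_rfl, by linarith⟩)
  refine ⟨C + M / (3 * π / 2) ^ s, by positivity, fun x hx => ?_⟩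
  have hx0 := hx.1
  have hX : 0 < x ^ s := by positivity
  rcases le_total x 1 with h1 | h1
  · refine (h x ⟨hx0, h1⟩).trans ?_
    gcongr
    have : 0 ≤ M / (3 * π / 2) ^ s := by positivity
    linarith
  · have h2 : (3 * π / 2) ^ s ≤ x ^ s := Real.rpow_le_rpow_of_nonpos hx0 hx.2 hs
    have h3 := hM x ⟨h1, hx.2⟩
    rw [Real.norm_eq_abs] at h3
    calc |f x| ≤ M := h3
      _ = M / (3 * π / 2) ^ s * (3 * π / 2) ^ s := by field_simp
      _ ≤ M / (3 * π / 2) ^ s * x ^ s := by gcongr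
      _ ≤ _ := by nlinarith

/-- real integrand -/
noncomputable def rk (α x t : ℝ) : ℝ := t ^ (α - 1) * (Real.exp t * Real.cos x - 1) /
        (1 - 2 * Real.exp t * Real.cos x + Real.exp (2 * t))

theorem rk_eq (α x t : ℝ) : rk α x t = (fk α x t).re := by
  simp only [fk, rk, Complex.re_ofReal_mul, Complex.inv_re]
  rw [Complex.normSq_eq_norm_sq, normSq_exp_sub_one, mul_div_assoc, arg_re, arg_im]
  congr 2
  · simp [Complex.exp_re]
  · simp; rw [two_mul t, Real.exp_add]; ring

theorem rk_int (α x : ℝ) (hα : 0 < α) (hx : Real.cos x < 1) : IntegrableOn (rk α x) (Ioi 0) := by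
  have := (fk_integrable α hα x (by simpa using hx)).re
  refine this.congr (Eventually.of_forall fun t => ?_)
  rw [rk_eq]; rfl

theorem rk_diff (α a b t : ℝ) (ha : Real.cos a < 1) (hb : Real.cos b < 1) :
    rk α a t - rk α b t = t ^ (α - 1) * (Real.exp t * ((Real.exp t) ^ 2 - 1) *
      (Real.cos a - Real.cos b) / ((1 - 2 * Real.exp t * Real.cos a + (Real.exp t) ^ 2) *
       (1 - 2 * Real.exp t * Real.cos b + (Real.exp t) ^ 2))) := by
  have hE := Real.exp_pos t
  have hD : ∀ c : ℝ, c < 1 → 0 < 1 - 2 * Real.exp t * c + (Real.exp t) ^ 2 := fun c hc => by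
    nlinarith [sq_nonneg (Real.exp t - 1)]
  have h1 := hD _ ha
  have h2 := hD _ hb
  have h3 : Real.exp (2 * t) = (Real.exp t) ^ 2 := by rw [two_mul, Real.exp_add]; ring
  unfold rk
  rw [h3, div_sub_div _ _ h1.ne' h2.ne', ← mul_div_assoc]
  congr 1
  ring

theorem Kker_sub (α a b : ℝ) (hα : 0 < α) (ha : Real.cos a < 1) (hb : Real.cos b < 1) :
    Kker α a - Kker α b = cG α * ∫ t in Ioi (0:ℝ), (rk α a t - rk α b t) := by
  rw [integral_sub (rk_int α a hα ha) (rk_int α b hα hb), Kker_eq α a hα ha, Kker_eq α b hα hb,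
    Fk_re α a hα ha, Fk_re α b hα hb]
  unfold cG rk
  ring

theorem rk_diff_pos (α a b t : ℝ) (ha : Real.cos a < 1) (hb : Real.cos b < 1)
    (hab : Real.cos b < Real.cos a) (ht : 0 < t) : 0 < rk α a t - rk α b t := by
  rw [rk_diff α a b t ha hb]
  have hE := Real.one_lt_exp_iff.2 ht
  have hD : ∀ c : ℝ, c < 1 → 0 < 1 - 2 * Real.exp t * c + (Real.exp t) ^ 2 := fun c hc => by
    nlinarith [sq_nonneg (Real.exp t - 1)]
  have h1 := hD _ ha
  have h2 := hD _ hb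
  have h3 : 0 < Real.exp t ^ 2 - 1 := by nlinarith
  have h4 : 0 < Real.cos a - Real.cos b := by linarith
  positivity

theorem Kker_anti (α : ℝ) (hα : 0 < α) : StrictAntiOn (Kker α) (Ioc 0 π) := by
  intro a ha b hb hab
  have hpi := Real.pi_pos
  have ca := cos_lt_one_of_mem a ⟨ha.1, by linarith [ha.2]⟩
  have cb := cos_lt_one_of_mem b ⟨hb.1, by linarith [hb.2]⟩
  have cab : Real.cos b < Real.cos a := Real.strictAntiOn_cos ⟨ha.1.le, ha.2⟩ ⟨hb.1.le, hb.2⟩ hab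
  rw [← sub_pos, Kker_sub α a b hα ca cb]
  refine mul_pos (cG_pos α hα) ?_
  rw [setIntegral_pos_iff_support_of_nonneg_ae]
  · have : Ioi (0:ℝ) ⊆ Function.support (fun t => rk α a t - rk α b t) ∩ Ioi 0 := fun t ht =>
      ⟨(rk_diff_pos α a b t ca cb cab ht).ne', ht⟩
    refine lt_of_lt_of_le ?_ (measure_mono this)
    simp
  · filter_upwards [ae_restrict_mem measurableSet_Ioi] with t ht
    exact (rk_diff_pos α a b t ca cb cab ht).le
  · exact (rk_int α a hα ca).sub (rk_int α b hα cb)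

theorem low_pt (x z t : ℝ) (hx0 : 0 < x) (hx1 : x ≤ 1 / 4) (hz1 : x ≤ z) (hz2 : z ≤ 3 * x / 2)
    (ht1 : x ≤ t) (ht2 : t ≤ 2 * x) :
    1 / (576 * 4) / x ≤ Real.exp t * ((Real.exp t) ^ 2 - 1) *
      (Real.cos (z - x / 2) - Real.cos (z + x / 2)) /
      ((1 - 2 * Real.exp t * Real.cos (z - x / 2) + (Real.exp t) ^ 2) *
       (1 - 2 * Real.exp t * Real.cos (z + x / 2) + (Real.exp t) ^ 2)) := by
  have hpi := Real.pi_gt_three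
  have hpi4 := Real.pi_le_four
  set E := Real.exp t with hE
  have hE1 : 1 + t ≤ E := by have := Real.add_one_le_exp t; linarith
  have hE2 : E ≤ 1 + 2 * t := by
    have h1 := Real.add_one_le_exp (-t)
    have h2 : Real.exp (-t) * E = 1 := by rw [hE, ← Real.exp_add]; simp
    nlinarith
  have hD : ∀ a : ℝ, 0 ≤ a → a ≤ 2 * x → Real.cos a < 1 → 0 < 1 - 2 * E * Real.cos a + E ^ 2 ∧
      1 - 2 * E * Real.cos a + E ^ 2 ≤ 24 * x ^ 2 := by
    intro a ha1 ha2 hc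
    constructor
    · nlinarith [sq_nonneg (E - 1)]
    · have h1 := Real.one_sub_sq_div_two_le_cos (x := a)
      have h2 : 1 - Real.cos a ≤ 2 * x ^ 2 := by nlinarith
      have h3 : (E - 1) ^ 2 ≤ 16 * x ^ 2 := by nlinarith
      have h4 : E * (1 - Real.cos a) ≤ 2 * (2 * x ^ 2) := by
        apply mul_le_mul <;> nlinarith [sq_nonneg x]
      nlinarith
  obtain ⟨a1, a2⟩ := hD (z - x / 2) (by linarith) (by linarith) (cos_lt_one_of_mem _ ⟨by linarith, by linarith⟩)
  obtain ⟨b1, b2⟩ := hD (z + x / 2) (by linarith) (by linarith) (cos_lt_one_of_mem _ ⟨by linarith, by linarith⟩)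
  have hcos : Real.cos (z - x / 2) - Real.cos (z + x / 2) = 2 * (Real.sin z * Real.sin (x / 2)) := by
    rw [Real.cos_sub, Real.cos_add]; ring
  have hsz : z / 2 ≤ Real.sin z := by
    have h1 := Real.mul_le_sin (x := z) (by linarith) (by linarith)
    have h2 : 1 / 2 ≤ 2 / π := by rw [div_le_div_iff₀] <;> linarith
    nlinarith
  have hsx : (x / 2) / 2 ≤ Real.sin (x / 2) := by
    have h1 := Real.mul_le_sin (x := x / 2) (by linarith) (by linarith)
    have h2 : 1 / 2 ≤ 2 / π := by rw [div_le_div_iff₀] <;> linarith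
    nlinarith
  have hc2 : x ^ 2 / 4 ≤ Real.cos (z - x / 2) - Real.cos (z + x / 2) := by
    rw [hcos]
    have : x / 2 * (x / 4) ≤ Real.sin z * Real.sin (x / 2) := by
      apply mul_le_mul <;> linarith
    nlinarith
  have hE3 : x ≤ E * (E ^ 2 - 1) := by nlinarith
  have hnum : x * (x ^ 2 / 4) ≤ E * (E ^ 2 - 1) * (Real.cos (z - x / 2) - Real.cos (z + x / 2)) := by
    apply mul_le_mul hE3 hc2 <;> nlinarith
  have hden : (1 - 2 * E * Real.cos (z - x / 2) + E ^ 2) * (1 - 2 * E * Real.cos (z + x / 2) + E ^ 2)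
      ≤ (24 * x ^ 2) * (24 * x ^ 2) := by
    apply mul_le_mul a2 b2 b1.le (by positivity)
  calc 1 / (576 * 4) / x = x * (x ^ 2 / 4) / ((24 * x ^ 2) * (24 * x ^ 2)) := by
        field_simp; norm_num
    _ ≤ _ := by
        apply div_le_div₀ ((by positivity : (0:ℝ) ≤ x * (x ^ 2 / 4)).trans hnum) hnum (mul_pos a1 b1) hden

theorem Kker_low (α : ℝ) (hα : α ∈ Ioo (0:ℝ) 1) :
    ∃ c > 0, ∃ δ > 0, ∀ x ∈ Ioc (0:ℝ) δ, ∀ z ∈ Icc x (3 * x / 2),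
    c * x ^ (α - 1) ≤ Kker α (z - x / 2) - Kker α (z + x / 2) := by
  have hG := cG_pos α hα.1
  refine ⟨cG α * (1 / (576 * 4)) * 2 ^ (α - 1), by positivity, 1 / 4, by norm_num, ?_⟩
  rintro x ⟨hx0, hx1⟩ z ⟨hz1, hz2⟩
  have hpi := Real.pi_gt_three
  have ca := cos_lt_one_of_mem (z - x / 2) ⟨by linarith, by linarith⟩
  have cb := cos_lt_one_of_mem (z + x / 2) ⟨by linarith, by linarith⟩
  have cab : Real.cos (z + x / 2) < Real.cos (z - x / 2) :=
    Real.strictAntiOn_cos ⟨by linarith, by linarith⟩ ⟨by linarith, by linarith⟩ (by linarith)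
  rw [Kker_sub α _ _ hα.1 ca cb, mul_assoc, mul_assoc]
  refine mul_le_mul_of_nonneg_left ?_ hG.le
  have hInt0 := (rk_int α _ hα.1 ca).sub (rk_int α _ hα.1 cb)
  have h1 : ∫ t in Icc x (2 * x), (rk α (z - x / 2) t - rk α (z + x / 2) t) ≤
      ∫ t in Ioi (0:ℝ), (rk α (z - x / 2) t - rk α (z + x / 2) t) := by
    refine setIntegral_mono_set hInt0 ?_ ?_
    · filter_upwards [ae_restrict_mem measurableSet_Ioi] with t ht
      exact (rk_diff_pos α _ _ t ca cb cab ht).le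
    · exact Eventually.of_forall fun t ht => lt_of_lt_of_le hx0 ht.1
  refine le_trans ?_ h1
  have h2 : ∫ t in Icc x (2 * x), (2 * x) ^ (α - 1) * (1 / (576 * 4) / x) ≤
      ∫ t in Icc x (2 * x), (rk α (z - x / 2) t - rk α (z + x / 2) t) := by
    refine setIntegral_mono_on ?_ (hInt0.mono_set fun t ht => lt_of_lt_of_le hx0 ht.1) measurableSet_Icc ?_
    · exact integrableOn_const (by simp)
    · intro t ht
      rw [rk_diff α _ _ t ca cb]
      have ht0 : 0 < t := lt_of_lt_of_le hx0 ht.1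
      have := low_pt x z t hx0 hx1 hz1 hz2 ht.1 ht.2
      have h3 : (2 * x) ^ (α - 1) ≤ t ^ (α - 1) :=
        Real.rpow_le_rpow_of_nonpos ht0 ht.2 (by linarith [hα.2])
      apply mul_le_mul h3 this (by positivity) (by positivity)
  refine le_trans (le_of_eq ?_) h2
  rw [setIntegral_const]
  simp only [Real.volume_real_Icc, smul_eq_mul]
  rw [Real.mul_rpow (by norm_num) hx0.le, max_eq_left (by linarith)]
  field_simp
  ring

theorem Kker_GK (α : ℝ) (hα : α ∈ Ioo (0:ℝ) 1) : GK α (Kker α) where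
  even := Kker_even α
  per := Kker_per α
  smooth := Kker_smooth α hα.1
  anti := Kker_anti α hα.1
  low := Kker_low α hα
  bd := by
    obtain ⟨C, hC, h⟩ := Kker_bd1 α hα
    have hpi := Real.pi_gt_three
    have hsub : Icc 1 (3 * π / 2) ⊆ Ioo 0 (2 * π) := fun x hx =>
      ⟨by linarith [hx.1], by linarith [hx.2]⟩
    have d1 : ContinuousOn (deriv (Kker α)) (Ioo 0 (2 * π)) := fun x hx =>
      (Kker_hasDeriv2 α hα.1 x hx).continuousAt.continuousWithinAt
    have d2 : ContinuousOn (deriv (deriv (Kker α))) (Ioo 0 (2 * π)) := by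
      have h1 : ContDiffOn ℝ 1 (deriv (Kker α)) (Ioo 0 (2 * π)) :=
        (Kker_smooth α hα.1).deriv_of_isOpen isOpen_Ioo (WithTop.coe_le_coe.2 le_top)
      exact h1.continuousOn_deriv_of_isOpen isOpen_Ioo le_rfl
    have hα2 := hα.2
    obtain ⟨C0, p0, h0⟩ := bd_extend _ ((Kker_smooth α hα.1).continuousOn.mono hsub) (α - 1)
      (by linarith) C hC fun x hx => (h x hx).1
    obtain ⟨C1, p1, h1⟩ := bd_extend _ (d1.mono hsub) (α - 2)
      (by linarith) C hC fun x hx => (h x hx).2.1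
    obtain ⟨C2, p2, h2⟩ := bd_extend _ (d2.mono hsub) (α - 3)
      (by linarith) C hC fun x hx => (h x hx).2.2
    refine ⟨C0 + C1 + C2, by positivity, fun x hx => ⟨?_, ?_, ?_⟩⟩
    · refine (h0 x hx).trans ?_
      have := Real.rpow_nonneg hx.1.le (α - 1)
      gcongr; linarith
    · refine (h1 x hx).trans ?_
      have := Real.rpow_nonneg hx.1.le (α - 2)
      gcongr; linarith
    · refine (h2 x hx).trans ?_
      have := Real.rpow_nonneg hx.1.le (α - 3)
      gcongr; linarith

end HW

namespace HW

theorem evper_eq (f : ℝ → ℝ) (he : ∀ x, f (-x) = f x) (hp : ∀ x, f (x + 2 * π) = f x) (x y : ℝ)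
    (h : Real.cos x = Real.cos y) : f x = f y := by
  have hp' : Function.Periodic f (2 * π) := hp
  obtain ⟨k, hk | hk⟩ := Real.cos_eq_cos_iff.1 h
  · have := hp'.int_mul k x
    rw [hk, ← this]; ring_nf
  · have := hp'.int_mul k (-x)
    rw [hk, ← he x, ← this]; ring_nf

theorem arccos_cos_mem (x : ℝ) : Real.arccos (Real.cos x) ∈ Icc 0 π :=
  ⟨Real.arccos_nonneg _, Real.arccos_le_pi _⟩

theorem cos_arccos_cos (x : ℝ) : Real.cos (Real.arccos (Real.cos x)) = Real.cos x :=
  Real.cos_arccos (Real.neg_one_le_cos x) (Real.cos_le_one x)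

theorem arccos_lt_of {x y : ℝ} (h : Real.cos y < Real.cos x) :
    Real.arccos (Real.cos x) < Real.arccos (Real.cos y) :=
  Real.strictAntiOn_arccos ⟨Real.neg_one_le_cos y, Real.cos_le_one y⟩
    ⟨Real.neg_one_le_cos x, Real.cos_le_one x⟩ h

theorem arccos_cos_pos {x : ℝ} (h : Real.cos x < 1) : 0 < Real.arccos (Real.cos x) :=
  Real.arccos_pos.2 h

section
variable {α : ℝ} {K : ℝ → ℝ}

theorem GK.lt_of_cos (hK : GK α K) {x y : ℝ} (h : Real.cos y < Real.cos x) (hx : Real.cos x < 1) :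
    K y < K x := by
  rw [evper_eq K hK.even hK.per x _ (cos_arccos_cos x).symm,
    evper_eq K hK.even hK.per y _ (cos_arccos_cos y).symm]
  exact hK.anti ⟨arccos_cos_pos hx, Real.arccos_le_pi _⟩
    ⟨arccos_cos_pos (h.trans hx), Real.arccos_le_pi _⟩ (arccos_lt_of h)

theorem GK.le_of_cos (hK : GK α K) {x y : ℝ} (h : Real.cos y ≤ Real.cos x) (hx : Real.cos x < 1) :
    K y ≤ K x := by
  rcases h.lt_or_eq with h | h
  · exact (hK.lt_of_cos h hx).le
  · exact (evper_eq K hK.even hK.per y x h).le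

theorem rpow_ii (hα : 0 < α) (a b : ℝ) : IntervalIntegrable (fun x : ℝ => x ^ (α - 1)) volume a b :=
  intervalIntegral.intervalIntegrable_rpow' (by linarith)

theorem GK.int0 (hK : GK α K) (hα : 0 < α) : IntervalIntegrable K volume 0 π := by
  obtain ⟨C, hC, h⟩ := hK.bd
  have hpi := Real.pi_pos
  rw [intervalIntegrable_iff_integrableOn_Ioc_of_le hpi.le]
  have h1 : IntegrableOn (fun x : ℝ => C * x ^ (α - 1)) (Ioc 0 π) := by
    rw [← intervalIntegrable_iff_integrableOn_Ioc_of_le hpi.le]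
    exact (rpow_ii hα _ _).const_mul _
  refine Integrable.mono' h1 ?_ ?_
  · refine (hK.smooth.continuousOn.mono ?_).aestronglyMeasurable measurableSet_Ioc
    exact fun x hx => ⟨hx.1, by linarith [hx.2]⟩
  · filter_upwards [ae_restrict_mem measurableSet_Ioc] with x hx
    exact (h x ⟨hx.1, by linarith [hx.2]⟩).1

theorem GK.int (hK : GK α K) (hα : 0 < α) (a b : ℝ) : IntervalIntegrable K volume a b := by
  have h0 := hK.int0 hα
  have h1 : IntervalIntegrable K volume (-π) 0 := by
    have h2 := h0.comp_sub_left 0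
    simp only [zero_sub, neg_zero] at h2
    have h3 : (fun x => K (-x)) = K := funext hK.even
    rw [h3] at h2
    exact h2.symm
  have hp : Function.Periodic K (2 * π) := hK.per
  refine hp.intervalIntegrable (t := -π) (by positivity) ?_ a b
  have : -π + 2 * π = π := by ring
  rw [this]
  exact h1.trans h0

theorem GK.int_sub (hK : GK α K) (hα : 0 < α) (c a b : ℝ) :
    IntervalIntegrable (fun y => K (c - y)) volume a b := by
  have := (hK.int hα (c - a) (c - b)).comp_sub_left c
  simpa using this

theorem GK.int_add (hK : GK α K) (hα : 0 < α) (c a b : ℝ) :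
    IntervalIntegrable (fun y => K (c + y)) volume a b := by
  have := (hK.int hα (c + a) (c + b)).comp_add_left c
  simpa using this

/-- The convolution operator. -/
noncomputable def TT (K v : ℝ → ℝ) (x : ℝ) : ℝ := ∫ y in (-π)..π, K (x - y) * v y

theorem TT_formula (hK : GK α K) (hα : 0 < α) (v : ℝ → ℝ) (hv : Continuous v)
    (hp : ∀ x, v (x + 2 * π) = v x) (a d : ℝ) :
    TT K v (a + d) = ∫ z in (0:ℝ)..π, (K (d - z) * v (a + z) + K (d + z) * v (a - z)) := by
  have hper : Function.Periodic (fun y => K (a + d - y) * v y) (2 * π) := by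
    intro y
    simp only [hp]
    congr 1
    have := hK.per (a + d - (y + 2 * π))
    rw [← this]; ring_nf
  have h1 : TT K v (a + d) = ∫ z in (-π)..π, K (d - z) * v (a + z) := by
    have h2 := hper.intervalIntegral_add_eq (-π) (a - π)
    rw [show -π + 2 * π = π by ring, show a - π + 2 * π = a + π by ring] at h2
    rw [TT, h2]
    have h3 := intervalIntegral.integral_comp_add_left (a := -π) (b := π) (fun y => K (a + d - y) * v y) a
    rw [show a + -π = a - π by ring] at h3
    rw [← h3]
    congr 1; ext z; congr 2; ring
  have i1 : ∀ s t, IntervalIntegrable (fun z => K (d - z) * v (a + z)) volume s t := fun s t =>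
    (hK.int_sub hα d s t).mul_continuousOn (by fun_prop)
  have i2 : ∀ s t, IntervalIntegrable (fun z => K (d + z) * v (a - z)) volume s t := fun s t =>
    (hK.int_add hα d s t).mul_continuousOn (by fun_prop)
  rw [h1, ← intervalIntegral.integral_add_adjacent_intervals (i1 (-π) 0) (i1 0 π),
    intervalIntegral.integral_add (i1 _ _) (i2 _ _), add_comm]
  congr 1
  have := intervalIntegral.integral_comp_neg (a := 0) (b := π) (fun z => K (d - z) * v (a + z))
  simp only [sub_neg_eq_add, neg_zero, ← sub_eq_add_neg] at this
  rw [this]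

theorem TT_reflect (hK : GK α K) (hα : 0 < α) (v : ℝ → ℝ) (hv : Continuous v)
    (hp : ∀ x, v (x + 2 * π) = v x) (a d : ℝ) :
    TT K v (a + d) - TT K v (a - d)
      = ∫ z in (0:ℝ)..π, (K (d - z) - K (d + z)) * (v (a + z) - v (a - z)) := by
  have i1 : ∀ s t, IntervalIntegrable (fun z => K (d - z) * v (a + z)) volume s t := fun s t =>
    (hK.int_sub hα d s t).mul_continuousOn (by fun_prop)
  have i2 : ∀ s t, IntervalIntegrable (fun z => K (d + z) * v (a - z)) volume s t := fun s t =>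
    (hK.int_add hα d s t).mul_continuousOn (by fun_prop)
  have i3 : ∀ s t, IntervalIntegrable (fun z => K (-d - z) * v (a + z)) volume s t := fun s t =>
    (hK.int_sub hα (-d) s t).mul_continuousOn (by fun_prop)
  have i4 : ∀ s t, IntervalIntegrable (fun z => K (-d + z) * v (a - z)) volume s t := fun s t =>
    (hK.int_add hα (-d) s t).mul_continuousOn (by fun_prop)
  have h2 := TT_formula hK hα v hv hp a (-d)
  rw [← sub_eq_add_neg] at h2
  rw [TT_formula hK hα v hv hp a d, h2,
    ← intervalIntegral.integral_sub ((i1 _ _).add (i2 _ _)) ((i3 _ _).add (i4 _ _))]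
  congr 1; ext z
  rw [← hK.even (-d - z), ← hK.even (-d + z)]
  ring_nf

theorem reflect_nonneg (hK : GK α K) {d z : ℝ} (hd : d ∈ Icc 0 π) (hz : z ∈ Icc 0 π) (hne : z ≠ d) :
    0 ≤ K (d - z) - K (d + z) := by
  rw [sub_nonneg]
  apply hK.le_of_cos
  · rw [Real.cos_sub, Real.cos_add]
    have := mul_nonneg (Real.sin_nonneg_of_mem_Icc hd) (Real.sin_nonneg_of_mem_Icc hz)
    linarith
  · have hpi := Real.pi_pos
    rw [← Real.cos_abs]
    refine cos_lt_one_of_mem _ ⟨abs_pos.2 (sub_ne_zero.2 hne.symm), ?_⟩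
    rw [abs_lt]; constructor <;> linarith [hd.1, hd.2, hz.1, hz.2]

theorem reflect_pos (hK : GK α K) {d z : ℝ} (hd : d ∈ Ioo 0 π) (hz : z ∈ Ioo 0 π) (hne : z ≠ d) :
    0 < K (d - z) - K (d + z) := by
  rw [sub_pos]
  apply hK.lt_of_cos
  · rw [Real.cos_sub, Real.cos_add]
    have := mul_pos (Real.sin_pos_of_mem_Ioo hd) (Real.sin_pos_of_mem_Ioo hz)
    linarith
  · have hpi := Real.pi_pos
    rw [← Real.cos_abs]
    refine cos_lt_one_of_mem _ ⟨abs_pos.2 (sub_ne_zero.2 hne.symm), ?_⟩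
    rw [abs_lt]; constructor <;> linarith [hd.1, hd.2, hz.1, hz.2]

theorem J_eq (hK : GK α K) (hα : 0 < α) (d : ℝ) :
    ∫ z in (0:ℝ)..π, (K (d - z) - K (d + z)) = (∫ z in (-d)..d, K z) - ∫ z in (π - d)..(π + d), K z := by
  have i := hK.int hα
  rw [intervalIntegral.integral_sub (hK.int_sub hα _ _ _) (hK.int_add hα _ _ _),
    intervalIntegral.integral_comp_sub_left K d, intervalIntegral.integral_comp_add_left K d]
  simp only [sub_zero, add_zero]
  have e1 := intervalIntegral.integral_add_adjacent_intervals (i (d - π) (-d)) (i (-d) d)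
  have e2 := intervalIntegral.integral_add_adjacent_intervals (i d (π - d)) (i (π - d) (π + d))
  have e3 := intervalIntegral.integral_comp_neg (a := d - π) (b := -d) K
  simp only [hK.even, neg_neg, neg_sub] at e3
  rw [add_comm d π]
  linarith

theorem J_bound (hK : GK α K) (hα : α ∈ Ioo (0:ℝ) 1) : ∃ C > 0, ∀ d ∈ Icc (0:ℝ) (π / 2),
    ∫ z in (0:ℝ)..π, |K (d - z) - K (d + z)| ≤ C * d ^ α := by
  obtain ⟨C, hC, h⟩ := hK.bd
  have hα0 := hα.1
  have hpi := Real.pi_pos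
  refine ⟨2 * C / α + 2 * C, by positivity, fun d hd => ?_⟩
  have hd0 := hd.1
  have h0 : ∫ z in (0:ℝ)..π, |K (d - z) - K (d + z)| = ∫ z in (0:ℝ)..π, (K (d - z) - K (d + z)) := by
    refine intervalIntegral.integral_congr_ae ?_
    have : ∀ᵐ z : ℝ, z ≠ d := by simp [ae_iff, measure_singleton]
    filter_upwards [this] with z hz hz2
    rw [uIoc_of_le hpi.le] at hz2
    exact abs_of_nonneg (reflect_nonneg hK ⟨hd.1, by linarith [hd.2]⟩ ⟨hz2.1.le, hz2.2⟩ hz)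
  rw [h0, J_eq hK hα.1]
  have i := hK.int hα.1
  have e1 : |∫ z in (0:ℝ)..d, K z| ≤ C * (d ^ α / α) := by
    have h1 : ∫ z in (0:ℝ)..d, C * z ^ (α - 1) = C * (d ^ α / α) := by
      rw [intervalIntegral.integral_const_mul, integral_rpow (Or.inl (by linarith))]
      rw [sub_add_cancel, Real.zero_rpow hα0.ne', sub_zero]
    rw [← h1, ← Real.norm_eq_abs]
    refine intervalIntegral.norm_integral_le_of_norm_le hd0 ?_ ((rpow_ii hα0 _ _).const_mul C)
    exact Eventually.of_forall fun z hz => (h z ⟨hz.1, by linarith [hz.2, hd.2]⟩).1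
  have e2 : ∫ z in (-d)..0, K z = ∫ z in (0:ℝ)..d, K z := by
    have e3 := intervalIntegral.integral_comp_neg (a := -d) (b := 0) K
    simpa only [hK.even, neg_neg, neg_zero] using e3
  have e3 : ∫ z in (-d)..d, K z = 2 * ∫ z in (0:ℝ)..d, K z := by
    rw [← intervalIntegral.integral_add_adjacent_intervals (i (-d) 0) (i 0 d), e2]; ring
  have e4 : |∫ z in (π - d)..(π + d), K z| ≤ C * (π / 2) ^ (α - 1) * |π + d - (π - d)| := by
    rw [← Real.norm_eq_abs]
    refine intervalIntegral.norm_integral_le_of_norm_le_const fun z hz => ?_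
    rw [uIoc_of_le (by linarith)] at hz
    have hz0 : π / 2 ≤ z := by linarith [hz.1, hd.2]
    refine (h z ⟨by linarith, by linarith [hz.2, hd.2]⟩).1.trans ?_
    refine mul_le_mul_of_nonneg_left ?_ hC.le
    exact Real.rpow_le_rpow_of_nonpos (by positivity) hz0 (by linarith [hα.2])
  have e5 : (π / 2) ^ (α - 1) * d ≤ d ^ α := by
    rcases hd0.eq_or_lt with h1 | h1
    · rw [← h1]; simp [Real.zero_rpow hα0.ne']
    · have : (π / 2) ^ (α - 1) ≤ d ^ (α - 1) :=
        Real.rpow_le_rpow_of_nonpos h1 hd.2 (by linarith [hα.2])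
      calc (π / 2) ^ (α - 1) * d ≤ d ^ (α - 1) * d := by gcongr
        _ = d ^ α := by rw [Real.rpow_sub_one h1.ne']; field_simp
  have e6 : |π + d - (π - d)| = 2 * d := by
    rw [show π + d - (π - d) = 2 * d by ring, abs_of_nonneg (by linarith)]
  rw [e6] at e4
  rw [e3]
  have a1 := (abs_le.1 e1).2
  have a2 := (abs_le.1 e4).1
  have : C * ((π / 2) ^ (α - 1) * d) ≤ C * d ^ α := by gcongr
  calc 2 * (∫ z in (0:ℝ)..d, K z) - ∫ z in (π - d)..(π + d), K z
      ≤ 2 * (C * (d ^ α / α)) + 2 * (C * ((π / 2) ^ (α - 1) * d)) := by linarith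
    _ ≤ 2 * (C * (d ^ α / α)) + 2 * (C * d ^ α) := by linarith
    _ = _ := by ring

end
end HW

namespace HW

/-- Even periodic continuous profile, monotone on the half period. -/
structure Prof (v : ℝ → ℝ) : Prop where
  cont : Continuous v
  even : ∀ x, v (-x) = v x
  per : ∀ x, v (x + 2 * π) = v x
  mono : MonotoneOn v (Icc 0 π)

theorem Prof.le_of_cos {v : ℝ → ℝ} (hv : Prof v) {x y : ℝ} (h : Real.cos y ≤ Real.cos x) :
    v x ≤ v y := by
  rw [evper_eq v hv.even hv.per x _ (cos_arccos_cos x).symm,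
    evper_eq v hv.even hv.per y _ (cos_arccos_cos y).symm]
  refine hv.mono (arccos_cos_mem x) (arccos_cos_mem y) ?_
  rcases h.lt_or_eq with h | h
  · exact (arccos_lt_of h).le
  · rw [h]

theorem Prof.zero_le {v : ℝ → ℝ} (hv : Prof v) (x : ℝ) : v 0 ≤ v x :=
  hv.le_of_cos (by rw [Real.cos_zero]; exact Real.cos_le_one x)
theorem Prof.le_pi {v : ℝ → ℝ} (hv : Prof v) (x : ℝ) : v x ≤ v π :=
  hv.le_of_cos (by rw [Real.cos_pi]; exact Real.neg_one_le_cos x)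

theorem Prof.reflect {v : ℝ → ℝ} (hv : Prof v) {a z : ℝ} (ha : a ∈ Icc 0 π) (hz : z ∈ Icc 0 π) :
    0 ≤ v (a + z) - v (a - z) := by
  rw [sub_nonneg]
  apply hv.le_of_cos
  rw [Real.cos_sub, Real.cos_add]
  have := mul_nonneg (Real.sin_nonneg_of_mem_Icc ha) (Real.sin_nonneg_of_mem_Icc hz)
  linarith

section
variable {α : ℝ} {K : ℝ → ℝ}

/-- L1 norm of the kernel -/
noncomputable def L1 (K : ℝ → ℝ) : ℝ := ∫ x in (-π)..π, |K x|

theorem TT_bound (hK : GK α K) (hα : 0 < α) (v : ℝ → ℝ) (hv : Continuous v) (M : ℝ)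
    (hM : ∀ x, |v x| ≤ M) (x : ℝ) : |TT K v x| ≤ M * L1 K := by
  have hpi := Real.pi_pos
  have hper : Function.Periodic (fun y => |K y|) (2 * π) := fun y => by simp only [hK.per]
  have h1 : ∫ y in (-π)..π, |K (x - y)| = L1 K := by
    rw [intervalIntegral.integral_comp_sub_left (fun y => |K y|) x]
    have := hper.intervalIntegral_add_eq (x - π) (-π)
    rw [show x - π + 2 * π = x - -π by ring, show -π + 2 * π = π by ring] at this
    exact this
  rw [← h1, TT, ← intervalIntegral.integral_const_mul, ← Real.norm_eq_abs]
  refine intervalIntegral.norm_integral_le_of_norm_le (by linarith) ?_ ((hK.int_sub hα x _ _).abs.const_mul M)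
  refine Eventually.of_forall fun y _ => ?_
  rw [Real.norm_eq_abs, abs_mul, mul_comm]
  exact mul_le_mul_of_nonneg_right (hM y) (abs_nonneg _)

theorem L1_nonneg (K : ℝ → ℝ) : 0 ≤ L1 K :=
  intervalIntegral.integral_nonneg (by linarith [Real.pi_pos]) fun _ _ => abs_nonneg _

theorem refl_ii (hK : GK α K) (hα : 0 < α) (d : ℝ) (s t : ℝ) :
    IntervalIntegrable (fun z => K (d - z) - K (d + z)) volume s t :=
  (hK.int_sub hα d s t).sub (hK.int_add hα d s t)

theorem TT_diff_small (hK : GK α K) (hα : α ∈ Ioo (0:ℝ) 1) : ∃ C > 0, ∀ v : ℝ → ℝ, Continuous v →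
    (∀ x, v (x + 2 * π) = v x) → ∀ M, (∀ x, |v x| ≤ M) → ∀ a, ∀ d ∈ Icc (0:ℝ) (π / 2),
    |TT K v (a + d) - TT K v (a - d)| ≤ C * M * d ^ α := by
  obtain ⟨C, hC, h⟩ := J_bound hK hα
  refine ⟨2 * C, by positivity, fun v hv hp M hM a d hd => ?_⟩
  have hpi := Real.pi_pos
  have hM0 : 0 ≤ M := (abs_nonneg _).trans (hM 0)
  rw [TT_reflect hK hα.1 v hv hp, ← Real.norm_eq_abs]
  have h1 : ‖∫ z in (0:ℝ)..π, (K (d - z) - K (d + z)) * (v (a + z) - v (a - z))‖ ≤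
      ∫ z in (0:ℝ)..π, |K (d - z) - K (d + z)| * (2 * M) := by
    refine intervalIntegral.norm_integral_le_of_norm_le hpi.le ?_ ((refl_ii hK hα.1 d _ _).abs.mul_const _)
    refine Eventually.of_forall fun z _ => ?_
    rw [Real.norm_eq_abs, abs_mul]
    refine mul_le_mul_of_nonneg_left ?_ (abs_nonneg _)
    have := abs_sub (v (a + z)) (v (a - z))
    linarith [hM (a + z), hM (a - z)]
  refine h1.trans ?_
  rw [intervalIntegral.integral_mul_const]
  calc _ ≤ (C * d ^ α) * (2 * M) := by gcongr; exact h d hd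
    _ = _ := by ring

theorem TT_holder (hK : GK α K) (hα : α ∈ Ioo (0:ℝ) 1) : ∃ C > 0, ∀ v : ℝ → ℝ, Continuous v →
    (∀ x, v (x + 2 * π) = v x) → ∀ M, (∀ x, |v x| ≤ M) → ∀ x y,
    |TT K v x - TT K v y| ≤ C * M * |x - y| ^ α := by
  obtain ⟨C, hC, h⟩ := TT_diff_small hK hα
  have hN := L1_nonneg K
  refine ⟨C + 2 * L1 K, by positivity, fun v hv hp M hM x y => ?_⟩
  have hM0 : 0 ≤ M := (abs_nonneg _).trans (hM 0)
  have hpi := Real.pi_gt_three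
  wlog hxy : y ≤ x generalizing x y
  · rw [abs_sub_comm, abs_sub_comm x y]
    exact this y x (le_of_not_ge hxy)
  rw [abs_of_nonneg (sub_nonneg.2 hxy)]
  rcases le_total (x - y) π with h1 | h1
  · have := h v hv hp M hM ((x + y) / 2) ((x - y) / 2) ⟨by linarith, by linarith⟩
    rw [show (x + y) / 2 + (x - y) / 2 = x by ring, show (x + y) / 2 - (x - y) / 2 = y by ring] at this
    refine this.trans ?_
    have h2 : ((x - y) / 2) ^ α ≤ (x - y) ^ α :=
      Real.rpow_le_rpow (by linarith) (by linarith) hα.1.le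
    have : C * M ≤ (C + 2 * L1 K) * M := by nlinarith
    have h3 : 0 ≤ (x - y) ^ α := Real.rpow_nonneg (by linarith) _
    calc _ ≤ C * M * (x - y) ^ α := by gcongr
      _ ≤ _ := by gcongr
  · have h2 : 1 ≤ (x - y) ^ α := Real.one_le_rpow (by linarith) hα.1.le
    have b1 := TT_bound hK hα.1 v hv M hM x
    have b2 := TT_bound hK hα.1 v hv M hM y
    have := abs_sub (TT K v x) (TT K v y)
    have h4 : 0 ≤ (C + 2 * L1 K) * M := by positivity
    have h5 : 0 ≤ C * M := by positivity
    nlinarith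

theorem holder_cont {f : ℝ → ℝ} {C r : ℝ} (hr : 0 < r) (h : ∀ x y, |f x - f y| ≤ C * |x - y| ^ r) :
    Continuous f := by
  rw [continuous_iff_continuousAt]
  intro x
  rw [ContinuousAt, tendsto_iff_dist_tendsto_zero]
  have h1 : Tendsto (fun y => C * |y - x| ^ r) (𝓝 x) (𝓝 0) := by
    have : Continuous fun y : ℝ => C * |y - x| ^ r :=
      continuous_const.mul (Continuous.rpow_const (by fun_prop) fun _ => Or.inr hr.le)
    have h2 := this.tendsto x
    simpa [Real.zero_rpow hr.ne'] using h2
  exact squeeze_zero (fun _ => dist_nonneg) (fun y => by rw [Real.dist_eq]; exact h y x) h1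

theorem TT_cont (hK : GK α K) (hα : α ∈ Ioo (0:ℝ) 1) (v : ℝ → ℝ) (hv : Continuous v)
    (hp : ∀ x, v (x + 2 * π) = v x) : Continuous (TT K v) := by
  obtain ⟨C, hC, h⟩ := TT_holder hK hα
  have hpi := Real.pi_pos
  obtain ⟨M, hM⟩ := (isCompact_Icc (a := (0:ℝ)) (b := 2 * π)).exists_bound_of_continuousOn hv.continuousOn
  refine holder_cont hα.1 (h v hv hp M fun x => ?_)
  have hp' : Function.Periodic v (2 * π) := hp
  obtain ⟨y, hy, hxy⟩ := hp'.exists_mem_Ico₀ (by positivity) x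
  rw [hxy]
  exact hM y ⟨hy.1, hy.2.le⟩

theorem TT_per (hK : GK α K) (v : ℝ → ℝ) (x : ℝ) : TT K v (x + 2 * π) = TT K v x := by
  unfold TT
  congr 1; ext y
  rw [show x + 2 * π - y = (x - y) + 2 * π by ring, hK.per]

theorem TT_even (hK : GK α K) (hα : 0 < α) {v : ℝ → ℝ} (hv : Prof v) (x : ℝ) :
    TT K v (-x) = TT K v x := by
  have h1 := TT_formula hK hα v hv.cont hv.per 0 x
  have h2 := TT_formula hK hα v hv.cont hv.per 0 (-x)
  rw [zero_add] at h1 h2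
  rw [h1, h2]
  congr 1; ext z
  rw [← hK.even (-x - z), ← hK.even (-x + z), zero_sub, hv.even, zero_add]
  ring_nf

theorem refl_ae (hK : GK α K) {v : ℝ → ℝ} (hv : Prof v) {a d : ℝ} (ha : a ∈ Icc 0 π) (hd : d ∈ Icc 0 π) :
    0 ≤ᵐ[volume.restrict (Ioc 0 π)] fun z => (K (d - z) - K (d + z)) * (v (a + z) - v (a - z)) := by
  have : ∀ᵐ z : ℝ ∂(volume.restrict (Ioc 0 π)), z ≠ d := ae_restrict_of_ae (by simp [ae_iff, measure_singleton])
  filter_upwards [this, ae_restrict_mem measurableSet_Ioc] with z hz hz2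
  exact mul_nonneg (reflect_nonneg hK hd ⟨hz2.1.le, hz2.2⟩ hz) (hv.reflect ha ⟨hz2.1.le, hz2.2⟩)

theorem TT_lower (hK : GK α K) (hα : 0 < α) {v : ℝ → ℝ} (hv : Prof v) {a d : ℝ} (ha : a ∈ Icc 0 π)
    (hd : d ∈ Icc 0 π) {s t : ℝ} (hs : 0 ≤ s) (hst : s ≤ t) (ht : t ≤ π) :
    ∫ z in s..t, (K (d - z) - K (d + z)) * (v (a + z) - v (a - z)) ≤
      TT K v (a + d) - TT K v (a - d) := by
  have hpi := Real.pi_pos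
  have hvc := hv.cont
  rw [TT_reflect hK hα v hv.cont hv.per]
  refine intervalIntegral.integral_mono_interval hs hst ht ?_ ((refl_ii hK hα d 0 π).mul_continuousOn (by fun_prop))
  exact refl_ae hK hv ha hd

theorem TT_mono (hK : GK α K) (hα : 0 < α) {v : ℝ → ℝ} (hv : Prof v) : MonotoneOn (TT K v) (Icc 0 π) := by
  intro x hx y hy hxy
  have := TT_lower hK hα hv (a := (x + y) / 2) (d := (y - x) / 2)
    ⟨by linarith [hx.1, hy.1], by linarith [hx.2, hy.2]⟩
    ⟨by linarith, by linarith [hx.1, hy.2, Real.pi_pos]⟩ le_rfl le_rfl Real.pi_pos.le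
  rw [intervalIntegral.integral_same, show (x + y) / 2 + (y - x) / 2 = y by ring,
    show (x + y) / 2 - (y - x) / 2 = x by ring] at this
  linarith

theorem TT_prof (hK : GK α K) (hα : α ∈ Ioo (0:ℝ) 1) {v : ℝ → ℝ} (hv : Prof v) : Prof (TT K v) :=
  ⟨TT_cont hK hα v hv.cont hv.per, TT_even hK hα.1 hv, TT_per hK v, TT_mono hK hα.1 hv⟩

theorem TT_kappa (hK : GK α K) (hα : α ∈ Ioo (0:ℝ) 1) : ∃ κ > 0, ∀ v : ℝ → ℝ, Prof v →
    κ * (v (3 * π / 4) - v (π / 4)) ≤ TT K v (3 * π / 4) - TT K v (π / 4) := by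
  have hpi := Real.pi_pos
  refine ⟨∫ z in (π / 4)..(π / 2), (K (π / 4 - z) - K (π / 4 + z)), ?_, fun v hv => ?_⟩
  · refine intervalIntegral.intervalIntegral_pos_of_pos_on (refl_ii hK hα.1 _ _ _) ?_ (by linarith)
    intro z hz
    exact reflect_pos hK ⟨by linarith, by linarith⟩ ⟨by linarith [hz.1], by linarith [hz.2]⟩ hz.1.ne'
  · have hvc := hv.cont
    have h1 := TT_lower hK hα.1 hv (a := π / 2) (d := π / 4) ⟨by linarith, by linarith⟩
      ⟨by linarith, by linarith⟩ (s := π / 4) (t := π / 2) (by linarith) (by linarith) (by linarith)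
    rw [show π / 2 + π / 4 = 3 * π / 4 by ring, show π / 2 - π / 4 = π / 4 by ring] at h1
    refine le_trans ?_ h1
    rw [← intervalIntegral.integral_mul_const]
    refine intervalIntegral.integral_mono_on_of_le_Ioo (by linarith) ((refl_ii hK hα.1 _ _ _).mul_const _)
      ((refl_ii hK hα.1 _ _ _).mul_continuousOn (by fun_prop)) fun z hz => ?_
    have h2 := (reflect_pos hK (d := π / 4) ⟨by linarith, by linarith⟩ ⟨by linarith [hz.1], by linarith [hz.2]⟩ hz.1.ne').le
    refine mul_le_mul_of_nonneg_left ?_ h2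
    have h3 := hv.mono (a := 3 * π / 4) (b := π / 2 + z) ⟨by linarith, by linarith⟩ ⟨by linarith [hz.1], by linarith [hz.2]⟩ (by linarith [hz.1])
    have h4 := hv.mono (a := π / 2 - z) (b := π / 4) ⟨by linarith [hz.2], by linarith [hz.1]⟩ ⟨by linarith, by linarith⟩ (by linarith [hz.1])
    linarith

theorem TT_low (hK : GK α K) (hα : α ∈ Ioo (0:ℝ) 1) : ∃ c > 0, ∃ δ > 0, ∀ v : ℝ → ℝ, Prof v →
    ∀ x ∈ Ioc (0:ℝ) δ, c * x ^ α * (v (3 * x / 2) - v x) ≤ TT K v x - TT K v 0 := by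
  obtain ⟨c, hc, δ, hδ, h⟩ := hK.low
  have hpi := Real.pi_pos
  refine ⟨c / 2, by positivity, min δ (π / 4), by positivity, fun v hv x hx => ?_⟩
  have hx0 := hx.1
  have hxd : x ≤ δ := hx.2.trans (min_le_left _ _)
  have hxp : x ≤ π / 4 := hx.2.trans (min_le_right _ _)
  have hvc := hv.cont
  have h1 := TT_lower hK hα.1 hv (a := x / 2) (d := x / 2) ⟨by linarith, by linarith⟩
      ⟨by linarith, by linarith⟩ (s := x) (t := 3 * x / 2) (by linarith) (by linarith) (by linarith)
  rw [add_halves, sub_self] at h1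
  refine le_trans ?_ h1
  have h5 : ∫ z in x..(3 * x / 2), (c * x ^ (α - 1)) * (v (3 * x / 2) - v x) ≤
      ∫ z in x..(3 * x / 2), (K (x / 2 - z) - K (x / 2 + z)) * (v (x / 2 + z) - v (x / 2 - z)) := by
    refine intervalIntegral.integral_mono_on (by linarith) (by simp)
      ((refl_ii hK hα.1 _ _ _).mul_continuousOn (by fun_prop)) fun z hz => ?_
    have h2 := h x ⟨hx0, hxd⟩ z hz
    rw [← hK.even (z - x / 2), neg_sub, add_comm z] at h2
    have h3 := hv.mono (a := 3 * x / 2) (b := x / 2 + z) ⟨by linarith, by linarith⟩ ⟨by linarith [hz.1], by linarith [hz.2]⟩ (by linarith [hz.1])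
    have h4 := hv.mono (a := z - x / 2) (b := x) ⟨by linarith [hz.1], by linarith [hz.2]⟩ ⟨by linarith, by linarith⟩ (by linarith [hz.2])
    rw [← hv.even (z - x / 2), neg_sub] at h4
    have h6 := hv.mono (a := x) (b := 3 * x / 2) ⟨by linarith, by linarith⟩ ⟨by linarith, by linarith⟩ (by linarith)
    apply mul_le_mul h2 (by linarith) (by linarith)
    exact le_trans (by positivity) h2
  refine le_trans (le_of_eq ?_) h5
  rw [intervalIntegral.integral_const, smul_eq_mul, Real.rpow_sub_one hx0.ne']
  field_simp
  ring

theorem TT_strict (hK : GK α K) (hα : α ∈ Ioo (0:ℝ) 1) {v : ℝ → ℝ} (hv : Prof v)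
    (hne : v 0 < v π) : StrictMonoOn (TT K v) (Icc 0 π) := by
  have hpi := Real.pi_pos
  intro x hx y hy hxy
  refine lt_of_le_of_ne (TT_mono hK hα.1 hv hx hy hxy.le) fun heq => ?_
  have hvc := hv.cont
  set a := (x + y) / 2 with ha
  set d := (y - x) / 2 with hd
  have ha' : a ∈ Ioo 0 π := ⟨by rw [ha]; linarith [hx.1], by rw [ha]; linarith [hy.2]⟩
  have hd' : d ∈ Ioo 0 π := ⟨by rw [hd]; linarith, by rw [hd]; linarith [hx.1, hy.2]⟩
  have h1 := TT_reflect hK hα.1 v hv.cont hv.per a d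
  rw [show a + d = y by rw [ha, hd]; ring, show a - d = x by rw [ha, hd]; ring, heq, sub_self] at h1
  have h2 := refl_ae hK hv (Ioo_subset_Icc_self ha') (Ioo_subset_Icc_self hd')
  have hii : IntervalIntegrable (fun z => (K (d - z) - K (d + z)) * (v (a + z) - v (a - z))) volume 0 π :=
    (refl_ii hK hα.1 d 0 π).mul_continuousOn (by fun_prop)
  have h3 := (intervalIntegral.integral_eq_zero_iff_of_le_of_nonneg_ae hpi.le h2 hii).1 h1.symm
  have h4 : ∀ᵐ z ∂(volume.restrict (Ioo 0 π)), v (a + z) - v (a - z) = 0 := by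
    have h3' := ae_mono (Measure.restrict_mono Ioo_subset_Ioc_self le_rfl) h3
    have : ∀ᵐ z : ℝ ∂(volume.restrict (Ioo 0 π)), z ≠ d := ae_restrict_of_ae (by simp [ae_iff, measure_singleton])
    filter_upwards [h3', this, ae_restrict_mem measurableSet_Ioo] with z hz hzd hzI
    have := (reflect_pos hK hd' hzI hzd).ne'
    simp only [Pi.zero_apply, mul_eq_zero] at hz
    tauto
  have h5 : EqOn (fun z => v (a + z) - v (a - z)) (fun _ => 0) (Ioo 0 π) :=
    Measure.eqOn_open_of_ae_eq h4 isOpen_Ioo (by fun_prop) (by fun_prop)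
  have h6 : ∀ z, z ∈ Icc (-π) π → v (a + z) = v (a - z) := by
    have hc : IsClosed {z | v (a + z) = v (a - z)} := isClosed_eq (by fun_prop) (by fun_prop)
    have hs : Ioo (-π) 0 ∪ Ioo 0 π ⊆ {z | v (a + z) = v (a - z)} := by
      rintro z (hz | hz)
      · have := h5 (x := -z) ⟨by linarith [hz.2], by linarith [hz.1]⟩
        simp only [sub_neg_eq_add, ← sub_eq_add_neg] at this
        show v (a + z) = v (a - z)
        linarith
      · have := h5 hz
        simp only at this
        show v (a + z) = v (a - z)
        linarith
    have h7 := closure_minimal hs hc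
    rw [closure_union, closure_Ioo (by linarith), closure_Ioo (by linarith),
      Icc_union_Icc_eq_Icc (by linarith) (by linarith)] at h7
    exact h7
  have h8 : ∀ z, v (a + z) = v (a - z) := by
    intro z
    have hper : Function.Periodic (fun z => v (a + z) - v (a - z)) (2 * π) := by
      intro z
      simp only
      rw [← add_assoc, hv.per, ← hv.per (a - (z + 2 * π))]
      ring_nf
    obtain ⟨w, hw, hzw⟩ := hper.exists_mem_Ico (by positivity) z (-π)
    rw [← sub_eq_zero]
    rw [hzw, sub_eq_zero]
    exact h6 w ⟨hw.1, by linarith [hw.2]⟩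
  have h9 : ∀ z, v (z + 2 * a) = v z := by
    intro z
    have := h8 (a + z)
    rw [show a - (a + z) = -z by ring, hv.even] at this
    rw [← this]; ring_nf
  set e := Real.arccos (Real.cos (2 * a)) with he
  have he0 : 0 < e := arccos_cos_pos (cos_lt_one_of_mem _ ⟨by linarith [ha'.1], by linarith [ha'.2]⟩)
  have hep : Function.Periodic v e := by
    have h2a : Function.Periodic v (2 * a) := h9
    have h2p : Function.Periodic v (2 * π) := hv.per
    obtain ⟨k, hk | hk⟩ := Real.cos_eq_cos_iff.1 (cos_arccos_cos (2 * a)).symm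
    · rw [he, hk]
      have : Function.Periodic v (k * (2 * π)) := h2p.int_mul k
      rw [show 2 * (k:ℝ) * π + 2 * a = k * (2 * π) + 2 * a by ring]
      exact this.add_period h2a
    · rw [he, hk]
      have : Function.Periodic v (k * (2 * π)) := h2p.int_mul k
      rw [show 2 * (k:ℝ) * π - 2 * a = k * (2 * π) - 2 * a by ring]
      exact this.sub_period h2a
  have hve : v e = v 0 := by have := hep 0; rwa [zero_add] at this
  obtain ⟨w, hw, hpw⟩ := hep.exists_mem_Ico₀ he0 π
  have : v w ≤ v e := hv.mono ⟨hw.1, hw.2.le.trans (Real.arccos_le_pi _)⟩ (arccos_cos_mem _) hw.2.le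
  linarith

end
end HW

namespace HW
section
variable {α : ℝ} {K : ℝ → ℝ}

theorem GK.diffAt (hK : GK α K) {x : ℝ} (hx : x ∈ Ioo 0 (2 * π)) : HasDerivAt K (deriv K x) x :=
  ((hK.smooth.differentiableOn (by simp)).differentiableAt (isOpen_Ioo.mem_nhds hx)).hasDerivAt

theorem GK.diffAt2 (hK : GK α K) {x : ℝ} (hx : x ∈ Ioo 0 (2 * π)) :
    HasDerivAt (deriv K) (deriv (deriv K) x) x := by
  have h1 : ContDiffOn ℝ 1 (deriv K) (Ioo 0 (2 * π)) :=
        hK.smooth.deriv_of_isOpen isOpen_Ioo (WithTop.coe_le_coe.2 le_top)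
  exact ((h1.differentiableOn (by simp)).differentiableAt (isOpen_Ioo.mem_nhds hx)).hasDerivAt

theorem double_diff (hK : GK α K) (w a d M : ℝ) (ha : 0 ≤ a) (hd : 0 ≤ d)
    (h1 : 0 < w - a - d) (h2 : w + a + d < 2 * π)
    (hM : ∀ s ∈ Icc (w - a - d) (w + a + d), |deriv (deriv K) s| ≤ M) :
    |K (w + a + d) + K (w - a - d) - K (w - a + d) - K (w + a - d)| ≤ 4 * a * d * M := by
  have k1 : ∀ s ∈ Icc (-d) d, |deriv K (w + a + s) - deriv K (w - a + s)| ≤ M * (2 * a) := by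
    intro s hs
    have := (convex_Icc (w - a - d) (w + a + d)).norm_image_sub_le_of_norm_hasDerivWithin_le
      (f := deriv K) (f' := deriv (deriv K)) (C := M) (x := w - a + s) (y := w + a + s)
      (fun t ht => (hK.diffAt2 ⟨by linarith [ht.1], by linarith [ht.2]⟩).hasDerivWithinAt)
      hM ⟨by linarith [hs.1], by linarith [hs.2]⟩ ⟨by linarith [hs.1], by linarith [hs.2]⟩
    rw [Real.norm_eq_abs, Real.norm_eq_abs, show w + a + s - (w - a + s) = 2 * a by ring,
      abs_of_nonneg (by linarith : 0 ≤ 2 * a)] at this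
    exact this
  have := (convex_Icc (-d) d).norm_image_sub_le_of_norm_hasDerivWithin_le
      (f := fun s => K (w + a + s) - K (w - a + s))
      (f' := fun s => deriv K (w + a + s) - deriv K (w - a + s)) (C := M * (2 * a)) (x := -d) (y := d)
      (fun t ht => by
        have e1 := (hK.diffAt (x := w + a + t) ⟨by linarith [ht.1], by linarith [ht.2]⟩).comp_const_add (w + a) t
        have e2 := (hK.diffAt (x := w - a + t) ⟨by linarith [ht.1], by linarith [ht.2]⟩).comp_const_add (w - a) t
        exact (e1.sub e2).hasDerivWithinAt)
      k1 ⟨by linarith, by linarith⟩ ⟨by linarith, by linarith⟩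
  rw [Real.norm_eq_abs, Real.norm_eq_abs, show d - -d = 2 * d by ring,
      abs_of_nonneg (by linarith : 0 ≤ 2 * d)] at this
  refine le_trans (le_of_eq ?_) (this.trans (le_of_eq ?_))
  · congr 1; ring_nf
  · ring

theorem J2 (hK : GK α K) (hα : 0 < α) (a d : ℝ) :
    ∫ w in (0:ℝ)..π, (|K (a + d - w) - K (a - d - w)| + |K (a + d + w) - K (a - d + w)|)
      = 2 * ∫ z in (0:ℝ)..π, |K (d - z) - K (d + z)| := by
  have i1 : ∀ c e s t : ℝ, IntervalIntegrable (fun w => |K (c - w) - K (e - w)|) volume s t :=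
    fun c e s t => ((hK.int_sub hα c s t).sub (hK.int_sub hα e s t)).abs
  have i2 : ∀ c e s t : ℝ, IntervalIntegrable (fun w => |K (c + w) - K (e + w)|) volume s t :=
    fun c e s t => ((hK.int_add hα c s t).sub (hK.int_add hα e s t)).abs
  have key : ∀ c e : ℝ, ∫ w in (0:ℝ)..π, (|K (c - w) - K (e - w)| + |K (c + w) - K (e + w)|) =
      ∫ w in (-π)..π, |K (c + w) - K (e + w)| := by
    intro c e
    rw [intervalIntegral.integral_add (i1 _ _ _ _) (i2 _ _ _ _),
      ← intervalIntegral.integral_add_adjacent_intervals (i2 c e (-π) 0) (i2 c e 0 π)]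
    congr 1
    have := intervalIntegral.integral_comp_neg (a := 0) (b := π) (fun w => |K (c + w) - K (e + w)|)
    simp only [neg_zero, ← sub_eq_add_neg] at this
    exact this
  have hper : Function.Periodic (fun w => |K (d + w) - K (-d + w)|) (2 * π) := by
    intro w
    simp only [← add_assoc, hK.per]
  have h2 : ∫ w in (-π)..π, |K (a + d + w) - K (a - d + w)| = ∫ w in (-π)..π, |K (d + w) - K (-d + w)| := by
    have h3 := intervalIntegral.integral_comp_add_left (a := -π) (b := π) (fun w => |K (d + w) - K (-d + w)|) a
    have h4 := hper.intervalIntegral_add_eq (a + -π) (-π)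
    rw [show a + -π + 2 * π = a + π by ring, show -π + 2 * π = π by ring] at h4
    rw [← h4, ← h3]
    congr 1; ext w
    ring_nf
  rw [key, h2, ← key, ← intervalIntegral.integral_const_mul]
  congr 1; ext w
  rw [← hK.even (-d - w), ← hK.even (-d + w), abs_sub_comm (K (d + w)),
    show -(-d - w) = d + w by ring, show -(-d + w) = d - w by ring]
  ring

theorem TT_fold (hK : GK α K) (hα : 0 < α) {v : ℝ → ℝ} (hv : Prof v) (x : ℝ) :
    TT K v x = ∫ w in (0:ℝ)..π, (K (x - w) + K (x + w)) * v w := by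
  have h1 := TT_formula hK hα v hv.cont hv.per 0 x
  rw [zero_add] at h1
  rw [h1]
  congr 1; ext w
  rw [zero_sub, hv.even, zero_add]; ring

theorem lemmaU (hK : GK α K) (hα : α ∈ Ioo (0:ℝ) 1) : ∃ C > 0, ∀ v : ℝ → ℝ, Prof v → 0 ≤ v 0 →
    ∀ A ≥ 0, ∀ β ∈ Icc 0 α, (∀ z ∈ Ioc 0 π, v z ≤ A * z ^ β) → ∀ x y : ℝ, 0 ≤ x → x < y → y ≤ π / 4 →
    TT K v y - TT K v x ≤ C * A * ((y - x) / 2) ^ α * ((x + y) / 2) ^ β := by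
  obtain ⟨C₁, hC₁, hJ⟩ := J_bound hK hα
  obtain ⟨C₂, hC₂, hbd⟩ := hK.bd
  have hα0 := hα.1
  have hα1 : 0 < 1 - α := by linarith [hα.2]
  have hpi := Real.pi_gt_three
  refine ⟨8 * C₁ + 32 * C₂ / (2 * (1 - α)), by positivity, ?_⟩
  intro v hv hv0 A hA β hβ hvA x y hx hxy hy
  set a := (x + y) / 2 with ha
  set d := (y - x) / 2 with hd
  have ha0 : 0 < a := by rw [ha]; linarith
  have hd0 : 0 < d := by rw [hd]; linarith
  have hda : d ≤ a := by rw [ha, hd]; linarith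
  have hap : a ≤ π / 4 := by rw [ha]; linarith
  have hya : y = a + d := by rw [ha, hd]; ring
  have hxa : x = a - d := by rw [ha, hd]; ring
  have hvc := hv.cont
  have hβ1 : β ≤ 1 := by linarith [hβ.2]
  have hvn : ∀ z, 0 ≤ v z := fun z => hv0.trans (hv.zero_le z)
  set B : ℝ → ℝ := fun w => K (y - w) + K (y + w) - (K (x - w) + K (x + w)) with hB
  have iB : ∀ s t, IntervalIntegrable B volume s t := fun s t =>
    ((hK.int_sub hα0 y s t).add (hK.int_add hα0 y s t)).sub
      ((hK.int_sub hα0 x s t).add (hK.int_add hα0 x s t))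
  have iBv : ∀ s t, IntervalIntegrable (fun w => B w * v w) volume s t := fun s t =>
    (iB s t).mul_continuousOn hvc.continuousOn
  have e0 : TT K v y - TT K v x = ∫ w in (0:ℝ)..π, B w * v w := by
    rw [TT_fold hK hα0 hv, TT_fold hK hα0 hv, ← intervalIntegral.integral_sub]
    · congr 1; ext w; simp only [hB]; ring
    · exact ((hK.int_sub hα0 y _ _).add (hK.int_add hα0 y _ _)).mul_continuousOn hvc.continuousOn
    · exact ((hK.int_sub hα0 x _ _).add (hK.int_add hα0 x _ _)).mul_continuousOn hvc.continuousOn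
  rw [e0, ← intervalIntegral.integral_add_adjacent_intervals (iBv 0 (4 * a)) (iBv (4 * a) π)]
  have p1 : ∫ w in (0:ℝ)..(4 * a), B w * v w ≤ 8 * C₁ * A * d ^ α * a ^ β := by
    have q1 : ∫ w in (0:ℝ)..(4 * a), B w * v w ≤ ∫ w in (0:ℝ)..(4 * a), |B w| * (A * (4 * a) ^ β) := by
      refine intervalIntegral.integral_mono_on_of_le_Ioo (by linarith) (iBv _ _) ((iB _ _).abs.mul_const _) ?_
      intro w hw
      have h1 : v w ≤ A * (4 * a) ^ β := by
        refine (hvA w ⟨hw.1, by linarith [hw.2]⟩).trans ?_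
        refine mul_le_mul_of_nonneg_left ?_ hA
        exact Real.rpow_le_rpow hw.1.le hw.2.le hβ.1
      calc B w * v w ≤ |B w| * v w := mul_le_mul_of_nonneg_right (le_abs_self _) (hvn w)
        _ ≤ _ := mul_le_mul_of_nonneg_left h1 (abs_nonneg _)
    have q2 : ∫ w in (0:ℝ)..(4 * a), |B w| ≤ 2 * (C₁ * d ^ α) := by
      have r1 : ∫ w in (0:ℝ)..(4 * a), |B w| ≤ ∫ w in (0:ℝ)..π, |B w| := by
        refine intervalIntegral.integral_mono_interval le_rfl (by linarith) (by linarith) ?_ (iB _ _).abs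
        exact Eventually.of_forall fun _ => abs_nonneg _
      have r2 : ∫ w in (0:ℝ)..π, |B w| ≤ ∫ w in (0:ℝ)..π, (|K (a + d - w) - K (a - d - w)| + |K (a + d + w) - K (a - d + w)|) := by
        refine intervalIntegral.integral_mono_on (by linarith) (iB _ _).abs ?_ ?_
        · exact ((hK.int_sub hα0 _ _ _).sub (hK.int_sub hα0 _ _ _)).abs.add
            ((hK.int_add hα0 _ _ _).sub (hK.int_add hα0 _ _ _)).abs
        · intro w _
          simp only [hB]
          rw [← hya, ← hxa]
          refine le_trans (le_of_eq ?_) (abs_add_le _ _)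
          congr 1; ring
      rw [J2 hK hα0] at r2
      have := hJ d ⟨hd0.le, by linarith⟩
      linarith
    rw [intervalIntegral.integral_mul_const] at q1
    have q3 : (4 * a) ^ β ≤ 4 * a ^ β := by
      rw [Real.mul_rpow (by norm_num) ha0.le]
      gcongr
      calc (4:ℝ) ^ β ≤ 4 ^ (1:ℝ) := Real.rpow_le_rpow_of_exponent_le (by norm_num) hβ1
        _ = 4 := by simp
    calc _ ≤ _ := q1
      _ ≤ (2 * (C₁ * d ^ α)) * (A * (4 * a ^ β)) := by gcongr
      _ = _ := by ring
  have p2 : ∫ w in (4 * a)..π, B w * v w ≤ 32 * C₂ / (2 * (1 - α)) * A * d ^ α * a ^ β := by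
    set s := α + β - 3 with hs
    have hs1 : s + 1 < 0 := by rw [hs]; linarith [hβ.2]
    have h4a : 0 < 4 * a := by linarith
    have h0n : (0:ℝ) ∉ uIcc (4 * a) π := by
      rw [uIcc_of_le (by linarith)]
      intro h; linarith [h.1]
    have q1 : ∫ w in (4 * a)..π, B w * v w ≤ ∫ w in (4 * a)..π, (32 * C₂ * A * (a * d)) * w ^ s := by
      refine intervalIntegral.integral_mono_on (by linarith) (iBv _ _) ?_ ?_
      · exact (intervalIntegral.intervalIntegrable_rpow (Or.inr h0n)).const_mul _
      intro w hw
      have hw0 : 0 < w := by linarith [hw.1]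
      have hM : ∀ t ∈ Icc (w - a - d) (w + a + d), |deriv (deriv K) t| ≤ C₂ * (8 * w ^ (α - 3)) := by
        intro t ht
        have ht1 : w / 2 ≤ t := by linarith [ht.1, hw.1]
        refine (hbd t ⟨by linarith, by linarith [ht.2, hw.2]⟩).2.2.trans ?_
        refine mul_le_mul_of_nonneg_left ?_ hC₂.le
        calc t ^ (α - 3) ≤ (w / 2) ^ (α - 3) := Real.rpow_le_rpow_of_nonpos (by linarith) ht1 (by linarith)
          _ = w ^ (α - 3) * (2:ℝ) ^ (3 - α) := by
            rw [Real.div_rpow hw0.le (by norm_num), div_eq_mul_inv, ← Real.rpow_neg (by norm_num), neg_sub]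
          _ ≤ w ^ (α - 3) * (2:ℝ) ^ (3:ℝ) := by
            gcongr
            · norm_num
            · linarith
          _ = _ := by rw [mul_comm]; norm_num
      have h1 := double_diff hK w a d _ ha0.le hd0.le (by linarith [hw.1]) (by linarith [hw.2]) hM
      have h2 : B w = K (w + a + d) + K (w - a - d) - K (w - a + d) - K (w + a - d) := by
        simp only [hB]
        rw [← hK.even (y - w), ← hK.even (x - w), hya, hxa,
          show -(a + d - w) = w - a - d by ring, show -(a - d - w) = w - a + d by ring,
          show a + d + w = w + a + d by ring, show a - d + w = w + a - d by ring]
        ring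
      rw [← h2] at h1
      have h3 := hvA w ⟨hw0, hw.2⟩
      calc B w * v w ≤ |B w| * v w := mul_le_mul_of_nonneg_right (le_abs_self _) (hvn w)
        _ ≤ (4 * a * d * (C₂ * (8 * w ^ (α - 3)))) * (A * w ^ β) :=
          mul_le_mul h1 h3 (hvn w) (by positivity)
        _ = (32 * C₂ * A * (a * d)) * w ^ s := by
          rw [hs, show α + β - 3 = (α - 3) + β by ring, Real.rpow_add hw0]; ring
    have q2 : ∫ w in (4 * a)..π, w ^ s ≤ a ^ (s + 1) / (2 * (1 - α)) := by
      rw [integral_rpow (Or.inr ⟨by linarith, h0n⟩), ← neg_div_neg_eq, neg_sub]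
      have t1 : (4 * a) ^ (s + 1) ≤ a ^ (s + 1) := Real.rpow_le_rpow_of_nonpos ha0 (by linarith) hs1.le
      have t2 : 0 ≤ π ^ (s + 1) := by positivity
      apply div_le_div₀ (by positivity) (by linarith) (by positivity)
      rw [hs]; linarith [hβ.2]
    have q3 : a * d * a ^ (s + 1) ≤ d ^ α * a ^ β := by
      have t1 : a ^ (α - 1) ≤ d ^ (α - 1) := Real.rpow_le_rpow_of_nonpos hd0 hda (by linarith)
      have t2 : a ^ (s + 1) = a ^ (α - 1) * a ^ β / a := by
        rw [hs, show α + β - 3 + 1 = (α - 1) + β - 1 by ring, Real.rpow_sub_one ha0.ne', Real.rpow_add ha0]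
      have t3 : d ^ (α - 1) * d = d ^ α := by rw [Real.rpow_sub_one hd0.ne']; field_simp
      rw [t2, ← t3]
      calc a * d * (a ^ (α - 1) * a ^ β / a) = a ^ (α - 1) * d * a ^ β := by field_simp
        _ ≤ d ^ (α - 1) * d * a ^ β := by gcongr
    rw [intervalIntegral.integral_const_mul] at q1
    calc _ ≤ _ := q1
      _ ≤ 32 * C₂ * A * (a * d) * (a ^ (s + 1) / (2 * (1 - α))) := by gcongr
      _ = 32 * C₂ / (2 * (1 - α)) * A * (a * d * a ^ (s + 1)) := by ring
      _ ≤ 32 * C₂ / (2 * (1 - α)) * A * (d ^ α * a ^ β) := by gcongr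
      _ = _ := by ring
  calc _ ≤ _ := add_le_add p1 p2
    _ = _ := by ring

end
end HW

namespace HW

/-- The shifted nonlinearity. -/
noncomputable def gg (p v : ℝ) : ℝ := p * v - 1 + |1 - v| ^ p

noncomputable def dg (p v : ℝ) : ℝ := p - p * |1 - v| ^ (p - 2) * (1 - v)

lemma gg_hasDeriv {p : ℝ} (hp : 1 < p) (v : ℝ) : HasDerivAt (gg p) (dg p v) v := by
  have h1 := (hasDerivAt_abs_rpow (1 - v) hp).comp v ((hasDerivAt_id v).const_sub 1)
  have h2 := (((hasDerivAt_id v).const_mul p).sub_const 1).add h1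
  refine h2.congr_deriv ?_
  simp only [dg]; ring

lemma gg_cont {p : ℝ} (hp : 1 < p) : Continuous (gg p) :=
  continuous_iff_continuousAt.2 fun v => (gg_hasDeriv hp v).continuousAt

lemma gg_zero (p : ℝ) : gg p 0 = 0 := by simp [gg]

lemma gg_one {p : ℝ} (hp : 1 < p) : gg p 1 = p - 1 := by
  simp [gg, Real.zero_rpow (by linarith : p ≠ 0)]

lemma dg_left {p : ℝ} (hp : 1 < p) {v : ℝ} (h : v < 1) : dg p v = p * (1 - (1 - v) ^ (p - 1)) := by
  have : 0 < 1 - v := by linarith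
  have e : (1 - v) ^ (p - 1) = (1 - v) ^ (p - 2) * (1 - v) := by
    rw [← Real.rpow_add_one this.ne']; ring_nf
  rw [dg, abs_of_pos this, e]; ring

lemma dg_right {p : ℝ} (hp : 1 < p) {v : ℝ} (h : 1 ≤ v) : dg p v = p * (1 + (v - 1) ^ (p - 1)) := by
  rcases h.eq_or_lt with rfl | h
  · simp [dg, Real.zero_rpow (by linarith : p - 1 ≠ 0)]
  have : 0 < v - 1 := by linarith
  have e : (v - 1) ^ (p - 1) = (v - 1) ^ (p - 2) * (v - 1) := by
    rw [← Real.rpow_add_one this.ne']; ring_nf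
  rw [dg, abs_sub_comm, abs_of_pos this, e]; ring

lemma dg_bounds {p : ℝ} (hp : 1 < p) (V : ℝ) : ∃ a > 0, ∃ b > 0, ∀ v ∈ Icc 0 V,
    2 * a * v ≤ dg p v ∧ dg p v ≤ 2 * b * v := by
  set W := max 1 V
  have hW : 1 ≤ W := le_max_left _ _
  have hp1 : 0 < p - 1 := by linarith
  have hWp : 0 ≤ W ^ (p - 1) := by positivity
  set m := min 1 (p - 1)
  have hm : 0 < m := lt_min one_pos hp1
  set M := max 1 (p - 1)
  have hM : 1 ≤ M := le_max_left _ _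
  refine ⟨p * m / W / 2, by positivity, p * (M + W ^ (p - 1)) / 2, by positivity, fun v hv => ?_⟩
  have hvW : v ≤ W := hv.2.trans (le_max_right _ _)
  have hm1 : m ≤ 1 := min_le_left _ _
  rcases lt_or_ge v 1 with h | h
  · rw [dg_left hp h]
    have key : m * v ≤ 1 - (1 - v) ^ (p - 1) ∧ 1 - (1 - v) ^ (p - 1) ≤ M * v := by
      rcases le_total 1 (p - 1) with h1 | h1
      · have e1 : (1 - v) ^ (p - 1) ≤ (1 - v) ^ (1:ℝ) :=
          Real.rpow_le_rpow_of_exponent_ge (by linarith) (by linarith [hv.1]) h1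
        have e2 := one_add_mul_self_le_rpow_one_add (s := -v) (by linarith) h1
        rw [Real.rpow_one] at e1
        rw [← sub_eq_add_neg] at e2
        have : m = 1 := min_eq_left h1
        have : M = p - 1 := max_eq_right h1
        constructor <;> nlinarith
      · have e1 : (1 - v) ^ (1:ℝ) ≤ (1 - v) ^ (p - 1) :=
          Real.rpow_le_rpow_of_exponent_ge (by linarith) (by linarith [hv.1]) h1
        have e2 := rpow_one_add_le_one_add_mul_self (s := -v) (by linarith) hp1.le h1
        rw [Real.rpow_one] at e1
        rw [← sub_eq_add_neg] at e2
        have : m = p - 1 := min_eq_right h1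
        have : M = 1 := max_eq_left h1
        constructor <;> nlinarith
    constructor
    · have : p * m / W * v ≤ p * m * v := by
        have : p * m / W ≤ p * m := div_le_self (by positivity) hW
        exact mul_le_mul_of_nonneg_right this hv.1
      nlinarith [key.1]
    · have : 0 ≤ W ^ (p - 1) * v := mul_nonneg hWp hv.1
      nlinarith [key.2]
  · rw [dg_right hp h]
    have e1 : 0 ≤ (v - 1) ^ (p - 1) := Real.rpow_nonneg (by linarith) _
    have e2 : (v - 1) ^ (p - 1) ≤ W ^ (p - 1) :=
      Real.rpow_le_rpow (by linarith) (by linarith) hp1.le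
    constructor
    · have : p * m / W * v ≤ p * m := by
        rw [div_mul_eq_mul_div, div_le_iff₀ (by linarith)]
        exact mul_le_mul_of_nonneg_left hvW (by positivity)
      nlinarith
    · have : (1 + (v-1)^(p-1)) ≤ (M + W ^ (p-1)) * v := by nlinarith
      nlinarith

lemma gg_bounds {p : ℝ} (hp : 1 < p) (V : ℝ) : ∃ a > 0, ∃ b > 0, ∀ x y, 0 ≤ x → x ≤ y → y ≤ V →
    a * (y ^ 2 - x ^ 2) ≤ gg p y - gg p x ∧ gg p y - gg p x ≤ b * (y ^ 2 - x ^ 2) := by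
  obtain ⟨a, ha, b, hb, h⟩ := dg_bounds hp V
  refine ⟨a, ha, b, hb, fun x y hx hxy hy => ?_⟩
  have hsq : ∀ c v : ℝ, HasDerivAt (fun v => c * v ^ 2) (2 * c * v) v := fun c v => by
    have := ((hasDerivAt_pow 2 v).const_mul c)
    refine this.congr_deriv ?_
    simp; ring
  have m1 : MonotoneOn (fun v => gg p v - a * v ^ 2) (Icc 0 V) := by
    have hd : ∀ v, HasDerivAt (fun v => gg p v - a * v ^ 2) (dg p v - 2 * a * v) v := fun v =>
      (gg_hasDeriv hp v).sub (hsq a v)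
    refine monotoneOn_of_deriv_nonneg (convex_Icc _ _)
      (fun v _ => (hd v).continuousAt.continuousWithinAt)
      (fun v _ => (hd v).differentiableAt.differentiableWithinAt) fun v hv => ?_
    rw [(hd v).deriv]; linarith [(h v (interior_subset hv)).1]
  have m2 : MonotoneOn (fun v => b * v ^ 2 - gg p v) (Icc 0 V) := by
    have hd : ∀ v, HasDerivAt (fun v => b * v ^ 2 - gg p v) (2 * b * v - dg p v) v := fun v =>
      (hsq b v).sub (gg_hasDeriv hp v)
    refine monotoneOn_of_deriv_nonneg (convex_Icc _ _)
      (fun v _ => (hd v).continuousAt.continuousWithinAt)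
      (fun v _ => (hd v).differentiableAt.differentiableWithinAt) fun v hv => ?_
    rw [(hd v).deriv]; linarith [(h v (interior_subset hv)).2]
  have i1 := m1 ⟨hx, hxy.trans hy⟩ ⟨hx.trans hxy, hy⟩ hxy
  have i2 := m2 ⟨hx, hxy.trans hy⟩ ⟨hx.trans hxy, hy⟩ hxy
  simp only at i1 i2
  constructor <;> linarith

lemma gg_strict {p : ℝ} (hp : 1 < p) {x y : ℝ} (hx : 0 ≤ x) (hxy : x < y) : gg p x < gg p y := by
  obtain ⟨a, ha, b, hb, h⟩ := gg_bounds hp y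
  have := (h x y hx hxy.le le_rfl).1
  have : 0 < a * (y ^ 2 - x ^ 2) := mul_pos ha (by nlinarith)
  linarith

lemma dg_pos {p : ℝ} (hp : 1 < p) {v : ℝ} (hv : 0 < v) : 0 < dg p v := by
  obtain ⟨a, ha, b, hb, h⟩ := dg_bounds hp v
  have := (h v ⟨hv.le, le_rfl⟩).1
  have : 0 < 2 * a * v := by positivity
  linarith

lemma gg_super {p : ℝ} (hp : 1 < p) (C : ℝ) : ∃ D, ∀ v, 0 ≤ v → C * v - D ≤ gg p v := by
  set M := max C 1
  have hM : 1 ≤ M := le_max_right _ _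
  set R := (M / p) ^ (1 / (p - 1)) with hR
  have hp1 : 0 < p - 1 := by linarith
  have hRp : 0 < R := by positivity
  have hRp1 : R ^ (p - 1) = M / p := by
    rw [hR, ← Real.rpow_mul (by positivity)]
    simp [hp1.ne']
  -- Bernoulli at `s / R`
  have key : ∀ s : ℝ, 0 ≤ s → M * s - M * R ≤ s ^ p := by
    intro s hs
    have e := one_add_mul_self_le_rpow_one_add (s := s / R - 1) (by
      have : 0 ≤ s / R := by positivity
      linarith) hp.le
    rw [add_sub_cancel, Real.div_rpow hs hRp.le, le_div_iff₀ (by positivity)] at e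
    have e2 : R ^ p = R * (M / p) := by
      rw [← hRp1, ← Real.rpow_one_add' hRp.le (by linarith)]; ring_nf
    rw [e2] at e
    have e3 : (1 + p * (s / R - 1)) * (R * (M / p)) = M * s - M * R + R * (M / p) := by
      field_simp; ring
    have : 0 < R * (M / p) := by positivity
    linarith
  refine ⟨M + M * R + 1, fun v hv => ?_⟩
  have h1 := key |1 - v| (abs_nonneg _)
  have h2 : v - 1 ≤ |1 - v| := by rw [abs_sub_comm]; exact le_abs_self _
  have h3 : C ≤ M := le_max_left _ _
  simp only [gg]
  nlinarith

theorem gi_exists {p : ℝ} (hp : 1 < p) : ∃ gi : ℝ → ℝ, Continuous gi ∧ StrictMono gi ∧ gi 0 = 0 ∧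
    (∀ v, 0 ≤ v → gi (gg p v) = v) ∧ (∀ s, 0 ≤ s → gg p (gi s) = s) := by
  set G : ℝ → ℝ := fun v => gg p (max v 0) + min v 0
  have hc : Continuous G := by
    have := gg_cont hp
    fun_prop
  have hG : ∀ v, 0 ≤ v → G v = gg p v := fun v hv => by simp [G, hv]
  have hG' : ∀ v, v ≤ 0 → G v = v := fun v hv => by simp [G, hv, gg_zero]
  have hm : StrictMono G := by
    intro x y hxy
    rcases le_total 0 x with hx | hx
    · rw [hG x hx, hG y (hx.trans hxy.le)]; exact gg_strict hp hx hxy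
    · rw [hG' x hx]
      rcases le_total y 0 with hy | hy
      · rw [hG' y hy]; exact hxy
      · rw [hG y hy]
        rcases hy.eq_or_lt with rfl | hy
        · rw [gg_zero]; exact hxy
        · have := gg_strict hp le_rfl hy
          rw [gg_zero] at this; linarith
  have hs : Function.Surjective G := by
    refine hc.surjective ?_ ?_
    · obtain ⟨D, hD⟩ := gg_super hp 1
      refine tendsto_atTop_mono' _ ?_ (tendsto_atTop_add_const_right _ (-D) tendsto_id)
      filter_upwards [eventually_ge_atTop 0] with v hv
      rw [hG v hv]; have := hD v hv; simp; linarith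
    · refine tendsto_id.congr' ?_
      filter_upwards [eventually_le_atBot 0] with v hv
      rw [hG' v hv]; rfl
  set e := hm.orderIsoOfSurjective G hs
  have he : ∀ v, e v = G v := fun v => rfl
  have h3 : ∀ v, 0 ≤ v → e.symm (gg p v) = v := fun v hv => by
    rw [← hG v hv, ← he]; simp
  have h0 : e.symm 0 = 0 := by have := h3 0 le_rfl; rwa [gg_zero] at this
  refine ⟨e.symm, e.symm.continuous, e.symm.strictMono, h0, h3, fun s hs => ?_⟩
  have : 0 ≤ e.symm s := by
    rw [← h0]; exact e.symm.monotone hs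
  rw [← hG _ this, ← he]; simp

end HW

namespace HW

/-- Predicate cutting out the invariant set of half-period profiles. -/
def HSp (α L ε : ℝ) (h : Icc 0 π → ℝ) : Prop :=
  h ⟨0, le_rfl, pi_pos.le⟩ = 0 ∧ (∀ x y, x ≤ y → h x ≤ h y) ∧
  (∀ x : Icc 0 π, ε * (1 - cos x) ≤ h x) ∧
  ∀ x y : Icc 0 π, |h x - h y| ≤ L * |(x:ℝ) - y| ^ α

def HS (α L ε : ℝ) : Set C(Icc 0 π, ℝ) := {h | HSp α L ε h}

lemma HSp.cont {α L ε : ℝ} (hα : 0 < α) {h : Icc 0 π → ℝ} (hh : HSp α L ε h) : Continuous h := by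
  rw [continuous_iff_continuousAt]
  intro x
  rw [ContinuousAt, tendsto_iff_dist_tendsto_zero]
  have h0 : Tendsto (fun y : Icc 0 π => L * |(y:ℝ) - x| ^ α) (𝓝 x) (𝓝 0) := by
    have : Continuous (fun y : Icc 0 π => L * |(y:ℝ) - x| ^ α) := by
      refine continuous_const.mul (Continuous.rpow_const (by fun_prop) fun _ => Or.inr hα.le)
    have h1 := this.tendsto x
    simpa [Real.zero_rpow hα.ne'] using h1
  exact squeeze_zero (fun _ => dist_nonneg) (fun y => by rw [Real.dist_eq]; exact hh.2.2.2 y x) h0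

lemma HS_compact {α L ε : ℝ} (hα : 0 < α) (hL : 0 ≤ L) : IsCompact (HS α L ε) := by
  apply ArzelaAscoli.isCompact_of_equicontinuous
  · have e : Set.image ContinuousMap.toFun (HS α L ε) = {h | HSp α L ε h} := by
      ext h
      constructor
      · rintro ⟨k, hk, rfl⟩; exact hk
      · intro hh; exact ⟨⟨h, hh.cont hα⟩, hh, rfl⟩
    rw [e]
    refine IsCompact.of_isClosed_subset
      (isCompact_univ_pi (fun _ : Icc 0 π => isCompact_Icc (a := -(L * π ^ α)) (b := L * π ^ α))) ?_ ?_
    · have e2 : {h | HSp α L ε h} = {h | h ⟨0, le_rfl, pi_pos.le⟩ = 0} ∩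
          (⋂ x, ⋂ y, ⋂ (_ : x ≤ y), {h : Icc 0 π → ℝ | h x ≤ h y}) ∩
          (⋂ x : Icc 0 π, {h : Icc 0 π → ℝ | ε * (1 - cos x) ≤ h x}) ∩
          (⋂ x, ⋂ y, {h : Icc 0 π → ℝ | |h x - h y| ≤ L * |(x:ℝ) - y| ^ α}) := by
        ext h; simp only [HSp, mem_ofPred_eq, mem_inter_iff, mem_iInter, and_assoc]
      rw [e2]
      refine IsClosed.inter (IsClosed.inter (IsClosed.inter ?_ ?_) ?_) ?_
      · exact isClosed_eq (continuous_apply _) continuous_const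
      · exact isClosed_iInter fun x => isClosed_iInter fun y => isClosed_iInter fun _ =>
          isClosed_le (continuous_apply _) (continuous_apply _)
      · exact isClosed_iInter fun x => isClosed_le continuous_const (continuous_apply _)
      · exact isClosed_iInter fun x => isClosed_iInter fun y =>
          isClosed_le (by fun_prop) continuous_const
    · intro h hh x _
      have h1 := hh.2.2.2 x ⟨0, le_rfl, pi_pos.le⟩
      rw [hh.1, sub_zero, sub_zero] at h1
      refine abs_le.1 ?_
      refine h1.trans (mul_le_mul_of_nonneg_left ?_ hL)
      exact Real.rpow_le_rpow (abs_nonneg _) (by rw [abs_of_nonneg x.2.1]; exact x.2.2) hα.le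
  · intro x
    rw [Metric.equicontinuousAt_iff_right]
    intro e he
    have h0 : Tendsto (fun y : Icc 0 π => L * |(x:ℝ) - y| ^ α) (𝓝 x) (𝓝 0) := by
      have : Continuous (fun y : Icc 0 π => L * |(x:ℝ) - y| ^ α) := by
        refine continuous_const.mul (Continuous.rpow_const (by fun_prop) fun _ => Or.inr hα.le)
      have h1 := this.tendsto x
      simpa [Real.zero_rpow hα.ne'] using h1
    filter_upwards [h0.eventually_lt_const he] with y hy i
    exact (i.2.2.2.2 x y).trans_lt hy

lemma HS_convex {α L ε : ℝ} : Convex ℝ (HS α L ε) := by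
  rintro h ⟨h1, h2, h3, h4⟩ k ⟨k1, k2, k3, k4⟩ a b ha hb hab
  refine ⟨?_, ?_, ?_, ?_⟩
  · simp [h1, k1]
  · intro x y hxy
    have := mul_le_mul_of_nonneg_left (h2 x y hxy) ha
    have := mul_le_mul_of_nonneg_left (k2 x y hxy) hb
    simp; linarith
  · intro x
    have e1 := mul_le_mul_of_nonneg_left (h3 x) ha
    have e2 := mul_le_mul_of_nonneg_left (k3 x) hb
    simp only [ContinuousMap.add_apply, ContinuousMap.smul_apply, smul_eq_mul]
    calc ε * (1 - cos x) = a * (ε * (1 - cos x)) + b * (ε * (1 - cos x)) := by rw [← add_mul, hab, one_mul]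
      _ ≤ _ := add_le_add e1 e2
  · intro x y
    have e1 := mul_le_mul_of_nonneg_left (h4 x y) ha
    have e2 := mul_le_mul_of_nonneg_left (k4 x y) hb
    simp only [ContinuousMap.add_apply, ContinuousMap.smul_apply, smul_eq_mul]
    calc |a * h x + b * k x - (a * h y + b * k y)| = |a * (h x - h y) + b * (k x - k y)| := by ring_nf
      _ ≤ a * |h x - h y| + b * |k x - k y| := by
        refine (abs_add_le _ _).trans ?_
        rw [abs_mul, abs_mul, abs_of_nonneg ha, abs_of_nonneg hb]
      _ ≤ a * (L * |(x:ℝ) - y| ^ α) + b * (L * |(x:ℝ) - y| ^ α) := add_le_add e1 e2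
      _ = _ := by rw [← add_mul, hab, one_mul]

/-- even periodic extension -/
noncomputable def ext (w : C(Icc 0 π, ℝ)) (x : ℝ) : ℝ := w ⟨arccos (cos x), arccos_cos_mem x⟩

lemma ext_cont (w : C(Icc 0 π, ℝ)) : Continuous (ext w) := by
  refine w.continuous.comp (Continuous.subtype_mk ?_ _)
  exact continuous_arccos.comp continuous_cos

lemma ext_even (w : C(Icc 0 π, ℝ)) (x : ℝ) : ext w (-x) = ext w x := by simp [ext]
lemma ext_per (w : C(Icc 0 π, ℝ)) (x : ℝ) : ext w (x + 2 * π) = ext w x := by simp [ext]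
lemma ext_eq (w : C(Icc 0 π, ℝ)) (x : ℝ) (hx : x ∈ Icc 0 π) : ext w x = w ⟨x, hx⟩ := by
  simp only [ext]; congr 2; exact arccos_cos hx.1 hx.2
lemma ext_prof (w : C(Icc 0 π, ℝ)) (h : ∀ x y, x ≤ y → w x ≤ w y) : Prof (ext w) :=
  ⟨ext_cont w, ext_even w, ext_per w, fun x hx y hy hxy => by
    rw [ext_eq w x hx, ext_eq w y hy]; exact h _ _ hxy⟩

/-- restriction -/
noncomputable def res (f : ℝ → ℝ) (hf : Continuous f) : C(Icc 0 π, ℝ) :=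
  ⟨fun x => f x, hf.comp continuous_subtype_val⟩

lemma ext_res (f : ℝ → ℝ) (hf : Continuous f) (he : ∀ x, f (-x) = f x) (hp : ∀ x, f (x + 2 * π) = f x) :
    ext (res f hf) = f := by
  funext x
  simp only [ext, res, ContinuousMap.coe_mk]
  exact evper_eq f he hp _ _ (cos_arccos_cos x)

lemma ext_abs (w : C(Icc 0 π, ℝ)) (x : ℝ) : |ext w x| ≤ ‖w‖ := by
  rw [← Real.norm_eq_abs]; exact w.norm_coe_le_norm _

section
variable {α : ℝ} {K : ℝ → ℝ}

lemma TT_ii (hK : GK α K) (hα : 0 < α) {v : ℝ → ℝ} (hv : Continuous v) (x : ℝ) :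
    IntervalIntegrable (fun y => K (x - y) * v y) volume (-π) π :=
  (hK.int_sub hα x _ _).mul_continuousOn hv.continuousOn

lemma TT_sub (hK : GK α K) (hα : 0 < α) {v w : ℝ → ℝ} (hv : Continuous v) (hw : Continuous w) (x : ℝ) :
    TT K (fun y => v y - w y) x = TT K v x - TT K w x := by
  simp only [TT, mul_sub]
  exact intervalIntegral.integral_sub (TT_ii hK hα hv x) (TT_ii hK hα hw x)

/-- The convolution operator on half-period functions. -/
noncomputable def Top (hK : GK α K) (hα : α ∈ Ioo (0:ℝ) 1) (w : C(Icc 0 π, ℝ)) : C(Icc 0 π, ℝ) :=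
  res (fun x => TT K (ext w) x - TT K (ext w) 0)
    ((TT_cont hK hα _ (ext_cont w) (ext_per w)).sub continuous_const)

lemma Top_cont (hK : GK α K) (hα : α ∈ Ioo (0:ℝ) 1) : Continuous (Top hK hα) := by
  have hN := L1_nonneg K
  refine (LipschitzWith.of_dist_le_mul (K := (2 * L1 K).toNNReal) fun w z => ?_).continuous
  rw [Real.coe_toNNReal _ (by positivity)]
  rw [ContinuousMap.dist_le (by positivity)]
  intro x
  have hb : ∀ x, |TT K (ext w) x - TT K (ext z) x| ≤ dist w z * L1 K := fun x => by
    rw [← TT_sub hK hα.1 (ext_cont w) (ext_cont z)]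
    refine TT_bound hK hα.1 _ ((ext_cont w).sub (ext_cont z)) _ (fun y => ?_) x
    change |ext w y - ext z y| ≤ _
    rw [← Real.dist_eq]; exact ContinuousMap.dist_apply_le_dist _
  have h1 := hb x
  have h2 := hb 0
  rw [Real.dist_eq]
  simp only [Top, res, ContinuousMap.coe_mk]
  rw [abs_le] at h1 h2 ⊢
  constructor <;> linarith [h1.1, h1.2, h2.1, h2.2]

noncomputable def mean (w : C(Icc 0 π, ℝ)) : ℝ := (∫ y in (-π)..π, ext w y) / (2 * π)

lemma mean_cont : Continuous mean := by
  have hpi := pi_pos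
  refine (LipschitzWith.of_dist_le_mul (K := 1) fun w z => ?_).continuous
  have e : mean w - mean z = (∫ y in (-π)..π, (ext w y - ext z y)) / (2 * π) := by
    rw [intervalIntegral.integral_sub ((ext_cont w).intervalIntegrable _ _)
      ((ext_cont z).intervalIntegrable _ _)]
    simp only [mean]; ring
  rw [Real.dist_eq, e, abs_div, abs_of_pos (by positivity : 0 < 2 * π), div_le_iff₀ (by positivity)]
  have := intervalIntegral.norm_integral_le_of_norm_le_const (a := -π) (b := π)
    (f := fun y => ext w y - ext z y) (C := dist w z) (fun y _ => by
      rw [← dist_eq_norm]; exact ContinuousMap.dist_apply_le_dist _)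
  rw [Real.norm_eq_abs] at this
  refine this.trans (le_of_eq ?_)
  rw [show π - -π = 2 * π by ring, abs_of_pos (by positivity)]; simp

/-- superposition -/
noncomputable def Vop (gi : ℝ → ℝ) (hgi : Continuous gi) (q : C(Icc 0 π, ℝ) × ℝ) : C(Icc 0 π, ℝ) :=
  (ContinuousMap.mk gi hgi).comp (q.2 • q.1)

lemma Vop_cont (gi : ℝ → ℝ) (hgi : Continuous gi) : Continuous (Vop gi hgi) :=
  (ContinuousMap.continuous_postcomp _).comp (continuous_snd.smul continuous_fst)

lemma ext_Vop (gi : ℝ → ℝ) (hgi : Continuous gi) (q : C(Icc 0 π, ℝ) × ℝ) (x : ℝ) :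
    ext (Vop gi hgi q) x = gi (q.2 * ext q.1 x) := rfl

end
end HW

namespace HW

structure GI (p : ℝ) (gi : ℝ → ℝ) : Prop where
  cont : Continuous gi
  mono : StrictMono gi
  zero : gi 0 = 0
  left : ∀ v, 0 ≤ v → gi (gg p v) = v
  right : ∀ s, 0 ≤ s → gg p (gi s) = s

lemma GI.nonneg {p : ℝ} {gi : ℝ → ℝ} (h : GI p gi) {s : ℝ} (hs : 0 ≤ s) : 0 ≤ gi s := by
  rw [← h.zero]; exact h.mono.monotone hs

lemma GI.choice {p : ℝ} (hp : 1 < p) {gi : ℝ → ℝ} (h : GI p gi) (C a d : ℝ) (hC : 0 ≤ C) (ha : 0 ≤ a)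
    (hd : 0 ≤ d) : ∃ L > 0, C * gi (a * L) + d ≤ L := by
  obtain ⟨D, hD⟩ := gg_super hp (2 * C * a + 1)
  have hA : 0 < 2 * C * a + 1 := by positivity
  refine ⟨2 * (C * |D| / (2 * C * a + 1) + d) + 1, by positivity, ?_⟩
  set L := 2 * (C * |D| / (2 * C * a + 1) + d) + 1 with hL
  have hL0 : 0 < L := by positivity
  have h1 := hD (gi (a * L)) (h.nonneg (by positivity))
  rw [h.right _ (by positivity)] at h1
  have h2 : gi (a * L) ≤ (a * L + |D|) / (2 * C * a + 1) := by
    rw [le_div_iff₀ hA]; linarith [le_abs_self D]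
  have h3 := mul_le_mul_of_nonneg_left h2 hC
  have h4 : C * ((a * L + |D|) / (2 * C * a + 1)) = C * a / (2 * C * a + 1) * L + C * |D| / (2 * C * a + 1) := by
    ring
  have h5 : C * a / (2 * C * a + 1) ≤ 1 / 2 := by
    rw [div_le_iff₀ hA]; linarith
  have h6 := mul_le_mul_of_nonneg_right h5 hL0.le
  linarith

structure Sol (K : ℝ → ℝ) (p ε τ : ℝ) (v : ℝ → ℝ) : Prop where
  prof : Prof v
  zero : v 0 = 0
  mean : ∫ y in (-π)..π, v y = 2 * π
  pos : 0 < τ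
  eqn : ∀ x, gg p (v x) = τ * (TT K v x - TT K v 0 + ε * (1 - cos x))

lemma cos_hol {α : ℝ} (hα : α ∈ Ioo (0:ℝ) 1) (x y : ℝ) (h : |x - y| ≤ π) :
    |cos x - cos y| ≤ π ^ (1 - α) * |x - y| ^ α := by
  have h1 : |cos x - cos y| ≤ |x - y| := by
    have := Real.abs_cos_sub_cos_le x y
    simpa using this
  refine h1.trans ?_
  rcases eq_or_lt_of_le (abs_nonneg (x - y)) with h0 | h0
  · rw [← h0, Real.zero_rpow hα.1.ne']; simp
  · calc |x - y| = |x - y| ^ (1 - α) * |x - y| ^ α := by rw [← Real.rpow_add h0]; simp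
      _ ≤ _ := by
        gcongr
        linarith [hα.2]

section
variable {α : ℝ} {K : ℝ → ℝ} {p : ℝ} {gi : ℝ → ℝ}

lemma Icc_abs_sub (x y : Icc 0 π) : |(x:ℝ) - y| ≤ π := by
  rw [abs_le]; constructor <;> linarith [x.2.1, x.2.2, y.2.1, y.2.2]

theorem exists_eps (hK : GK α K) (hα : α ∈ Ioo (0:ℝ) 1) (hp : 1 < p) (hg : GI p gi) (ε : ℝ) (hε : 0 < ε) :
    ∃ τ v, Sol K p ε τ v := by
  have hpi := pi_pos
  obtain ⟨C, hC, hH⟩ := TT_holder hK hα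
  have hg3 : 0 < gg p 3 := by have := gg_strict hp le_rfl (by norm_num : (0:ℝ) < 3); rwa [gg_zero] at this
  set T := gg p 3 / ε with hT
  have hT0 : 0 < T := by positivity
  obtain ⟨L, hL, hLc⟩ := hg.choice hp C (T * π ^ α) (ε * π ^ (1 - α)) hC.le (by positivity) (by positivity)
  set b : C(Icc 0 π, ℝ) := res (fun x => ε * (1 - cos x)) (by fun_prop)
  set S : Set (C(Icc 0 π, ℝ) × ℝ) := HS α L ε ×ˢ Icc 0 T
  set F : C(Icc 0 π, ℝ) × ℝ → C(Icc 0 π, ℝ) × ℝ := fun q =>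
    (Top hK hα (Vop gi hg.cont q) + b, max 0 (min T (q.2 + 1 - mean (Vop gi hg.cont q))))
  have hFc : Continuous F := by
    have h1 := Top_cont hK hα
    have h2 := Vop_cont gi hg.cont
    have h3 := mean_cont
    refine ((h1.comp h2).add continuous_const).prodMk ?_
    exact continuous_const.max (continuous_const.min ((continuous_snd.add continuous_const).sub (h3.comp h2)))
  have hmonoV : ∀ q ∈ S, ∀ x y, x ≤ y → Vop gi hg.cont q x ≤ Vop gi hg.cont q y := by
    intro q hq x y hxy
    exact hg.mono.monotone (mul_le_mul_of_nonneg_left (hq.1.2.1 x y hxy) hq.2.1)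
  have hprofV : ∀ q ∈ S, Prof (ext (Vop gi hg.cont q)) := fun q hq => ext_prof _ (hmonoV q hq)
  have hq0 : ∀ q ∈ S, ∀ x, 0 ≤ q.1 x := fun q hq x => by
    have := hq.1.2.2.1 x
    have : 0 ≤ ε * (1 - cos x) := mul_nonneg hε.le (by linarith [cos_le_one x])
    linarith
  have hq0e : ∀ q ∈ S, ∀ x : ℝ, 0 ≤ ext q.1 x := fun q hq x => hq0 q hq _
  have hqL : ∀ q ∈ S, ∀ x, q.1 x ≤ L * π ^ α := fun q hq x => by
    have h1 := hq.1.2.2.2 x ⟨0, le_rfl, pi_pos.le⟩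
    rw [hq.1.1, sub_zero, sub_zero] at h1
    refine (le_abs_self _).trans (h1.trans (mul_le_mul_of_nonneg_left ?_ hL.le))
    exact Real.rpow_le_rpow (abs_nonneg _) (by rw [abs_of_nonneg x.2.1]; exact x.2.2) hα.1.le
  have hVb : ∀ q ∈ S, ∀ x, |ext (Vop gi hg.cont q) x| ≤ gi (T * π ^ α * L) := fun q hq x => by
    rw [ext_Vop, abs_of_nonneg (hg.nonneg (mul_nonneg hq.2.1 (hq0e q hq x)))]
    apply hg.mono.monotone
    calc q.2 * ext q.1 x ≤ T * (L * π ^ α) :=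
          mul_le_mul hq.2.2 (hqL q hq _) (hq0 q hq _) hT0.le
      _ = _ := by ring
  have hmaps : MapsTo F S S := by
    intro q hq
    refine ⟨⟨?_, ?_, ?_, ?_⟩, le_max_left _ _, max_le hT0.le (min_le_left _ _)⟩
    · simp [F, Top, res, b]
    · intro x y hxy
      have h1 := TT_mono hK hα.1 (hprofV q hq) x.2 y.2 hxy
      have h2 : cos y ≤ cos x := Real.cos_le_cos_of_nonneg_of_le_pi x.2.1 y.2.2 hxy
      have h3 := mul_le_mul_of_nonneg_left h2 hε.le
      simp only [F, Top, res, b, ContinuousMap.add_apply, ContinuousMap.coe_mk]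
      linarith
    · intro x
      have h1 := TT_mono hK hα.1 (hprofV q hq) ⟨le_rfl, hpi.le⟩ x.2 x.2.1
      simp only [F, Top, res, b, ContinuousMap.add_apply, ContinuousMap.coe_mk]
      linarith
    · intro x y
      have h1 := hH _ (ext_cont _) (ext_per _) _ (hVb q hq) x y
      have h2 := mul_le_mul_of_nonneg_left (cos_hol hα x y (Icc_abs_sub x y)) hε.le
      have h3 := mul_le_mul_of_nonneg_right hLc (Real.rpow_nonneg (abs_nonneg ((x:ℝ) - y)) α)
      simp only [F, Top, res, b, ContinuousMap.add_apply, ContinuousMap.coe_mk]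
      refine le_trans ?_ (le_trans (add_le_add h1 h2) (le_trans (le_of_eq (by ring)) h3))
      rw [← abs_of_pos hε, ← abs_mul, abs_of_pos hε, ← abs_neg (ε * _)]
      refine le_trans (le_of_eq ?_) (abs_add_le _ _)
      ring_nf
  have hSne : S.Nonempty := by
    refine ⟨(b, 0), ⟨?_, ?_, ?_, ?_⟩, le_rfl, hT0.le⟩
    · simp [res, b]
    · intro x y hxy
      have h2 : cos y ≤ cos x := Real.cos_le_cos_of_nonneg_of_le_pi x.2.1 y.2.2 hxy
      have h3 := mul_le_mul_of_nonneg_left h2 hε.le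
      simp only [res, b, ContinuousMap.coe_mk]
      linarith
    · intro x; simp [res, b]
    · intro x y
      have h2 := mul_le_mul_of_nonneg_left (cos_hol hα x y (Icc_abs_sub x y)) hε.le
      have h4 : ε * π ^ (1 - α) ≤ L := by
        have : 0 ≤ C * gi (T * π ^ α * L) := mul_nonneg hC.le (hg.nonneg (by positivity))
        linarith
      have h3 := mul_le_mul_of_nonneg_right h4 (Real.rpow_nonneg (abs_nonneg ((x:ℝ) - y)) α)
      simp only [res, b, ContinuousMap.coe_mk]
      refine le_trans (le_of_eq ?_) (h2.trans ((le_of_eq (by ring)).trans h3))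
      rw [← mul_sub, abs_mul, abs_of_pos hε, abs_sub_comm]; ring_nf
  obtain ⟨q, hq, hfix⟩ := schauder S ((HS_compact hα.1 hL.le).prod isCompact_Icc)
    (HS_convex.prod (convex_Icc _ _)) hSne F hFc.continuousOn hmaps
  set v := ext (Vop gi hg.cont q) with hv
  have e1 : Top hK hα (Vop gi hg.cont q) + b = q.1 := congrArg Prod.fst hfix
  have e2 : max 0 (min T (q.2 + 1 - mean (Vop gi hg.cont q))) = q.2 := congrArg Prod.snd hfix
  have hvx : ∀ x, v x = gi (q.2 * ext q.1 x) := ext_Vop gi hg.cont q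
  have hτ0 : q.2 ≠ 0 := by
    intro h0
    have : mean (Vop gi hg.cont q) = 0 := by
      have : ∀ x, ext (Vop gi hg.cont q) x = 0 := fun x => by
        rw [ext_Vop, h0, zero_mul, hg.zero]
      simp [mean, this]
    rw [this, h0] at e2
    have : 0 < min T (0 + 1 - 0) := lt_min hT0 (by norm_num)
    exact absurd e2 (lt_of_lt_of_le this (le_max_right _ _)).ne'
  have hτ : 0 < q.2 := lt_of_le_of_ne hq.2.1 hτ0.symm
  have hvn : ∀ x, 0 ≤ v x := fun x => hg.nonneg (mul_nonneg hτ.le (hq0 q hq _))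
  have hτT : q.2 ≠ T := by
    intro h0
    have hm : 1 < mean (Vop gi hg.cont q) := by
      rw [mean, lt_div_iff₀ (by positivity), one_mul]
      have hii : ∀ a b, IntervalIntegrable v volume a b := fun a b =>
        (ext_cont _).intervalIntegrable _ _
      have hge : ∀ x, cos x ≤ 0 → 3 ≤ v x := fun x hx => by
        rw [hvx, ← hg.left 3 (by norm_num)]
        apply hg.mono.monotone
        have : ε * (1 - cos x) ≤ ext q.1 x := by
          have := hq.1.2.2.1 ⟨arccos (cos x), arccos_cos_mem x⟩
          simp only [cos_arccos_cos] at this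
          exact this
        rw [h0, hT, div_mul_eq_mul_div, le_div_iff₀ hε]
        have : ε ≤ ext q.1 x := by nlinarith
        exact mul_le_mul_of_nonneg_left this hg3.le
      have i1 : 3 * (π / 2) ≤ ∫ y in (-π)..(-(π/2)), v y := by
        have := intervalIntegral.integral_mono_on (a := -π) (b := -(π/2)) (by linarith)
          (f := fun _ => (3:ℝ)) (g := v) (by simp) (hii _ _) fun x hx => hge x (by
            rw [← Real.cos_neg]
            exact Real.cos_nonpos_of_pi_div_two_le_of_le (by linarith [hx.2]) (by linarith [hx.1]))
        rw [intervalIntegral.integral_const, smul_eq_mul] at this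
        linarith
      have i2 : 3 * (π / 2) ≤ ∫ y in (π/2)..π, v y := by
        have := intervalIntegral.integral_mono_on (a := π/2) (b := π) (by linarith)
          (f := fun _ => (3:ℝ)) (g := v) (by simp) (hii _ _) fun x hx => hge x (by
            exact Real.cos_nonpos_of_pi_div_two_le_of_le (by linarith [hx.1]) (by linarith [hx.2]))
        rw [intervalIntegral.integral_const, smul_eq_mul] at this
        linarith
      have i3 : 0 ≤ ∫ y in (-(π/2))..(π/2), v y :=
        intervalIntegral.integral_nonneg (by linarith) fun x _ => hvn x
      have s1 := intervalIntegral.integral_add_adjacent_intervals (hii (-π) (-(π/2))) (hii _ (π/2))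
      have s2 := intervalIntegral.integral_add_adjacent_intervals (hii (-π) (π/2)) (hii _ π)
      rw [← hv]
      linarith
    have : max 0 (min T (q.2 + 1 - mean (Vop gi hg.cont q))) < T := by
      refine max_lt hT0 (lt_of_le_of_lt (min_le_right _ _) ?_)
      rw [h0]; linarith
    rw [e2] at this
    linarith
  have hτT' : q.2 < T := lt_of_le_of_ne hq.2.2 hτT
  have hmean : mean (Vop gi hg.cont q) = 1 := by
    rcases max_choice 0 (min T (q.2 + 1 - mean (Vop gi hg.cont q))) with h | h
    · rw [h] at e2; linarith
    · rw [h] at e2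
      rcases min_choice T (q.2 + 1 - mean (Vop gi hg.cont q)) with h | h
      · rw [h] at e2; linarith
      · rw [h] at e2; linarith
  have hprof := hprofV q hq
  have hext : ∀ x, ext q.1 x = TT K v x - TT K v 0 + ε * (1 - cos x) := by
    intro x
    have hT := TT_prof hK hα hprof
    have : ext q.1 x = (Top hK hα (Vop gi hg.cont q) + b) ⟨arccos (cos x), arccos_cos_mem x⟩ := by
      rw [e1]; rfl
    rw [this]
    simp only [Top, res, b, ContinuousMap.add_apply, ContinuousMap.coe_mk, cos_arccos_cos]
    rw [evper_eq (TT K v) hT.even hT.per _ _ (cos_arccos_cos x)]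
  refine ⟨q.2, v, hprof, ?_, ?_, hτ, fun x => ?_⟩
  · rw [hvx, hext]; simp [hg.zero]
  · have := hmean
    rw [mean, div_eq_one_iff_eq (by positivity)] at this
    exact this
  · rw [hvx, hg.right _ (mul_nonneg hτ.le (hq0e q hq x)), hext]

end
end HW

namespace HW
section
variable {α : ℝ} {K : ℝ → ℝ} {p : ℝ} {gi : ℝ → ℝ} {ε τ : ℝ} {v : ℝ → ℝ}

lemma Sol.nonneg (h : Sol K p ε τ v) (x : ℝ) : 0 ≤ v x := by
  have := h.prof.zero_le x; rwa [h.zero] at this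

lemma Sol.one_le_pi (h : Sol K p ε τ v) : 1 ≤ v π := by
  have hpi := pi_pos
  have := intervalIntegral.integral_mono_on (μ := volume) (a := -π) (b := π) (by linarith)
    (f := v) (g := fun _ => v π) (h.prof.cont.intervalIntegrable _ _) intervalIntegrable_const
    fun x _ => h.prof.le_pi x
  rw [h.mean, intervalIntegral.integral_const, smul_eq_mul] at this
  nlinarith

lemma Sol.le_four (h : Sol K p ε τ v) : v (3 * π / 4) ≤ 4 := by
  have hpi := pi_pos
  have hii : ∀ a b, IntervalIntegrable v volume a b := fun a b => h.prof.cont.intervalIntegrable _ _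
  have i2 : v (3 * π / 4) * (π / 4) ≤ ∫ y in (3 * π/4)..π, v y := by
    have := intervalIntegral.integral_mono_on (a := 3 * π/4) (b := π) (by linarith)
      (f := fun _ => v (3 * π / 4)) (g := v) (by simp) (hii _ _) fun x hx =>
        h.prof.mono ⟨by linarith, by linarith⟩ ⟨by linarith [hx.1], hx.2⟩ hx.1
    rw [intervalIntegral.integral_const, smul_eq_mul] at this
    linarith
  have i1 : v (3 * π / 4) * (π / 4) ≤ ∫ y in (-π)..(-(3 * π/4)), v y := by
    have := intervalIntegral.integral_mono_on (a := -π) (b := -(3 * π/4)) (by linarith)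
      (f := fun _ => v (3 * π / 4)) (g := v) (by simp) (hii _ _) fun x hx => by
        rw [← h.prof.even x]
        exact h.prof.mono ⟨by linarith, by linarith⟩ ⟨by linarith [hx.2], by linarith [hx.1]⟩ (by linarith [hx.2])
    rw [intervalIntegral.integral_const, smul_eq_mul] at this
    linarith
  have i3 : 0 ≤ ∫ y in (-(3 * π/4))..(3 * π/4), v y :=
    intervalIntegral.integral_nonneg (by linarith) fun x _ => h.nonneg x
  have s1 := intervalIntegral.integral_add_adjacent_intervals (hii (-π) (-(3 * π/4))) (hii _ (3 * π/4))
  have s2 := intervalIntegral.integral_add_adjacent_intervals (hii (-π) (3 * π/4)) (hii _ π)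
  have := h.mean
  nlinarith

theorem apriori (hK : GK α K) (hα : α ∈ Ioo (0:ℝ) 1) (hp : 1 < p) :
    ∃ T₀ > 0, ∃ T₁, ∃ M ≥ 0, ∀ ε ∈ Ioc (0:ℝ) 1, ∀ τ v, Sol K p ε τ v → T₀ ≤ τ ∧ τ ≤ T₁ ∧ ∀ x, v x ≤ M := by
  have hpi := pi_pos
  have hN := L1_nonneg K
  obtain ⟨κ, hκ, hkap⟩ := TT_kappa hK hα
  obtain ⟨a, ha, b, hb, hab⟩ := gg_bounds hp 4
  set T₁ := 8 * b / κ with hT1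
  have hT1p : 0 < T₁ := by positivity
  obtain ⟨D, hD⟩ := gg_super hp (2 * T₁ * L1 K + 1)
  set M := |D| + 2 * T₁
  have hM : 0 ≤ M := by positivity
  refine ⟨(p - 1) / (2 * M * L1 K + 2), div_pos (by linarith) (by positivity), T₁, M, hM,
    fun ε hε τ v h => ?_⟩
  have hm1 := h.one_le_pi
  have hτ1 : τ ≤ T₁ := by
    have hle : v (π / 4) ≤ v (3 * π / 4) :=
      h.prof.mono ⟨by linarith, by linarith⟩ ⟨by linarith, by linarith⟩ (by linarith)
    have e1 := h.eqn (3 * π / 4)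
    have e2 := h.eqn (π / 4)
    have hk := hkap v h.prof
    have hcos : cos (3 * π / 4) < cos (π / 4) :=
      Real.cos_lt_cos_of_nonneg_of_le_pi (by linarith) (by linarith) (by linarith)
    have hgd : gg p (v (3 * π / 4)) - gg p (v (π / 4)) =
        τ * ((TT K v (3 * π / 4) - TT K v (π / 4)) + ε * (cos (π / 4) - cos (3 * π / 4))) := by
      rw [e1, e2]; ring
    have hec : 0 < ε * (cos (π / 4) - cos (3 * π / 4)) := mul_pos hε.1 (by linarith)
    have hl : 0 < v (3 * π / 4) - v (π / 4) := by
      rcases hle.lt_or_eq with hl | hl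
      · linarith
      · exfalso
        rw [hl, sub_self, mul_zero] at hk
        rw [hl, sub_self] at hgd
        have := mul_pos h.pos (lt_of_lt_of_le hec (le_add_of_nonneg_left hk))
        linarith
    have h4 := h.le_four
    have hb1 := (hab _ _ (h.nonneg (π / 4)) hle h4).2
    have hb2 : b * (v (3 * π / 4) ^ 2 - v (π / 4) ^ 2) ≤ 8 * b * (v (3 * π / 4) - v (π / 4)) := by
      have : (v (3 * π / 4) ^ 2 - v (π / 4) ^ 2) ≤ 8 * (v (3 * π / 4) - v (π / 4)) := by nlinarith
      have := mul_le_mul_of_nonneg_left this hb.le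
      linarith
    have hb3 : τ * κ * (v (3 * π / 4) - v (π / 4)) ≤ 8 * b * (v (3 * π / 4) - v (π / 4)) := by
      have h5 := mul_le_mul_of_nonneg_left hk h.pos.le
      have h6 := mul_pos h.pos hec
      nlinarith
    have hb4 := le_of_mul_le_mul_right hb3 hl
    rw [hT1, le_div_iff₀ hκ]; exact hb4
  have hTb : ∀ x, |TT K v x| ≤ v π * L1 K := TT_bound hK hα.1 v h.prof.cont _ fun x => by
    rw [abs_of_nonneg (h.nonneg x)]; exact h.prof.le_pi x
  have e := h.eqn π
  have hh : TT K v π - TT K v 0 + ε * (1 - cos π) ≤ 2 * v π * L1 K + 2 := by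
    have h1 := abs_le.1 (hTb π)
    have h2 := abs_le.1 (hTb 0)
    rw [cos_pi]
    linarith [hε.2]
  have hm : v π ≤ M := by
    have h1 := hD (v π) (by linarith)
    have h2 : gg p (v π) ≤ T₁ * (2 * v π * L1 K + 2) := by
      rw [e]
      refine (mul_le_mul_of_nonneg_left hh h.pos.le).trans (mul_le_mul_of_nonneg_right hτ1 ?_)
      positivity
    have := le_abs_self D
    simp only [M]
    linarith
  refine ⟨?_, hτ1, fun x => (h.prof.le_pi x).trans hm⟩
  rw [div_le_iff₀ (by positivity)]
  have h1 : p - 1 ≤ gg p (v π) := by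
    rw [← gg_one hp]
    rcases hm1.eq_or_lt with h1 | h1
    · rw [← h1]
    · exact (gg_strict hp zero_le_one h1).le
  rw [e] at h1
  refine h1.trans (mul_le_mul_of_nonneg_left (hh.trans ?_) h.pos.le)
  have := mul_le_mul_of_nonneg_right hm hN
  linarith

theorem exists_sol (hK : GK α K) (hα : α ∈ Ioo (0:ℝ) 1) (hp : 1 < p) : ∃ τ v, Sol K p 0 τ v := by
  have hpi := pi_pos
  obtain ⟨gi, g1, g2, g3, g4, g5⟩ := gi_exists hp
  have hg : GI p gi := ⟨g1, g2, g3, g4, g5⟩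
  obtain ⟨T₀, hT0, T₁, M, hM, hap⟩ := apriori hK hα hp
  obtain ⟨C, hC, hH⟩ := TT_holder hK hα
  set e : ℕ → ℝ := fun n => 1 / ((n:ℝ) + 1)
  have he : ∀ n, e n ∈ Ioc (0:ℝ) 1 := fun n => by
    constructor
    · positivity
    · simp only [e]; rw [div_le_one (by positivity)]; linarith [Nat.cast_nonneg (α := ℝ) n]
  choose τ v hs using fun n => exists_eps hK hα hp hg (e n) (he n).1
  set b : C(Icc 0 π, ℝ) := res (fun x => 1 - cos x) (by fun_prop)
  set w : ℕ → C(Icc 0 π, ℝ) := fun n => res (v n) (hs n).prof.cont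
  have hw : ∀ n, ext (w n) = v n := fun n => ext_res _ _ (hs n).prof.even (hs n).prof.per
  set q : ℕ → C(Icc 0 π, ℝ) × ℝ := fun n => (Top hK hα (w n) + e n • b, τ n)
  have hq1 : ∀ n x, (q n).1 x = TT K (v n) x - TT K (v n) 0 + e n * (1 - cos x) := fun n x => by
    simp [q, Top, res, hw, b]
  set L := C * M + π ^ (1 - α)
  have hL : 0 ≤ L := by positivity
  have hqS : ∀ n, q n ∈ HS α L 0 ×ˢ Icc T₀ T₁ := by
    intro n
    obtain ⟨ha1, ha2, ha3⟩ := hap (e n) (he n) _ _ (hs n)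
    refine ⟨⟨?_, ?_, ?_, ?_⟩, ha1, ha2⟩
    · rw [hq1]; simp
    · intro x y hxy
      rw [hq1, hq1]
      have h1 := TT_mono hK hα.1 (hs n).prof x.2 y.2 hxy
      have h2 : cos y ≤ cos x := Real.cos_le_cos_of_nonneg_of_le_pi x.2.1 y.2.2 hxy
      have h3 := mul_le_mul_of_nonneg_left h2 (he n).1.le
      linarith
    · intro x
      rw [hq1]
      have h1 := TT_mono hK hα.1 (hs n).prof ⟨le_rfl, hpi.le⟩ x.2 x.2.1
      have h3 : 0 ≤ e n * (1 - cos x) := mul_nonneg (he n).1.le (by linarith [cos_le_one x])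
      linarith
    · intro x y
      rw [hq1, hq1]
      have h1 := hH _ (hs n).prof.cont (hs n).prof.per M (fun x => by
        rw [abs_of_nonneg ((hs n).nonneg x)]; exact ha3 x) x y
      have h2 := cos_hol hα x y (Icc_abs_sub x y)
      have h3 : |-(e n * (cos x - cos y))| ≤ π ^ (1 - α) * |(x:ℝ) - y| ^ α := by
        rw [abs_neg, abs_mul, abs_of_pos (he n).1]
        refine le_trans ?_ h2
        exact mul_le_of_le_one_left (abs_nonneg _) (he n).2
      refine le_trans (le_trans (le_of_eq ?_) (abs_add_le _ _)) (le_trans (add_le_add h1 h3) (le_of_eq (by ring)))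
      ring_nf
  obtain ⟨r, hr, φ, hφ, hlim⟩ := ((HS_compact hα.1 hL).prod (isCompact_Icc (a := T₀) (b := T₁))).tendsto_subseq hqS
  have hVq : ∀ n, Vop gi hg.cont (q n) = w n := by
    intro n
    ext x
    change gi (τ n * (q n).1 x) = v n x
    rw [hq1, ← (hs n).eqn x, hg.left _ ((hs n).nonneg x)]
  have hVl : Tendsto (fun n => w (φ n)) atTop (𝓝 (Vop gi hg.cont r)) := by
    have := ((Vop_cont gi hg.cont).tendsto r).comp hlim
    refine this.congr fun n => hVq _
  have h1 : Tendsto (fun n => (q (φ n)).1) atTop (𝓝 r.1) := (continuous_fst.tendsto r).comp hlim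
  have h2 : Tendsto (fun n => (q (φ n)).1) atTop (𝓝 (Top hK hα (Vop gi hg.cont r) + (0:ℝ) • b)) := by
    refine (((Top_cont hK hα).tendsto _).comp hVl).add ?_
    refine Tendsto.smul_const ?_ b
    exact tendsto_one_div_add_atTop_nhds_zero_nat.comp hφ.tendsto_atTop
  have hfix := tendsto_nhds_unique h1 h2
  rw [zero_smul, add_zero] at hfix
  have hmean : mean (Vop gi hg.cont r) = 1 := by
    refine tendsto_nhds_unique ((mean_cont.tendsto _).comp hVl) ?_
    refine tendsto_const_nhds.congr fun n => ?_
    simp only [Function.comp, mean, hw, (hs (φ n)).mean]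
    rw [div_self (by positivity)]
  set u := ext (Vop gi hg.cont r) with hu
  have hτ : 0 < r.2 := lt_of_lt_of_le hT0 hr.2.1
  have hprof : Prof u := by
    refine ext_prof _ fun x y hxy => ?_
    exact hg.mono.monotone (mul_le_mul_of_nonneg_left (hr.1.2.1 x y hxy) hτ.le)
  have hux : ∀ x, u x = gi (r.2 * ext r.1 x) := ext_Vop gi hg.cont r
  have hext : ∀ x, ext r.1 x = TT K u x - TT K u 0 := by
    intro x
    have hT := TT_prof hK hα hprof
    have : ext r.1 x = (Top hK hα (Vop gi hg.cont r)) ⟨arccos (cos x), arccos_cos_mem x⟩ := by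
      rw [← hfix]; rfl
    rw [this]
    simp only [Top, res, ContinuousMap.coe_mk]
    rw [evper_eq (TT K u) hT.even hT.per _ _ (cos_arccos_cos x)]
  have hr0 : ∀ x : ℝ, 0 ≤ ext r.1 x := fun x => by
    have := hr.1.2.2.1 ⟨arccos (cos x), arccos_cos_mem x⟩
    rw [zero_mul] at this
    exact this
  refine ⟨r.2, u, hprof, ?_, ?_, hτ, fun x => ?_⟩
  · rw [hux, hext]; simp [hg.zero]
  · have := hmean
    rw [mean, div_eq_one_iff_eq (by positivity)] at this
    exact this
  · rw [hux, hg.right _ (mul_nonneg hτ.le (hr0 x)), hext]; ring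

end
end HW

namespace HW
section
variable {α : ℝ} {K : ℝ → ℝ} {p : ℝ} {τ : ℝ} {v : ℝ → ℝ}

lemma K_shift (hK : GK α K) (x : ℝ) : ∫ y in (-π)..π, K (y - x) = ∫ y in (-π)..π, K y := by
  have hper : Function.Periodic K (2 * π) := hK.per
  rw [intervalIntegral.integral_comp_sub_right K x]
  have := hper.intervalIntegral_add_eq (-π - x) (-π)
  rw [show -π - x + 2 * π = π - x by ring, show -π + 2 * π = π by ring] at this
  exact this

lemma TT_one (hK : GK α K) (x : ℝ) : TT K (fun _ => 1) x = ∫ y in (-π)..π, K y := by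
  rw [← K_shift hK x]
  simp only [TT, mul_one]
  congr 1; ext y
  rw [← hK.even]; ring_nf

lemma TT_integral (hK : GK α K) (hα : 0 < α) (hv : Continuous v) :
    ∫ x in (-π)..π, TT K v x = (∫ y in (-π)..π, K y) * ∫ y in (-π)..π, v y := by
  have hpi := pi_pos
  have hsw : ∫ x in (-π)..π, ∫ y in (-π)..π, K (x - y) * v y =
      ∫ y in (-π)..π, ∫ x in (-π)..π, K (x - y) * v y := by
    apply intervalIntegral_intervalIntegral_swap (F := fun x y => K (x - y) * v y)
    rw [uIoc_of_le (by linarith)]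
    have hf : Integrable (indicator (Ioc (-π) π) v) :=
      (integrable_indicator_iff measurableSet_Ioc).2 (hv.integrableOn_Ioc)
    have hk : Integrable (indicator (Ioc (-(2*π)) (2*π)) K) :=
      (integrable_indicator_iff measurableSet_Ioc).2
        ((intervalIntegrable_iff_integrableOn_Ioc_of_le (by linarith)).1 (hK.int hα _ _))
    have h1 := hf.convolution_integrand (ContinuousLinearMap.mul ℝ ℝ) hk
    refine (h1.integrableOn (s := Ioc (-π) π ×ˢ Ioc (-π) π)).congr_fun ?_
      (measurableSet_Ioc.prod measurableSet_Ioc)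
    rintro ⟨x, y⟩ ⟨hx, hy⟩
    simp only at hx hy
    have hxy : x - y ∈ Ioc (-(2*π)) (2*π) := ⟨by linarith [hx.1, hy.2], by linarith [hx.2, hy.1]⟩
    simp only [ContinuousLinearMap.mul_apply', Function.uncurry]
    rw [indicator_of_mem hy, indicator_of_mem hxy, mul_comm]
  simp only [TT]
  rw [hsw]
  have : ∀ y, ∫ x in (-π)..π, K (x - y) * v y = (∫ z in (-π)..π, K z) * v y := fun y => by
    rw [intervalIntegral.integral_mul_const, K_shift hK]
  simp only [this]
  rw [intervalIntegral.integral_const_mul]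

lemma Sol.eqn0 (h : Sol K p 0 τ v) (x : ℝ) : gg p (v x) = τ * (TT K v x - TT K v 0) := by
  rw [h.eqn x]; ring

lemma Sol.lt_pi (h : Sol K p 0 τ v) : v 0 < v π := by
  rw [h.zero]; linarith [h.one_le_pi]

lemma Sol.strict (hK : GK α K) (hα : α ∈ Ioo (0:ℝ) 1) (hp : 1 < p) (h : Sol K p 0 τ v) : StrictMonoOn v (Icc 0 π) := by
  intro x hx y hy hxy
  have h1 := TT_strict hK hα h.prof h.lt_pi hx hy hxy
  by_contra hc
  have he : v x = v y := le_antisymm (h.prof.mono hx hy hxy.le) (not_lt.1 hc)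
  have e1 := h.eqn0 x
  have e2 := h.eqn0 y
  rw [he, e2] at e1
  have := mul_left_cancel₀ h.pos.ne' e1
  linarith

lemma Sol.pos' (hK : GK α K) (hα : α ∈ Ioo (0:ℝ) 1) (hp : 1 < p) (h : Sol K p 0 τ v) {x : ℝ}
    (hx : x ∈ Ioc 0 π) : 0 < v x := by
  have := h.strict hK hα hp ⟨le_rfl, pi_pos.le⟩ ⟨hx.1.le, hx.2⟩ hx.1
  rwa [h.zero] at this

lemma Sol.one_lt_pi (h : Sol K p 0 τ v) : 1 < v π := by
  have hpi := pi_pos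
  have := intervalIntegral.integral_lt_integral_of_continuousOn_of_le_of_exists_lt (a := -π) (b := π)
    (by linarith) (f := v) (g := fun _ => v π) h.prof.cont.continuousOn continuousOn_const
    (fun x _ => h.prof.le_pi x) ⟨0, ⟨by linarith, hpi.le⟩, h.lt_pi⟩
  rw [h.mean, intervalIntegral.integral_const, smul_eq_mul] at this
  nlinarith

lemma gg_comp_cont (hp : 1 < p) (hv : Continuous v) : Continuous (fun x => gg p (v x)) :=
  (gg_cont hp).comp hv

/-- integrated equation -/
lemma Sol.mean_gg (hK : GK α K) (hα : α ∈ Ioo (0:ℝ) 1) (h : Sol K p 0 τ v) :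
    ∫ x in (-π)..π, gg p (v x) = 2 * π * (τ * ((∫ y in (-π)..π, K y) - TT K v 0)) := by
  simp only [h.eqn0]
  rw [intervalIntegral.integral_const_mul, intervalIntegral.integral_sub
    ((TT_cont hK hα v h.prof.cont h.prof.per).intervalIntegrable _ _) (by simp),
    TT_integral hK hα.1 h.prof.cont, h.mean]
  simp; ring

lemma Sol.tau_bound (hK : GK α K) (hα : α ∈ Ioo (0:ℝ) 1) (hp : 1 < p) (h : Sol K p 0 τ v) :
    p - 1 < τ * L1 K := by
  have hpi := pi_pos
  have hvc := h.prof.cont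
  have hpsi : ∀ x, TT K (fun y => 1 - v y) x = (∫ y in (-π)..π, K y) - TT K v x := fun x => by
    rw [TT_sub hK hα.1 continuous_const hvc, TT_one hK]
  have hb : ∀ M, (∀ x, |1 - v x| ≤ M) → ∀ x, |TT K (fun y => 1 - v y) x| ≤ M * L1 K := fun M hM =>
    TT_bound hK hα.1 _ (continuous_const.sub hvc) M hM
  rcases le_total (v π) 2 with h2 | h2
  · have h1 := hb 1 (fun x => by
      rw [abs_le]; constructor <;> linarith [h.nonneg x, h.prof.le_pi x]) 0
    rw [hpsi, one_mul] at h1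
    have hm := h.mean_gg hK hα
    have hlt : ∫ x in (-π)..π, (p * v x - 1) < ∫ x in (-π)..π, gg p (v x) := by
      refine intervalIntegral.integral_lt_integral_of_continuousOn_of_le_of_exists_lt (by linarith)
        (by fun_prop) (gg_comp_cont hp hvc).continuousOn (fun x _ => ?_) ⟨0, ⟨by linarith, hpi.le⟩, ?_⟩
      · simp only [gg]; linarith [Real.rpow_nonneg (abs_nonneg (1 - v x)) p]
      · simp [gg, h.zero]
    rw [intervalIntegral.integral_sub ((hvc.const_mul p).intervalIntegrable _ _) (by simp),
      intervalIntegral.integral_const_mul, h.mean, hm, intervalIntegral.integral_const, smul_eq_mul] at hlt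
    have h3 : p - 1 < τ * ((∫ y in (-π)..π, K y) - TT K v 0) := by
      have : 2 * π * (p - 1) < 2 * π * (τ * ((∫ y in (-π)..π, K y) - TT K v 0)) := by linarith
      exact lt_of_mul_lt_mul_left this (by positivity)
    exact h3.trans_le (mul_le_mul_of_nonneg_left ((le_abs_self _).trans h1) h.pos.le)
  · have h1 := hb (v π - 1) (fun x => by
      rw [abs_le]; constructor <;> linarith [h.nonneg x, h.prof.le_pi x])
    have e := h.eqn0 π
    have hd : TT K v π - TT K v 0 ≤ 2 * (v π - 1) * L1 K := by
      have i1 := abs_le.1 (h1 π)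
      have i2 := abs_le.1 (h1 0)
      rw [hpsi] at i1 i2
      linarith
    have hg : 2 * p * (v π - 1) ≤ gg p (v π) := by
      have e := one_add_mul_self_le_rpow_one_add (s := v π - 2) (by linarith) hp.le
      rw [gg, abs_sub_comm, abs_of_nonneg (by linarith)]
      rw [show 1 + (v π - 2) = v π - 1 by ring] at e
      linarith
    have : p * (2 * (v π - 1)) ≤ τ * L1 K * (2 * (v π - 1)) := by
      have := mul_le_mul_of_nonneg_left hd h.pos.le
      linarith
    have := le_of_mul_le_mul_right this (by linarith)
    linarith

end
end HW

namespace HW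
section
variable {α : ℝ} {K : ℝ → ℝ} {p : ℝ} {τ : ℝ} {v : ℝ → ℝ}

lemma sq_bound_step {A B s t β α : ℝ} (hA : 0 < A) (hBA : B ≤ A) (ht : 0 < t)
    (h : s ^ 2 ≤ B * A * t ^ α * t ^ β) : s ≤ A * t ^ ((α + β) / 2) := by
  refine le_of_sq_le_sq ?_ (by positivity)
  refine h.trans ?_
  have : (t ^ ((α + β) / 2)) ^ 2 = t ^ α * t ^ β := by
    rw [← Real.rpow_natCast, ← Real.rpow_mul ht.le, ← Real.rpow_add ht]; congr 1; push_cast; ring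
  rw [mul_pow, this, mul_assoc (B * A)]
  have h1 : B * A ≤ A ^ 2 := by nlinarith
  exact mul_le_mul_of_nonneg_right h1 (by positivity)

theorem Sol.upper (hK : GK α K) (hα : α ∈ Ioo (0:ℝ) 1) (hp : 1 < p) (h : Sol K p 0 τ v) :
    ∃ A > 0, ∀ z ∈ Ioc 0 π, v z ≤ A * z ^ α := by
  have hpi := pi_gt_three
  obtain ⟨C, hC, hU⟩ := lemmaU hK hα
  obtain ⟨a, ha, b, hb, hab⟩ := gg_bounds hp (v π)
  have hτ := h.pos
  have hm := h.one_le_pi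
  set B := τ * C / a
  have hB : 0 < B := by positivity
  set A := B + 2 * v π
  have hA : 0 < A := by positivity
  have step : ∀ β ∈ Icc 0 α, (∀ z ∈ Ioc 0 π, v z ≤ A * z ^ β) →
      ∀ z ∈ Ioc 0 π, v z ≤ A * z ^ ((α + β) / 2) := by
    intro β hβ hz z hzm
    rcases le_total z (π / 4) with h4 | h4
    · have h1 := hU v h.prof (by rw [h.zero]) A hA.le β hβ hz 0 z le_rfl hzm.1 h4
      have h2 := (hab 0 (v z) le_rfl (h.nonneg z) (h.prof.le_pi z)).1
      rw [gg_zero, h.eqn0] at h2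
      refine sq_bound_step (B := B) hA (by simp only [A]; linarith) hzm.1 ?_
      have h3 : ((z - 0) / 2) ^ α ≤ z ^ α :=
        Real.rpow_le_rpow (by linarith [hzm.1]) (by linarith [hzm.1]) hα.1.le
      have h4 : ((0 + z) / 2) ^ β ≤ z ^ β :=
        Real.rpow_le_rpow (by linarith [hzm.1]) (by linarith [hzm.1]) hβ.1
      have hz0 := hzm.1
      have h5 : TT K v z - TT K v 0 ≤ C * A * z ^ α * z ^ β := by
        refine h1.trans ?_
        gcongr
      have h6 := mul_le_mul_of_nonneg_left h5 hτ.le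
      have h7 : a * v z ^ 2 ≤ τ * (C * A * z ^ α * z ^ β) := by nlinarith
      rw [show B * A * z ^ α * z ^ β = τ * (C * A * z ^ α * z ^ β) / a by simp only [B]; ring, le_div_iff₀ ha]
      linarith
    · have hh : 0 < (α + β) / 2 := by linarith [hα.1, hβ.1]
      have hh1 : (α + β) / 2 ≤ 1 := by linarith [hα.2, hβ.2]
      have h1 : (1/2 : ℝ) ≤ z ^ ((α + β) / 2) := by
        calc (1/2 : ℝ) = (1/2 : ℝ) ^ (1:ℝ) := by simp
          _ ≤ (1/2 : ℝ) ^ ((α + β) / 2) :=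
            Real.rpow_le_rpow_of_exponent_ge (by norm_num) (by norm_num) hh1
          _ ≤ _ := Real.rpow_le_rpow (by norm_num) (by linarith) hh.le
      have h2 := h.prof.le_pi z
      have h3 : A * (1/2) ≤ A * z ^ ((α + β) / 2) := mul_le_mul_of_nonneg_left h1 hA.le
      simp only [A] at h3 ⊢
      linarith
  have all : ∀ n : ℕ, ∀ z ∈ Ioc 0 π, v z ≤ A * z ^ (α * (1 - (1/2 : ℝ) ^ n)) := by
    intro n
    induction n with
    | zero =>
      intro z hz
      simp only [pow_zero, sub_self, mul_zero, Real.rpow_zero, mul_one, A]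
      linarith [h.prof.le_pi z]
    | succ n ih =>
      have h1 : (1/2 : ℝ) ^ n ≤ 1 := pow_le_one₀ (by norm_num) (by norm_num)
      have h2 : (0:ℝ) < (1/2 : ℝ) ^ n := by positivity
      have := step _ ⟨mul_nonneg hα.1.le (by linarith), by nlinarith [hα.1]⟩ ih
      intro z hz
      refine (this z hz).trans (le_of_eq ?_)
      congr 2; rw [pow_succ]; ring
  refine ⟨A, hA, fun z hz => ?_⟩
  have hl : Tendsto (fun n : ℕ => A * z ^ (α * (1 - (1/2 : ℝ) ^ n))) atTop (𝓝 (A * z ^ (α * (1 - 0)))) := by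
    have h1 : Tendsto (fun n : ℕ => (1/2 : ℝ) ^ n) atTop (𝓝 0) :=
      tendsto_pow_atTop_nhds_zero_of_lt_one (by norm_num) (by norm_num)
    have h2 := (h1.const_sub 1).const_mul α
    exact ((Real.continuous_const_rpow hz.1.ne').tendsto _ |>.comp h2).const_mul A
  have := ge_of_tendsto' hl (fun n => all n z hz)
  simpa using this

theorem Sol.lower (hK : GK α K) (hα : α ∈ Ioo (0:ℝ) 1) (hp : 1 < p) (h : Sol K p 0 τ v) :
    ∃ c > 0, ∃ δ > 0, δ ≤ 1 ∧ ∀ x ∈ Ioc 0 δ, c * x ^ α ≤ v x := by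
  have hpi := pi_gt_three
  obtain ⟨c₁, hc₁, δ₀, hδ₀, hL⟩ := TT_low hK hα
  obtain ⟨a, ha, b, hb, hab⟩ := gg_bounds hp (v π)
  have hτ := h.pos
  set δ := min δ₀ 1
  have hδ : 0 < δ := by positivity
  have hδ1 : δ ≤ 1 := min_le_right _ _
  set s := (3/2 : ℝ) ^ α
  have hs : 1 < s := Real.one_lt_rpow (by norm_num) hα.1
  set d := τ * c₁ / b
  have hd : 0 < d := by positivity
  set η := d * (s - 1)
  have hη : 0 < η := mul_pos hd (by linarith)
  have hvδ : 0 < v δ := h.pos' hK hα hp ⟨hδ, by linarith⟩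
  set c := min η (v δ / 2)
  have hc : 0 < c := by positivity
  have key : ∀ x ∈ Ioc 0 δ, d * x ^ α * (v (3 * x / 2) - v x) ≤ v x ^ 2 := by
    intro x hx
    have h1 := hL v h.prof x ⟨hx.1, hx.2.trans (min_le_left _ _)⟩
    have h2 := (hab 0 (v x) le_rfl (h.nonneg x) (h.prof.le_pi x)).2
    rw [gg_zero, h.eqn0] at h2
    have h3 := mul_le_mul_of_nonneg_left h1 hτ.le
    rw [show d * x ^ α * (v (3 * x / 2) - v x) = τ * (c₁ * x ^ α * (v (3 * x / 2) - v x)) / b by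
      simp only [d]; ring, div_le_iff₀ hb]
    nlinarith
  have all : ∀ n : ℕ, ∀ x, δ * (2/3 : ℝ) ^ n ≤ x → x ≤ 3 * δ / 2 → c * x ^ α ≤ v x := by
    intro n
    induction n with
    | zero =>
      intro x hx1 hx2
      simp only [pow_zero, mul_one] at hx1
      have h1 : v δ ≤ v x := h.prof.mono ⟨hδ.le, by linarith⟩ ⟨by linarith, by linarith⟩ hx1
      have h2 : x ^ α ≤ 2 := by
        calc x ^ α ≤ 2 ^ α := Real.rpow_le_rpow (by linarith) (by linarith) hα.1.le
          _ ≤ 2 ^ (1:ℝ) := Real.rpow_le_rpow_of_exponent_le (by norm_num) hα.2.le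
          _ = 2 := by simp
      have h3 : c ≤ v δ / 2 := min_le_right _ _
      have h4 : 0 ≤ x ^ α := Real.rpow_nonneg (by linarith) _
      nlinarith
    | succ n ih =>
      intro x hx1 hx2
      rcases le_total δ x with hx | hx
      · refine ih x (le_trans ?_ hx) hx2
        exact mul_le_of_le_one_right hδ.le (pow_le_one₀ (by norm_num) (by norm_num))
      have hx0 : 0 < x := lt_of_lt_of_le (by positivity) hx1
      have h1 := ih (3 * x / 2) (by rw [pow_succ] at hx1; linarith) (by linarith)
      have h2 := key x ⟨hx0, hx⟩
      have hxa : 0 < x ^ α := by positivity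
      have e : (3 * x / 2) ^ α = s * x ^ α := by
        rw [← Real.mul_rpow (by norm_num) hx0.le]; ring_nf
      rw [e] at h1
      by_contra hcon
      push Not at hcon
      have h3 : v x < η * x ^ α := hcon.trans_le (mul_le_mul_of_nonneg_right (min_le_left _ _) hxa.le)
      have hv0 := h.nonneg x
      have h4 : d * x ^ α * (v (3 * x / 2) - v x) ≤ η * x ^ α * v x := by
        refine h2.trans ?_
        rw [sq]; exact mul_le_mul_of_nonneg_right h3.le hv0
      have h5 : v (3 * x / 2) - v x ≤ (s - 1) * v x := by
        have : d * x ^ α * (v (3 * x / 2) - v x) ≤ d * x ^ α * ((s - 1) * v x) := by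
          refine h4.trans (le_of_eq ?_)
          simp only [η]; ring
        exact le_of_mul_le_mul_left this (by positivity)
      have h6 : s * (c * x ^ α) ≤ s * v x := by linarith
      have := le_of_mul_le_mul_left h6 (by linarith)
      linarith
  refine ⟨c, hc, δ, hδ, hδ1, fun x hx => ?_⟩
  have h1 : Tendsto (fun n : ℕ => δ * (2/3 : ℝ) ^ n) atTop (𝓝 (δ * 0)) :=
    (tendsto_pow_atTop_nhds_zero_of_lt_one (by norm_num) (by norm_num)).const_mul δ
  rw [mul_zero] at h1
  obtain ⟨n, hn⟩ := (h1.eventually_le_const hx.1).exists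
  exact all n x hn (by linarith [hx.2])

lemma fold_lip (he : ∀ x, v (-x) = v x) (hper : ∀ x, v (x + 2 * π) = v x) {H : ℝ} (hα : 0 < α) (hH0 : 0 ≤ H)
    (hH : ∀ x ∈ Icc 0 π, ∀ y ∈ Icc 0 π, |v x - v y| ≤ H * |x - y| ^ α) (x y : ℝ) :
    |v x - v y| ≤ H * |x - y| ^ α := by
  have hpi := pi_pos
  set N : ℝ → ℝ := fun x => ‖(x : AddCircle (2 * π))‖
  have hN : ∀ x, N x ∈ Icc 0 π := fun x => ⟨norm_nonneg _, by
    have := AddCircle.norm_le_half_period (2 * π) (x := (x : AddCircle (2 * π))) (by positivity)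
    rw [abs_of_pos (by positivity)] at this
    linarith⟩
  have hv : ∀ x, v x = v (N x) := fun x => by
    apply evper_eq v he hper
    simp only [N]
    rw [AddCircle.norm_eq, Real.cos_abs, Real.cos_sub_int_mul_two_pi]
  have hl : |N x - N y| ≤ |x - y| := by
    refine (abs_norm_sub_norm_le _ _).trans ?_
    rw [← AddCircle.coe_sub, ← Real.norm_eq_abs]
    exact QuotientAddGroup.norm_mk_le_norm
  rw [hv x, hv y]
  refine (hH _ (hN x) _ (hN y)).trans ?_
  gcongr

theorem Sol.holder (hK : GK α K) (hα : α ∈ Ioo (0:ℝ) 1) (hp : 1 < p) (h : Sol K p 0 τ v) :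
    ∃ H > 0, ∀ x y, |v x - v y| ≤ H * |x - y| ^ α := by
  have hpi := pi_gt_three
  have hα0 := hα.1
  obtain ⟨A, hA, hup⟩ := h.upper hK hα hp
  obtain ⟨c, hc, δ₀, hδ₀, hδ₀1, hlow⟩ := h.lower hK hα hp
  obtain ⟨C, hC, hU⟩ := lemmaU hK hα
  obtain ⟨C', hC', hT⟩ := TT_holder hK hα
  obtain ⟨a, ha, b, hb, hab⟩ := gg_bounds hp (v π)
  have hτ := h.pos
  have hm := h.one_le_pi
  set δ := min δ₀ (π / 4)
  have hδ : 0 < δ := by positivity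
  have hδ1 : δ ≤ 1 := (min_le_left _ _).trans hδ₀1
  have hvδ : 0 < v δ := h.pos' hK hα hp ⟨hδ, by linarith⟩
  set H₁ := τ * (C' * v π) / (a * v δ)
  set H₂ := A * 2 ^ α
  set H₃ := τ * C * A * 2 ^ α / (a * c)
  have p1 : 0 < H₁ := by positivity
  have p2 : 0 < H₂ := by positivity
  have p3 : 0 < H₃ := by positivity
  refine ⟨H₁ + H₂ + H₃, by positivity, ?_⟩
  have main : ∀ x y, 0 ≤ x → x < y → y ≤ π → v y - v x ≤ (H₁ + H₂ + H₃) * (y - x) ^ α := by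
    intro x y hx hxy hy
    have hd : 0 < y - x := by linarith
    have hpow : 0 < (y - x) ^ α := by positivity
    have hxy' : v x ≤ v y := h.prof.mono ⟨hx, by linarith⟩ ⟨by linarith, hy⟩ hxy.le
    have hvx := h.nonneg x
    have hg := (hab (v x) (v y) hvx hxy' (h.prof.le_pi y)).1
    rw [h.eqn0, h.eqn0, ← mul_sub] at hg
    have hg' : a * ((v y + v x) * (v y - v x)) ≤ τ * (TT K v y - TT K v x) := by
      refine le_trans (le_of_eq (by ring)) (hg.trans (le_of_eq (by ring)))
    suffices hs : v y - v x ≤ H₁ * (y - x) ^ α ∨ v y - v x ≤ H₂ * (y - x) ^ α ∨ v y - v x ≤ H₃ * (y - x) ^ α by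
      have q1 := mul_pos p1 hpow
      have q2 := mul_pos p2 hpow
      have q3 := mul_pos p3 hpow
      rcases hs with hs | hs | hs <;> linarith
    rcases le_total δ y with hδy | hδy
    · left
      have h1 := hT v h.prof.cont h.prof.per (v π) (fun x => by
        rw [abs_of_nonneg (h.nonneg x)]; exact h.prof.le_pi x) y x
      rw [abs_of_pos hd] at h1
      have h2 := mul_le_mul_of_nonneg_left ((le_abs_self _).trans h1) hτ.le
      have h3 : v δ ≤ v y := h.prof.mono ⟨hδ.le, by linarith⟩ ⟨by linarith, hy⟩ hδy
      have h4 : a * v δ * (v y - v x) ≤ a * ((v y + v x) * (v y - v x)) := by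
        rw [mul_assoc]
        exact mul_le_mul_of_nonneg_left (mul_le_mul_of_nonneg_right (by linarith) (by linarith)) ha.le
      rw [show H₁ * (y - x) ^ α = τ * (C' * v π * (y - x) ^ α) / (a * v δ) by simp only [H₁]; ring,
        le_div_iff₀ (by positivity)]
      linarith
    right
    rcases le_total (2 * x) y with h2x | h2x
    · left
      have h1 := hup y ⟨by linarith, hy⟩
      have h2 : y ^ α ≤ 2 ^ α * (y - x) ^ α := by
        rw [← Real.mul_rpow (by norm_num) hd.le]
        exact Real.rpow_le_rpow (by linarith) (by linarith) hα0.le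
      have := mul_le_mul_of_nonneg_left h2 hA.le
      simp only [H₂]
      linarith
    · right
      have hx0 : 0 < x := by linarith
      have h1 := hU v h.prof (by rw [h.zero]) A hA.le α ⟨hα0.le, le_rfl⟩ hup x y hx hxy
        (hδy.trans (min_le_right _ _))
      have h2 : ((y - x) / 2) ^ α ≤ (y - x) ^ α := Real.rpow_le_rpow (by linarith) (by linarith) hα0.le
      have h3 : ((x + y) / 2) ^ α ≤ 2 ^ α * x ^ α := by
        rw [← Real.mul_rpow (by norm_num) hx0.le]
        exact Real.rpow_le_rpow (by linarith) (by linarith) hα0.le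
      have h4 : TT K v y - TT K v x ≤ C * A * (y - x) ^ α * (2 ^ α * x ^ α) := by
        refine h1.trans ?_
        have : 0 ≤ ((x + y) / 2) ^ α := Real.rpow_nonneg (by linarith) _
        gcongr
      have h5 := mul_le_mul_of_nonneg_left h4 hτ.le
      have h6 := hlow x ⟨hx0, (hxy.le.trans hδy).trans (min_le_left _ _)⟩
      have hxa : 0 < x ^ α := by positivity
      have h7 : a * c * (v y - v x) * x ^ α ≤ a * ((v y + v x) * (v y - v x)) := by
        have : c * x ^ α * (v y - v x) ≤ (v y + v x) * (v y - v x) :=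
          mul_le_mul_of_nonneg_right (by linarith) (by linarith)
        have := mul_le_mul_of_nonneg_left this ha.le
        linarith
      have h8 : a * c * (v y - v x) * x ^ α ≤ τ * C * A * 2 ^ α * (y - x) ^ α * x ^ α := by linarith
      have h9 := le_of_mul_le_mul_right h8 hxa
      rw [show H₃ * (y - x) ^ α = τ * C * A * 2 ^ α * (y - x) ^ α / (a * c) by simp only [H₃]; ring,
        le_div_iff₀ (by positivity)]
      linarith
  refine fold_lip h.prof.even h.prof.per hα0 (by positivity) fun x hx y hy => ?_
  wlog hxy : x ≤ y generalizing x y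
  · rw [abs_sub_comm, abs_sub_comm x y]; exact this y hy x hx (by linarith)
  rcases hxy.eq_or_lt with rfl | hxy
  · simp [Real.zero_rpow hα0.ne']
  rw [abs_sub_comm, abs_sub_comm x y, abs_of_pos (sub_pos.2 hxy),
    abs_of_nonneg (sub_nonneg.2 (h.prof.mono hx hy hxy.le))]
  exact main x y hx.1 hxy hy.2

end
end HW

namespace HW
section

/-- Local `C^{k,β}` regularity at a point. -/
def HC : ℕ → ℝ → (ℝ → ℝ) → ℝ → Prop
  | 0, β, f, x => ∃ C ≥ 0, ∃ ε > 0, ∀ y ∈ Metric.ball x ε, ∀ z ∈ Metric.ball x ε,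
      |f y - f z| ≤ C * |y - z| ^ β
  | k + 1, β, f, x => (∀ᶠ y in 𝓝 x, DifferentiableAt ℝ f y) ∧ HC k β (deriv f) x

lemma HC_congr {k : ℕ} {β : ℝ} {f g : ℝ → ℝ} {x : ℝ} (h : f =ᶠ[𝓝 x] g) (hf : HC k β f x) :
    HC k β g x := by
  induction k generalizing f g with
  | zero =>
    obtain ⟨C, hC, ε, hε, hf⟩ := hf
    obtain ⟨δ, hδ, hb⟩ := Metric.eventually_nhds_iff_ball.1 h
    refine ⟨C, hC, min ε δ, lt_min hε hδ, fun y hy z hz => ?_⟩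
    have hy1 := Metric.ball_subset_ball (min_le_left ε δ) hy
    have hy2 := Metric.ball_subset_ball (min_le_right ε δ) hy
    have hz1 := Metric.ball_subset_ball (min_le_left ε δ) hz
    have hz2 := Metric.ball_subset_ball (min_le_right ε δ) hz
    rw [← hb y hy2, ← hb z hz2]
    exact hf y hy1 z hz1
  | succ k ih =>
    refine ⟨?_, ih h.deriv hf.2⟩
    filter_upwards [hf.1, h.eventuallyEq_nhds] with y hy hy2
    exact hy.congr_of_eventuallyEq hy2.symm

lemma HC_mono {k : ℕ} {β β' : ℝ} {f : ℝ → ℝ} {x : ℝ} (hβ : β' ≤ β) (h0 : 0 ≤ β') (hf : HC k β f x) :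
    HC k β' f x := by
  induction k generalizing f with
  | zero =>
    obtain ⟨C, hC, ε, hε, hf⟩ := hf
    refine ⟨C, hC, min ε (1/2), lt_min hε (by norm_num), fun y hy z hz => ?_⟩
    have hy1 := Metric.ball_subset_ball (min_le_left ε (1/2)) hy
    have hy2 := Metric.ball_subset_ball (min_le_right ε (1/2)) hy
    have hz1 := Metric.ball_subset_ball (min_le_left ε (1/2)) hz
    have hz2 := Metric.ball_subset_ball (min_le_right ε (1/2)) hz
    refine (hf y hy1 z hz1).trans (mul_le_mul_of_nonneg_left ?_ hC)
    rcases (abs_nonneg (y - z)).eq_or_lt with h | h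
    · have e : y = z := by linarith [abs_eq_zero.1 h.symm]
      have := hf y hy1 z hz1
      subst e
      simp only [sub_self, abs_zero]
      rcases h0.eq_or_lt with h0 | h0
      · subst h0
        rw [Real.rpow_zero]
        exact Real.zero_rpow_le_one _
      · rw [Real.zero_rpow h0.ne', Real.zero_rpow (by linarith)]
    · refine Real.rpow_le_rpow_of_exponent_ge h ?_ hβ
      rw [Metric.mem_ball, Real.dist_eq] at hy2 hz2
      have := abs_sub_abs_le_abs_sub y x
      calc |y - z| = |(y - x) - (z - x)| := by ring_nf
        _ ≤ |y - x| + |z - x| := abs_sub _ _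
        _ ≤ 1 := by linarith
  | succ k ih => exact ⟨hf.1, ih hf.2⟩

lemma HC_add {k : ℕ} {β : ℝ} {f g : ℝ → ℝ} {x : ℝ} (hf : HC k β f x) (hg : HC k β g x) :
    HC k β (fun y => f y + g y) x := by
  induction k generalizing f g with
  | zero =>
    obtain ⟨C, hC, ε, hε, hf⟩ := hf
    obtain ⟨D, hD, δ, hδ, hg⟩ := hg
    refine ⟨C + D, by positivity, min ε δ, lt_min hε hδ, fun y hy z hz => ?_⟩
    have hy1 := Metric.ball_subset_ball (min_le_left ε δ) hy
    have hy2 := Metric.ball_subset_ball (min_le_right ε δ) hy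
    have hz1 := Metric.ball_subset_ball (min_le_left ε δ) hz
    have hz2 := Metric.ball_subset_ball (min_le_right ε δ) hz
    have h1 := hf y hy1 z hz1
    have h2 := hg y hy2 z hz2
    calc |f y + g y - (f z + g z)| = |(f y - f z) + (g y - g z)| := by ring_nf
      _ ≤ _ := abs_add_le _ _
      _ ≤ _ := by linarith
  | succ k ih =>
    refine ⟨?_, HC_congr ?_ (ih hf.2 hg.2)⟩
    · filter_upwards [hf.1, hg.1] with y h1 h2 using h1.add h2
    · filter_upwards [hf.1, hg.1] with y h1 h2
      exact (h1.hasDerivAt.add h2.hasDerivAt).deriv.symm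

lemma HC_contAt {β : ℝ} (hβ : 0 < β) {f : ℝ → ℝ} {x : ℝ} (hf : HC 0 β f x) :
    ∀ᶠ y in 𝓝 x, ContinuousAt f y := by
  obtain ⟨C, hC, ε, hε, hf⟩ := hf
  filter_upwards [Metric.ball_mem_nhds x hε] with y hy
  rw [ContinuousAt, tendsto_iff_dist_tendsto_zero]
  have h1 : Tendsto (fun z => C * |z - y| ^ β) (𝓝 y) (𝓝 0) := by
    have : Continuous (fun z => C * |z - y| ^ β) := by
      refine continuous_const.mul (Continuous.rpow_const (by fun_prop) fun _ => Or.inr hβ.le)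
    have h := this.tendsto y
    simpa [Real.zero_rpow hβ.ne'] using h
  refine squeeze_zero' (Eventually.of_forall fun _ => dist_nonneg) ?_ h1
  filter_upwards [Metric.isOpen_ball.mem_nhds hy] with z hz
  exact hf z hz y hy

lemma HC_lip {f : ℝ → ℝ} {x : ℝ} {β : ℝ} (hβ : 0 < β) (hf : HC 1 β f x) : HC 0 1 f x := by
  obtain ⟨hd, h0⟩ := hf
  have hc := (HC_contAt hβ h0).self_of_nhds
  obtain ⟨δ, hδ, hb⟩ := Metric.eventually_nhds_iff_ball.1
    (hd.and (hc.abs.eventually_lt continuousAt_const (lt_add_one _) : ∀ᶠ y in 𝓝 x, |deriv f y| < |deriv f x| + 1))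
  refine ⟨|deriv f x| + 1, by positivity, δ, hδ, fun y hy z hz => ?_⟩
  rw [Real.rpow_one]
  exact (convex_ball x δ).norm_image_sub_le_of_norm_deriv_le (fun w hw => (hb w hw).1)
    (fun w hw => (hb w hw).2.le) hz hy

lemma HC_pred {k : ℕ} {β : ℝ} (hβ : β ∈ Ioc (0:ℝ) 1) {f : ℝ → ℝ} {x : ℝ} (hf : HC (k + 1) β f x) :
    HC k β f x := by
  induction k generalizing f with
  | zero => exact HC_mono hβ.2 hβ.1.le (HC_lip hβ.1 hf)
  | succ k ih => exact ⟨hf.1, ih hf.2⟩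

lemma HC_zero {k : ℕ} {β : ℝ} (hβ : β ∈ Ioc (0:ℝ) 1) {f : ℝ → ℝ} {x : ℝ} (hf : HC k β f x) :
    HC 0 β f x := by
  induction k with
  | zero => exact hf
  | succ k ih => exact ih (HC_pred hβ hf)

lemma HC_mul {k : ℕ} {β : ℝ} (hβ : β ∈ Ioc (0:ℝ) 1) {f g : ℝ → ℝ} {x : ℝ} (hf : HC k β f x)
    (hg : HC k β g x) : HC k β (fun y => f y * g y) x := by
  induction k generalizing f g with
  | zero =>
    have hcf := (HC_contAt hβ.1 hf).self_of_nhds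
    have hcg := (HC_contAt hβ.1 hg).self_of_nhds
    obtain ⟨C, hC, ε, hε, hf⟩ := hf
    obtain ⟨D, hD, δ, hδ, hg⟩ := hg
    obtain ⟨η, hη, hb⟩ := Metric.eventually_nhds_iff_ball.1
      ((hcf.abs.eventually_lt continuousAt_const (lt_add_one _) : ∀ᶠ y in 𝓝 x, |f y| < |f x| + 1).and
      (hcg.abs.eventually_lt continuousAt_const (lt_add_one _) : ∀ᶠ y in 𝓝 x, |g y| < |g x| + 1))
    refine ⟨C * (|g x| + 1) + D * (|f x| + 1), by positivity, min (min ε δ) η,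
      lt_min (lt_min hε hδ) hη, fun y hy z hz => ?_⟩
    have i1 : min (min ε δ) η ≤ ε := (min_le_left _ _).trans (min_le_left _ _)
    have i2 : min (min ε δ) η ≤ δ := (min_le_left _ _).trans (min_le_right _ _)
    have i3 : min (min ε δ) η ≤ η := (min_le_right _ _)
    have h1 := hf y (Metric.ball_subset_ball i1 hy) z (Metric.ball_subset_ball i1 hz)
    have h2 := hg y (Metric.ball_subset_ball i2 hy) z (Metric.ball_subset_ball i2 hz)
    have h3 := hb y (Metric.ball_subset_ball i3 hy)
    have h4 := hb z (Metric.ball_subset_ball i3 hz)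
    have e : f y * g y - f z * g z = (f y - f z) * g z + (g y - g z) * f y := by ring
    rw [e]
    refine (abs_add_le _ _).trans ?_
    rw [abs_mul, abs_mul]
    have hp : 0 ≤ |y - z| ^ β := by positivity
    have q1 : |f y - f z| * |g z| ≤ (C * |y - z| ^ β) * (|g x| + 1) :=
      mul_le_mul h1 h4.2.le (abs_nonneg _) (by positivity)
    have q2 : |g y - g z| * |f y| ≤ (D * |y - z| ^ β) * (|f x| + 1) :=
      mul_le_mul h2 h3.1.le (abs_nonneg _) (by positivity)
    linarith
  | succ k ih =>
    refine ⟨?_, HC_congr ?_ (HC_add (ih hf.2 (HC_pred hβ hg)) (ih (HC_pred hβ hf) hg.2))⟩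
    · filter_upwards [hf.1, hg.1] with y h1 h2 using h1.mul h2
    · filter_upwards [hf.1, hg.1] with y h1 h2
      exact (h1.hasDerivAt.mul h2.hasDerivAt).deriv.symm

lemma contDiffAt_deriv {G : ℝ → ℝ} {x : ℝ} (hG : ContDiffAt ℝ (⊤ : ℕ∞) G x) :
    ContDiffAt ℝ (⊤ : ℕ∞) (deriv G) x ∧ ∀ᶠ y in 𝓝 x, DifferentiableAt ℝ G y := by
  constructor
  · have := hG.fderiv_right (m := (⊤ : ℕ∞)) (by norm_cast)
    exact this.clm_apply contDiffAt_const
  · have := (hG.of_le (m := 1) (by norm_cast)).eventually (by simp)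
    filter_upwards [this] with y hy using hy.differentiableAt (by simp)

lemma contDiffAt_lip {G : ℝ → ℝ} {x : ℝ} (hG : ContDiffAt ℝ (⊤ : ℕ∞) G x) : HC 0 1 G x := by
  obtain ⟨C, t, ht, hL⟩ := (hG.of_le (m := 1) (by norm_cast)).exists_lipschitzOnWith
  obtain ⟨ε, hε, hb⟩ := Metric.mem_nhds_iff.1 ht
  refine ⟨C, C.2, ε, hε, fun y hy z hz => ?_⟩
  rw [Real.rpow_one]
  exact hL.dist_le_mul y (hb hy) z (hb hz)

lemma HC_smooth {k : ℕ} {β : ℝ} (hβ : β ∈ Ioc (0:ℝ) 1) {G : ℝ → ℝ} {x : ℝ}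
    (hG : ContDiffAt ℝ (⊤ : ℕ∞) G x) : HC k β G x := by
  induction k generalizing G with
  | zero => exact HC_mono hβ.2 hβ.1.le (contDiffAt_lip hG)
  | succ k ih => exact ⟨(contDiffAt_deriv hG).2, ih (contDiffAt_deriv hG).1⟩

lemma HC_comp {k : ℕ} {β : ℝ} (hβ : β ∈ Ioc (0:ℝ) 1) {f G : ℝ → ℝ} {x : ℝ} (hf : HC k β f x)
    (hG : ContDiffAt ℝ (⊤ : ℕ∞) G (f x)) : HC k β (fun y => G (f y)) x := by
  induction k generalizing G with
  | zero =>
    have hcf := (HC_contAt hβ.1 hf).self_of_nhds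
    obtain ⟨C, hC, ε, hε, hf⟩ := hf
    obtain ⟨D, hD, δ, hδ, hg⟩ := contDiffAt_lip hG
    obtain ⟨η, hη, hb⟩ := Metric.mem_nhds_iff.1 (hcf.preimage_mem_nhds (Metric.ball_mem_nhds _ hδ))
    refine ⟨D * C, by positivity, min ε η, lt_min hε hη, fun y hy z hz => ?_⟩
    have h1 := hf y (Metric.ball_subset_ball (min_le_left _ _) hy) z (Metric.ball_subset_ball (min_le_left _ _) hz)
    have h2 := hg _ (hb (Metric.ball_subset_ball (min_le_right _ _) hy)) _ (hb (Metric.ball_subset_ball (min_le_right _ _) hz))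
    rw [Real.rpow_one] at h2
    refine h2.trans ?_
    rw [mul_assoc]
    exact mul_le_mul_of_nonneg_left h1 hD
  | succ k ih =>
    have hcf := (HC_contAt hβ.1 (HC_zero hβ hf)).self_of_nhds
    have hd := hcf.eventually (contDiffAt_deriv hG).2
    refine ⟨?_, HC_congr ?_ (HC_mul hβ (ih (HC_pred hβ hf) (contDiffAt_deriv hG).1) hf.2)⟩
    · filter_upwards [hf.1, hd] with y h1 h2 using h2.comp y h1
    · filter_upwards [hf.1, hd] with y h1 h2
      exact (h2.hasDerivAt.comp y h1.hasDerivAt).deriv.symm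

lemma HC_contDiffAt {k : ℕ} {β : ℝ} (hβ : β ∈ Ioc (0:ℝ) 1) {f : ℝ → ℝ} {x : ℝ} (hf : HC k β f x) :
    ContDiffAt ℝ k f x := by
  induction k generalizing f with
  | zero =>
    have h := HC_contAt hβ.1 hf
    refine contDiffAt_zero.2 ⟨_, h, fun y hy => ContinuousAt.continuousWithinAt hy⟩
  | succ k ih =>
    have h2 := ih hf.2
    rw [show ((k + 1 : ℕ) : WithTop ℕ∞) = (k : WithTop ℕ∞) + 1 by norm_cast]
    rw [contDiffAt_succ_iff_hasFDerivAt]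
    refine ⟨fun y => ContinuousLinearMap.toSpanSingleton ℝ (deriv f y), ⟨_, hf.1, fun y hy => ?_⟩, ?_⟩
    · exact (DifferentiableAt.hasDerivAt hy).hasFDerivAt
    · exact (ContinuousLinearMap.toSpanSingletonCLE (𝕜 := ℝ) (E := ℝ)).contDiff.contDiffAt.comp x h2

end
end HW

namespace HW
section
variable {α r : ℝ} {k : ℝ → ℝ}

/-- Compactly supported kernels with a weak singularity at the origin. -/
structure NK (α r : ℝ) (k : ℝ → ℝ) : Prop where
  meas : Measurable k
  supp : ∀ y, r ≤ |y| → k y = 0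
  bd : ∃ C > 0, (∀ y, y ≠ 0 → |k y| ≤ C * |y| ^ (α - 1)) ∧
    (∀ y h, y ≠ 0 → 2 * |h| ≤ |y| → |k (y + h) - k y| ≤ C * |h| * |y| ^ (α - 2))

/-- Convolution with a kernel. -/
noncomputable def cv (k u : ℝ → ℝ) (x : ℝ) : ℝ := ∫ y, k y * u (x - y)

/-- Truncated power weight. -/
noncomputable def WW (R σ : ℝ) (y : ℝ) : ℝ := indicator (Metric.ball 0 R) (fun y => |y| ^ (σ - 1)) y

lemma WW_nonneg (R σ y : ℝ) : 0 ≤ WW R σ y :=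
  indicator_nonneg (fun _ _ => by positivity) _

lemma WW_of {R σ y : ℝ} (h : |y| < R) : WW R σ y = |y| ^ (σ - 1) := by
  rw [WW, indicator_of_mem]; simpa [Metric.mem_ball, Real.dist_eq] using h

lemma WW_int {R σ : ℝ} (hσ : 0 < σ) : Integrable (WW R σ) := by
  rcases le_or_gt R 0 with hR | hR
  · have : WW R σ = fun _ => 0 := by
      ext y; rw [WW, Metric.ball_eq_empty.2 hR]; simp
    rw [this]; exact integrable_zero _ _ _
  unfold WW
  rw [integrable_indicator_iff Metric.isOpen_ball.measurableSet, Real.ball_eq_Ioo]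
  have h0 : IntervalIntegrable (fun x : ℝ => |x| ^ (σ - 1)) volume 0 R := by
    refine (rpow_ii hσ 0 R).congr ?_
    intro x hx
    rw [uIoc_of_le hR.le] at hx
    simp [abs_of_pos hx.1]
  have h1 : IntervalIntegrable (fun x : ℝ => |x| ^ (σ - 1)) volume (-R) 0 := by
    have := ((IntervalIntegrable.iff_comp_neg (by simp)).1 h0).symm
    simpa using this
  have h2 := h1.trans h0
  rw [intervalIntegrable_iff_integrableOn_Ioo_of_le (by linarith)] at h2
  simpa using h2

lemma NK.integrable (hk : NK α r k) (hα : 0 < α) : Integrable k := by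
  obtain ⟨C, hC, h1, -⟩ := hk.bd
  refine ((WW_int (R := r) hα).const_mul C).mono' hk.meas.aestronglyMeasurable ?_
  filter_upwards [measure_eq_zero_iff_ae_notMem.1 (measure_singleton (0:ℝ))] with y hy
  rcases le_or_gt r |y| with h | h
  · rw [hk.supp y h]; simpa using mul_nonneg hC.le (WW_nonneg _ _ _)
  · rw [WW_of h]; exact h1 y hy

lemma NK.ptw (hk : NK α r k) {β γ : ℝ} (hβ : 0 ≤ β) (hβγ : β ≤ γ) (hγ1 : γ ≤ 1) :
    ∃ C > 0, ∀ y h, y ≠ 0 → y + h ≠ 0 → |k (y + h) - k y| * |y| ^ β ≤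
      C * |h| ^ γ * (|y| ^ ((α + β - γ) - 1) + |y + h| ^ ((α + β - γ) - 1)) := by
  obtain ⟨C, hC, h1, h2⟩ := hk.bd
  refine ⟨3 * C, by positivity, fun y h hy hyh => ?_⟩
  have py : 0 < |y| := abs_pos.2 hy
  have pyh : 0 < |y + h| := abs_pos.2 hyh
  set s := (α + β - γ) - 1
  have hγ0 : 0 ≤ γ := hβ.trans hβγ
  rcases le_or_gt (2 * |h|) |y| with hc | hc
  · have q := h2 y h hy hc
    have e1 : |h| ≤ |h| ^ γ * |y| ^ (1 - γ) := by
      rcases (abs_nonneg h).eq_or_lt with h0 | h0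
      · rw [← h0]; positivity
      · calc |h| = |h| ^ γ * |h| ^ (1 - γ) := by
              rw [← Real.rpow_add h0]; simp
          _ ≤ _ := by
            refine mul_le_mul_of_nonneg_left ?_ (by positivity)
            exact Real.rpow_le_rpow h0.le (by linarith) (by linarith)
    have e2 : |y| ^ (1 - γ) * (|y| ^ (α - 2) * |y| ^ β) = |y| ^ s := by
      rw [← Real.rpow_add py, ← Real.rpow_add py]; congr 1; simp only [s]; ring
    calc |k (y + h) - k y| * |y| ^ β ≤ C * |h| * |y| ^ (α - 2) * |y| ^ β := by gcongr
      _ ≤ C * (|h| ^ γ * |y| ^ (1 - γ)) * |y| ^ (α - 2) * |y| ^ β := by gcongr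
      _ = C * |h| ^ γ * |y| ^ s := by rw [← e2]; ring
      _ ≤ 3 * C * |h| ^ γ * (|y| ^ s + |y + h| ^ s) := by
        have a1 : 0 ≤ C * |h| ^ γ := by positivity
        have a2 : 0 ≤ |y| ^ s := by positivity
        have a3 : 0 ≤ |y + h| ^ s := by positivity
        nlinarith [mul_nonneg a1 a2, mul_nonneg a1 a3]
  · have ph : 0 < |h| := by linarith
    have t3 : (3 * |h|) ^ γ ≤ 3 * |h| ^ γ := by
      rw [Real.mul_rpow (by norm_num) ph.le]
      refine mul_le_mul_of_nonneg_right ?_ (by positivity)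
      calc (3:ℝ) ^ γ ≤ 3 ^ (1:ℝ) := Real.rpow_le_rpow_of_exponent_le (by norm_num) hγ1
        _ = 3 := by simp
    have b1 : |k y| * |y| ^ β ≤ C * |y| ^ s * (3 * |h| ^ γ) := by
      calc |k y| * |y| ^ β ≤ C * |y| ^ (α - 1) * |y| ^ β := by gcongr; exact h1 y hy
        _ = C * |y| ^ s * |y| ^ γ := by
          rw [mul_assoc, mul_assoc, ← Real.rpow_add py, ← Real.rpow_add py]
          congr 2; simp only [s]; ring
        _ ≤ C * |y| ^ s * (3 * |h|) ^ γ := by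
          gcongr; linarith
        _ ≤ _ := by gcongr
    have hyh3 : |y + h| ≤ 3 * |h| := by linarith [abs_add_le y h]
    have b2 : |k (y + h)| * |y| ^ β ≤ C * |y + h| ^ s * (3 * |h| ^ γ) := by
      calc |k (y + h)| * |y| ^ β ≤ C * |y + h| ^ (α - 1) * (3 * |h|) ^ β := by
            have := h1 _ hyh
            gcongr
            linarith
        _ = C * |y + h| ^ s * (|y + h| ^ (γ - β) * (3 * |h|) ^ β) := by
          have : |y + h| ^ (α - 1) = |y + h| ^ s * |y + h| ^ (γ - β) := by
            rw [← Real.rpow_add pyh]; congr 1; simp only [s]; ring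
          rw [this]; ring
        _ ≤ C * |y + h| ^ s * ((3 * |h|) ^ (γ - β) * (3 * |h|) ^ β) := by
          have : |y + h| ^ (γ - β) ≤ (3 * |h|) ^ (γ - β) :=
            Real.rpow_le_rpow pyh.le hyh3 (by linarith)
          gcongr
        _ = C * |y + h| ^ s * (3 * |h|) ^ γ := by
          rw [← Real.rpow_add (by positivity)]; congr 2; ring
        _ ≤ _ := by gcongr
    calc |k (y + h) - k y| * |y| ^ β ≤ (|k (y + h)| + |k y|) * |y| ^ β := by
          gcongr; exact abs_sub _ _
      _ ≤ _ := by linarith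

lemma NK.int_cv (hk : NK α r k) (hα : 0 < α) {u : ℝ → ℝ} (hu : Measurable u) {x0 M : ℝ} 
    (hM : ∀ y ∈ Metric.ball x0 (2 * r), |u y| ≤ M) {x : ℝ} (hx : x ∈ Metric.ball x0 r) :
    Integrable (fun y => k y * u (x - y)) := by
  refine ((hk.integrable hα).abs.mul_const M).mono'
    (hk.meas.mul (hu.comp (measurable_const.sub measurable_id))).aestronglyMeasurable
    (Eventually.of_forall fun y => ?_)
  rw [norm_mul]
  rcases le_or_gt r |y| with h | h
  · simp [hk.supp y h]
  · refine mul_le_mul_of_nonneg_left (hM _ ?_) (abs_nonneg _)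
    rw [Metric.mem_ball, Real.dist_eq] at hx ⊢
    calc |x - y - x0| = |(x - x0) - y| := by ring_nf
      _ ≤ |x - x0| + |y| := abs_sub _ _
      _ < 2 * r := by linarith

theorem NK.hol (hk : NK α r k) (hα : 0 < α) (hr : 0 < r) {β γ : ℝ} (hβ : 0 ≤ β) (hβγ : β ≤ γ)
    (hγ1 : γ ≤ 1) (hγα : γ < α + β) {u : ℝ → ℝ} (hu : Measurable u) {x0 D : ℝ} (hD : 0 ≤ D)
    (hH : ∀ y ∈ Metric.ball x0 (5 * r), ∀ z ∈ Metric.ball x0 (5 * r), |u y - u z| ≤ D * |y - z| ^ β) :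
    ∃ C ≥ 0, ∀ x ∈ Metric.ball x0 r, ∀ z ∈ Metric.ball x0 r,
      |cv k u x - cv k u z| ≤ C * |x - z| ^ γ := by
  obtain ⟨C, hC, hp⟩ := hk.ptw hβ hβγ hγ1
  set σ := α + β - γ
  have hσ : 0 < σ := by simp only [σ]; linarith
  have hW := WW_int (R := 5 * r) hσ
  have hI0 : 0 ≤ ∫ y, WW (5 * r) σ y := integral_nonneg (WW_nonneg _ _)
  refine ⟨2 * D * C * ∫ y, WW (5 * r) σ y, by positivity, fun x' hx' x hx => ?_⟩
  have hM : ∀ y ∈ Metric.ball x0 (2 * r), |u y| ≤ |u x0| + D * (5 * r) ^ β := by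
    intro y hy
    have hy' := Metric.ball_subset_ball (by linarith : 2 * r ≤ 5 * r) hy
    have h1 := hH y hy' x0 (Metric.mem_ball_self (by positivity))
    rw [Metric.mem_ball, Real.dist_eq] at hy'
    have h2 : D * |y - x0| ^ β ≤ D * (5 * r) ^ β := by gcongr
    have h3 := abs_sub_abs_le_abs_sub (u y) (u x0)
    linarith
  have i1 := hk.int_cv hα hu hM hx
  have i2 := hk.int_cv hα hu hM hx'
  set h := x' - x
  have hki := hk.integrable hα
  have e1 : cv k u x' = ∫ y, k (y + h) * u (x - y) := by
    rw [cv, ← integral_add_right_eq_self (fun y => k y * u (x' - y)) h]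
    congr 1; ext y; congr 2; simp only [h]; ring
  have i3 : Integrable (fun y => k (y + h) * u (x - y)) := by
    have := i2.comp_add_right h
    refine this.congr (Eventually.of_forall fun y => ?_)
    simp only [h]; congr 2; ring
  have e2 : ∫ y, (k (y + h) - k y) * u x = 0 := by
    rw [integral_mul_const, integral_sub (hki.comp_add_right h) hki, integral_add_right_eq_self k h]
    simp
  have i4 : Integrable (fun y => (k (y + h) - k y) * u x) := ((hki.comp_add_right h).sub hki).mul_const _
  have e3 : cv k u x' - cv k u x = ∫ y, (k (y + h) - k y) * (u (x - y) - u x) := by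
    rw [e1, cv, ← integral_sub i3 i1, ← sub_zero (∫ y, _), ← e2, ← integral_sub (f := fun y => k (y + h) * u (x - y) - k y * u (x - y)) (i3.sub i1) i4]
    congr 1; ext y; ring
  rw [e3]
  rw [Metric.mem_ball, Real.dist_eq] at hx hx'
  have hh : |h| < 2 * r := by
    calc |h| = |(x' - x0) - (x - x0)| := by simp only [h]; ring_nf
      _ ≤ |x' - x0| + |x - x0| := abs_sub _ _
      _ < _ := by linarith
  have hbi : Integrable (fun y => D * C * |h| ^ γ * (WW (5 * r) σ y + WW (5 * r) σ (y + h))) :=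
    (hW.add (hW.comp_add_right h)).const_mul _
  calc |∫ y, (k (y + h) - k y) * (u (x - y) - u x)| 
      ≤ ∫ y, D * C * |h| ^ γ * (WW (5 * r) σ y + WW (5 * r) σ (y + h)) := by
        rw [← Real.norm_eq_abs]
        refine norm_integral_le_of_norm_le hbi ?_
        filter_upwards [measure_eq_zero_iff_ae_notMem.1 (measure_singleton (0:ℝ)),
          measure_eq_zero_iff_ae_notMem.1 (measure_singleton (-h))] with y hy1 hy2
        have hy1 : y ≠ 0 := hy1
        have hy2 : y + h ≠ 0 := fun h => hy2 (by simp; linarith)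
        have n1 := WW_nonneg (5 * r) σ y
        have n2 := WW_nonneg (5 * r) σ (y + h)
        rcases le_or_gt (3 * r) |y| with hy | hy
        · have a2 : r ≤ |y + h| := by
            have := abs_sub_abs_le_abs_sub y (-h)
            rw [abs_neg, sub_neg_eq_add] at this
            linarith
          rw [hk.supp y (by linarith), hk.supp _ a2]
          simp; positivity
        · have a2 : |y + h| < 5 * r := by linarith [abs_add_le y h]
          rw [WW_of (by linarith : |y| < 5 * r), WW_of a2, norm_mul]
          have b1 : |u (x - y) - u x| ≤ D * |y| ^ β := by
            have := hH (x - y) ?_ x ?_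
            · simpa using this
            · rw [Metric.mem_ball, Real.dist_eq]
              calc |x - y - x0| = |(x - x0) - y| := by ring_nf
                _ ≤ |x - x0| + |y| := abs_sub _ _
                _ < 5 * r := by linarith
            · rw [Metric.mem_ball, Real.dist_eq]; linarith
          have b2 := hp y h hy1 hy2
          calc ‖k (y + h) - k y‖ * ‖u (x - y) - u x‖ ≤ |k (y + h) - k y| * (D * |y| ^ β) :=
                mul_le_mul_of_nonneg_left b1 (abs_nonneg _)
            _ = D * (|k (y + h) - k y| * |y| ^ β) := by ring
            _ ≤ D * _ := mul_le_mul_of_nonneg_left b2 hD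
            _ = _ := by ring
    _ = _ := by
      rw [integral_const_mul, integral_add hW (hW.comp_add_right h), integral_add_right_eq_self (WW (5 * r) σ) h]
      ring

theorem NK.der (hk : NK α r k) (hα : 0 < α) (hr : 0 < r) {u : ℝ → ℝ} (hu : Measurable u)
    {x0 D : ℝ} (hD : 0 ≤ D)
    (hH : ∀ y ∈ Metric.ball x0 (2 * r), ∀ z ∈ Metric.ball x0 (2 * r), |u y - u z| ≤ D * |y - z|) :
    ∀ x ∈ Metric.ball x0 r, HasDerivAt (cv k u) (cv k (deriv u) x) x := by
  intro x hx
  have hM : ∀ y ∈ Metric.ball x0 (2 * r), |u y| ≤ |u x0| + D * (2 * r) := by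
    intro y hy
    have h1 := hH y hy x0 (Metric.mem_ball_self (by positivity))
    rw [Metric.mem_ball, Real.dist_eq] at hy
    have h2 : D * |y - x0| ≤ D * (2 * r) := by gcongr
    have h3 := abs_sub_abs_le_abs_sub (u y) (u x0)
    linarith
  have hin : ∀ x ∈ Metric.ball x0 r, ∀ y, |y| < r → x - y ∈ Metric.ball x0 (2 * r) := by
    intro x hx y hy
    rw [Metric.mem_ball, Real.dist_eq] at hx ⊢
    calc |x - y - x0| = |(x - x0) - y| := by ring_nf
      _ ≤ |x - x0| + |y| := abs_sub _ _
      _ < 2 * r := by linarith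
  have hlip : LipschitzOnWith D.toNNReal u (Metric.ball x0 (2 * r)) := by
    refine LipschitzOnWith.of_dist_le_mul fun y hy z hz => ?_
    rw [Real.coe_toNNReal _ hD]
    exact hH y hy z hz
  have hae : ∀ᵐ y : ℝ, x - y ∈ Metric.ball x0 (2 * r) → DifferentiableAt ℝ u (x - y) := by
    have h1 : ∀ᵐ y : ℝ, y ∈ Metric.ball x0 (2 * r) → DifferentiableAt ℝ u y := by
      filter_upwards [hlip.ae_differentiableWithinAt_of_mem (μ := volume)] with y hy hm
      exact (hy hm).differentiableAt (Metric.isOpen_ball.mem_nhds hm)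
    exact (Measure.measurePreserving_sub_left volume x).quasiMeasurePreserving.ae h1
  refine (hasDerivAt_integral_of_dominated_loc_of_lip (𝕜 := ℝ) (μ := volume)
    (F := fun x y => k y * u (x - y)) (F' := fun y => k y * deriv u (x - y)) (x₀ := x) (s := Metric.ball x0 r)
    (bound := fun y => |k y| * D)
    (Metric.isOpen_ball.mem_nhds hx) ?_ ?_ ?_ ?_ ?_ ?_).2
  · exact Eventually.of_forall fun z =>
      (hk.meas.mul (hu.comp (measurable_const.sub measurable_id))).aestronglyMeasurable
  · exact hk.int_cv hα hu hM hx
  · exact (hk.meas.mul ((measurable_deriv u).comp (measurable_const.sub measurable_id))).aestronglyMeasurable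
  · refine Eventually.of_forall fun y => LipschitzOnWith.of_dist_le_mul fun a ha b hb => ?_
    rcases le_or_gt r |y| with h | h
    · simp [hk.supp y h]
    · rw [Real.dist_eq, ← mul_sub, abs_mul, Real.dist_eq]
      have := hH _ (hin a ha y h) _ (hin b hb y h)
      have e : (Real.nnabs (|k y| * D) : ℝ) = |k y| * D := by
        rw [Real.coe_nnabs, abs_of_nonneg (by positivity)]
      rw [e, mul_assoc]
      refine mul_le_mul_of_nonneg_left (this.trans (le_of_eq ?_)) (abs_nonneg _)
      congr 2; ring
  · exact (hk.integrable hα).abs.mul_const D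
  · filter_upwards [hae] with y hy
    rcases le_or_gt r |y| with h | h
    · simp only [hk.supp y h, zero_mul]; exact hasDerivAt_const _ _
    · have := (hy (hin x hx y h)).hasDerivAt
      have h2 := (this.comp x ((hasDerivAt_id x).sub_const y)).const_mul (k y)
      simpa using h2

/-- Gain of regularity below the Lipschitz threshold. -/
theorem HC_gain (hα : 0 < α) {β γ : ℝ} (hβ : 0 < β) (hβγ : β ≤ γ)
    (hγ1 : γ ≤ 1) (hγα : γ < α + β) {n : ℕ} {u : ℝ → ℝ} (hu : Measurable u) {x0 : ℝ} (h : HC n β u x0) :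
    ∃ r0 > 0, ∀ r k, 0 < r → r ≤ r0 → NK α r k → HC n γ (cv k u) x0 := by
  induction n generalizing u with
  | zero =>
    obtain ⟨D, hD, ε, hε, hf⟩ := h
    refine ⟨ε / 5, by positivity, fun r k hr hr0 hk => ?_⟩
    have hs : Metric.ball x0 (5 * r) ⊆ Metric.ball x0 ε := Metric.ball_subset_ball (by linarith)
    obtain ⟨C, hC, hh⟩ := hk.hol hα hr hβ.le hβγ hγ1 hγα hu hD (fun y hy z hz => hf y (hs hy) z (hs hz))
    exact ⟨C, hC, r, hr, hh⟩
  | succ n ih =>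
    obtain ⟨r0, hr0, hh⟩ := ih (measurable_deriv u) h.2
    have h01 : HC 0 1 u x0 := HC_lip hβ ⟨h.1, HC_zero ⟨hβ, hβγ.trans hγ1⟩ h.2⟩
    obtain ⟨D, hD, ε, hε, hf⟩ := h01
    refine ⟨min r0 (ε / 2), by positivity, fun r k hr hr1 hk => ?_⟩
    have hs : Metric.ball x0 (2 * r) ⊆ Metric.ball x0 ε :=
      Metric.ball_subset_ball (by linarith [hr1.trans (min_le_right _ _)])
    have hd := hk.der hα hr hu hD (fun y hy z hz => by simpa using hf y (hs hy) z (hs hz))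
    have hev : ∀ᶠ x in 𝓝 x0, x ∈ Metric.ball x0 r := Metric.ball_mem_nhds _ hr
    refine ⟨?_, HC_congr ?_ (hh r k hr (hr1.trans (min_le_left _ _)) hk)⟩
    · filter_upwards [hev] with x hx using (hd x hx).differentiableAt
    · filter_upwards [hev] with x hx using (hd x hx).deriv.symm

/-- Gain of a derivative at the Lipschitz threshold. -/
theorem HC_gain_one (hα : α ∈ Ioo (0:ℝ) 1) {n : ℕ} {u : ℝ → ℝ} (hu : Measurable u) {x0 : ℝ} (h : HC n 1 u x0) :
    ∃ r0 > 0, ∀ r k, 0 < r → r ≤ r0 → NK α r k → HC (n + 1) (α / 2) (cv k u) x0 := by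
  have hα0 := hα.1
  induction n generalizing u with
  | zero =>
    obtain ⟨D, hD, ε, hε, hf⟩ := h
    refine ⟨ε / 5, by positivity, fun r k hr hr0 hk => ?_⟩
    have hs : Metric.ball x0 (2 * r) ⊆ Metric.ball x0 ε := Metric.ball_subset_ball (by linarith)
    have hs5 : Metric.ball x0 (5 * r) ⊆ Metric.ball x0 ε := Metric.ball_subset_ball (by linarith)
    have hd := hk.der hα0 hr hu hD (fun y hy z hz => by simpa using hf y (hs hy) z (hs hz))
    have hev : ∀ᶠ x in 𝓝 x0, x ∈ Metric.ball x0 r := Metric.ball_mem_nhds _ hr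
    have hlip : LipschitzOnWith D.toNNReal u (Metric.ball x0 ε) := by
      refine LipschitzOnWith.of_dist_le_mul fun y hy z hz => ?_
      rw [Real.coe_toNNReal _ hD]
      simpa [Real.dist_eq] using hf y hy z hz
    have hbd : ∀ y ∈ Metric.ball x0 ε, |deriv u y| ≤ D := by
      intro y hy
      have := norm_deriv_le_of_lipschitzOn (Metric.isOpen_ball.mem_nhds hy) hlip
      rwa [Real.coe_toNNReal _ hD] at this
    obtain ⟨C, hC, hh⟩ := hk.hol (β := 0) (γ := α / 2) (D := 2 * D) hα0 hr le_rfl (by linarith)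
      (by linarith [hα.2]) (by linarith) (measurable_deriv u) (by positivity) (fun y hy z hz => by
        rw [Real.rpow_zero, mul_one]
        refine (abs_sub _ _).trans ?_
        linarith [hbd y (hs5 hy), hbd z (hs5 hz)])
    refine ⟨?_, HC_congr (f := cv k (deriv u)) ?_ ⟨C, hC, r, hr, hh⟩⟩
    · filter_upwards [hev] with x hx using (hd x hx).differentiableAt
    · filter_upwards [hev] with x hx using (hd x hx).deriv.symm
  | succ n ih =>
    obtain ⟨r0, hr0, hh⟩ := ih (measurable_deriv u) h.2
    have h01 : HC 0 1 u x0 := HC_lip one_pos ⟨h.1, HC_zero ⟨one_pos, le_rfl⟩ h.2⟩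
    obtain ⟨D, hD, ε, hε, hf⟩ := h01
    refine ⟨min r0 (ε / 2), by positivity, fun r k hr hr1 hk => ?_⟩
    have hs : Metric.ball x0 (2 * r) ⊆ Metric.ball x0 ε :=
      Metric.ball_subset_ball (by linarith [hr1.trans (min_le_right _ _)])
    have hd := hk.der hα0 hr hu hD (fun y hy z hz => by simpa using hf y (hs hy) z (hs hz))
    have hev : ∀ᶠ x in 𝓝 x0, x ∈ Metric.ball x0 r := Metric.ball_mem_nhds _ hr
    refine ⟨?_, HC_congr ?_ (hh r k hr (hr1.trans (min_le_left _ _)) hk)⟩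
    · filter_upwards [hev] with x hx using (hd x hx).differentiableAt
    · filter_upwards [hev] with x hx using (hd x hx).deriv.symm

end
end HW

namespace HW
section
variable {α r : ℝ} {K : ℝ → ℝ}

lemma far_deriv {M v : ℝ → ℝ} (hM : ContDiff ℝ (⊤ : ℕ∞) M) (hv : Continuous v) (x : ℝ) :
    HasDerivAt (fun x => ∫ y in (-π)..π, M (x - y) * v y) (∫ y in (-π)..π, deriv M (x - y) * v y) x := by
  have hMc : Continuous M := hM.continuous
  have hM'c : Continuous (deriv M) := hM.continuous_deriv (by norm_cast)
  have hMd : Differentiable ℝ M := hM.differentiable (by simp)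
  obtain ⟨B, hB⟩ := ((isCompact_Icc (a := x - 1 - π) (b := x + 1 + π)).image hM'c).isBounded.exists_norm_le
  have hpi := pi_pos
  refine (intervalIntegral.hasDerivAt_integral_of_dominated_loc_of_deriv_le (𝕜 := ℝ) (μ := volume)
    (F := fun x y => M (x - y) * v y) (F' := fun x y => deriv M (x - y) * v y) (x₀ := x)
    (s := Metric.ball x 1) (bound := fun y => B * |v y|) (Metric.ball_mem_nhds x one_pos)
    ?_ ?_ ?_ ?_ ?_ ?_).2
  · exact Eventually.of_forall fun z => (by fun_prop : Continuous fun y => M (z - y) * v y).aestronglyMeasurable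
  · exact (by fun_prop : Continuous fun y => M (x - y) * v y).intervalIntegrable _ _
  · exact (by fun_prop : Continuous fun y => deriv M (x - y) * v y).aestronglyMeasurable
  · refine Eventually.of_forall fun y hy z hz => ?_
    rw [norm_mul]
    refine mul_le_mul_of_nonneg_right (hB _ (mem_image_of_mem _ ?_)) (norm_nonneg _)
    rw [uIoc_of_le (by linarith)] at hy
    rw [Real.ball_eq_Ioo] at hz
    constructor <;> linarith [hz.1, hz.2, hy.1, hy.2]
  · exact (by fun_prop : Continuous fun y => B * |v y|).intervalIntegrable _ _
  · refine Eventually.of_forall fun y hy z hz => ?_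
    have := ((hMd (z - y)).hasDerivAt.comp z ((hasDerivAt_id z).sub_const y)).mul_const (v y)
    simpa using this

lemma far_smooth {M v : ℝ → ℝ} (hM : ContDiff ℝ (⊤ : ℕ∞) M) (hv : Continuous v) :
    ContDiff ℝ (⊤ : ℕ∞) (fun x => ∫ y in (-π)..π, M (x - y) * v y) := by
  rw [contDiff_infty]
  intro n
  induction n generalizing M with
  | zero =>
    rw [Nat.cast_zero, contDiff_zero]
    exact continuous_iff_continuousAt.2 fun x => (far_deriv hM hv x).continuousAt
  | succ n ih =>
    rw [show ((n + 1 : ℕ) : WithTop ℕ∞) = (n : WithTop ℕ∞) + 1 by norm_cast, contDiff_succ_iff_deriv]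
    refine ⟨fun x => (far_deriv hM hv x).differentiableAt, by simp, ?_⟩
    have : deriv (fun x => ∫ y in (-π)..π, M (x - y) * v y) = fun x => ∫ y in (-π)..π, deriv M (x - y) * v y := by
      ext x; exact (far_deriv hM hv x).deriv
    rw [this]
    exact ih ((contDiff_infty_iff_deriv.1 hM).2)

lemma GK.smoothAt (hK : GK α K) {x : ℝ} (hx : Real.cos x ≠ 1) : ContDiffAt ℝ (⊤ : ℕ∞) K x := by
  have hper : Function.Periodic K (2 * π) := hK.per
  have h2 : (0:ℝ) < 2 * π := by positivity
  obtain ⟨n, hn⟩ : ∃ n : ℤ, x - n * (2 * π) ∈ Ico 0 (2 * π) := by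
    refine ⟨toIcoDiv h2 0 x, ?_⟩
    have := sub_toIcoDiv_zsmul_mem_Ico h2 0 x
    simpa using this
  have hne : x - n * (2 * π) ≠ 0 := by
    intro h
    apply hx
    rw [show x = n * (2 * π) by linarith]
    exact Real.cos_int_mul_two_pi n
  have hm : x - n * (2 * π) ∈ Ioo 0 (2 * π) := ⟨lt_of_le_of_ne hn.1 hne.symm, hn.2⟩
  have h1 := (hK.smooth.contDiffAt (isOpen_Ioo.mem_nhds hm))
  have h3 : ContDiffAt ℝ (⊤ : ℕ∞) (fun y : ℝ => y - n * (2 * π)) x := by fun_prop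
  have h4 := h1.comp x h3
  have e : K ∘ (fun y : ℝ => y - n * (2 * π)) = K := by
    ext y; exact hper.sub_int_mul_eq n
  rwa [e] at h4

/-- The periodic cutoff. -/
noncomputable def cut (ε y : ℝ) : ℝ := Real.smoothTransition ((1 - Real.cos y) / ε - 1)

lemma cut_smooth (ε : ℝ) : ContDiff ℝ (⊤ : ℕ∞) (cut ε) := by
  unfold cut
  exact Real.smoothTransition.contDiff.comp (by
    have := Real.contDiff_cos (n := (⊤ : ℕ∞))
    fun_prop)

lemma near_exists (hK : GK α K) (hα : α ∈ Ioo (0:ℝ) 1) (hr : 0 < r) (hr1 : r ≤ 1) {v : ℝ → ℝ}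
    (hv : Continuous v) (hvp : ∀ x, v (x + 2 * π) = v x) :
    ∃ k, NK α r k ∧ ∃ F, ContDiff ℝ (⊤ : ℕ∞) F ∧ ∀ x, TT K v x = cv k v x + F x := by
  have hpi := pi_gt_three
  have hcr : Real.cos r < 1 := by
    have := Real.cos_lt_cos_of_nonneg_of_le_pi le_rfl (by linarith) hr
    rwa [Real.cos_zero] at this
  obtain ⟨ε, hε, hεr⟩ : ∃ ε > 0, 2 * ε = 1 - Real.cos r := ⟨(1 - Real.cos r) / 2, by linarith, by ring⟩
  set θ : ℝ → ℝ := fun y => 1 - cut ε y with hθ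
  have hgs := cut_smooth ε
  have hθs : ContDiff ℝ (⊤ : ℕ∞) θ := contDiff_const.sub hgs
  have hθ0 : ∀ y, r ≤ |y| → |y| ≤ π → θ y = 0 := by
    intro y h1 h2
    have h3 : Real.cos y ≤ Real.cos r := by
      rw [← Real.cos_abs y]
      exact Real.cos_le_cos_of_nonneg_of_le_pi hr.le h2 h1
    have : 1 ≤ (1 - Real.cos y) / ε - 1 := by
      rw [le_sub_iff_add_le, le_div_iff₀ hε]; linarith
    simp only [hθ, cut]
    rw [Real.smoothTransition.one_of_one_le this, sub_self]
  have hθb : ∀ y, |θ y| ≤ 1 := by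
    intro y
    have h1 := Real.smoothTransition.nonneg ((1 - Real.cos y) / ε - 1)
    have h2 := Real.smoothTransition.le_one ((1 - Real.cos y) / ε - 1)
    simp only [hθ, cut]
    rw [abs_of_nonneg (by linarith)]; linarith
  have hθe : ∀ y, θ (-y) = θ y := by intro y; simp [hθ, cut]
  have hθp : ∀ y, θ (y + 2 * π) = θ y := by intro y; simp [hθ, cut]
  -- the far kernel
  have hMs : ContDiff ℝ (⊤ : ℕ∞) (fun y => K y * cut ε y) := by
    rw [contDiff_iff_contDiffAt]
    intro x
    by_cases hx : Real.cos x = 1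
    · have : (fun y => K y * cut ε y) =ᶠ[𝓝 x] fun _ => 0 := by
        have hc : ∀ᶠ y in 𝓝 x, 1 - ε < Real.cos y :=
          Real.continuous_cos.continuousAt.eventually (lt_mem_nhds (by rw [hx]; linarith))
        filter_upwards [hc] with y hy
        have : (1 - Real.cos y) / ε - 1 ≤ 0 := by
          rw [sub_nonpos, div_le_one hε]; linarith
        rw [cut, Real.smoothTransition.zero_of_nonpos this, mul_zero]
      exact contDiffAt_const.congr_of_eventuallyEq this
    · exact (hK.smoothAt hx).mul hgs.contDiffAt
  set k : ℝ → ℝ := fun y => if |y| < 2 then K y * θ y else 0 with hk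
  have kpi : ∀ y, |y| ≤ π → k y = K y * θ y := by
    intro y hy
    simp only [hk]
    split_ifs with h
    · rfl
    · rw [hθ0 y (by linarith) hy, mul_zero]
  have ksupp : ∀ y, r ≤ |y| → k y = 0 := by
    intro y hy
    rcases le_or_gt |y| π with h | h
    · rw [kpi y h, hθ0 y hy h, mul_zero]
    · simp only [hk]; rw [if_neg (by linarith)]
  have keven : ∀ y, k (-y) = k y := by
    intro y; simp only [hk, abs_neg, hK.even, hθe]
  have kloc1 : ∀ y, |y| < 2 → k =ᶠ[𝓝 y] fun z => K z * θ z := by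
    intro y hy
    filter_upwards [continuous_abs.continuousAt.eventually (gt_mem_nhds hy)] with z hz
    simp only [hk]; rw [if_pos hz]
  have kloc2 : ∀ y, r < |y| → k =ᶠ[𝓝 y] fun z => 0 := by
    intro y hy
    filter_upwards [continuous_abs.continuousAt.eventually (lt_mem_nhds hy)] with z hz
    exact ksupp z (le_of_lt hz)
  have hcosne : ∀ y, y ≠ 0 → |y| < 2 → Real.cos y ≠ 1 := by
    intro y h0 h2 h
    rw [← Real.cos_abs] at h
    have := Real.cos_lt_cos_of_nonneg_of_le_pi le_rfl (by linarith) (abs_pos.2 h0)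
    rw [Real.cos_zero] at this; linarith
  obtain ⟨C, hC, hb⟩ := hK.bd
  have hθ'c : Continuous (deriv θ) := hθs.continuous_deriv (by norm_cast)
  obtain ⟨B, hB⟩ := ((isCompact_Icc (a := (0:ℝ)) (b := 2)).image hθ'c).isBounded.exists_norm_le
  have hB0 : 0 ≤ B := (norm_nonneg _).trans (hB _ (mem_image_of_mem _ ⟨le_rfl, by norm_num⟩))
  set E := C + C * B * 2 with hE
  have hE0 : 0 < E := by positivity
  have kb0 : ∀ y, 0 < y → |k y| ≤ C * y ^ (α - 1) := by
    intro y hy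
    rcases lt_or_ge y 2 with h | h
    · rw [kpi y (by rw [abs_of_pos hy]; linarith), abs_mul]
      have h1 := (hb y ⟨hy, by linarith⟩).1
      have h2 := hθb y
      have : 0 ≤ C * y ^ (α - 1) := by positivity
      nlinarith [abs_nonneg (K y), abs_nonneg (θ y)]
    · rw [ksupp y (by rw [abs_of_pos hy]; linarith), abs_zero]; positivity
  have kd : ∀ s, 0 < s → DifferentiableAt ℝ k s ∧ |deriv k s| ≤ E * s ^ (α - 2) := by
    intro s hs
    rcases lt_or_ge s 2 with h | h
    · have e := kloc1 s (by rw [abs_of_pos hs]; exact h)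
      have d1 := (hK.diffAt (x := s) ⟨hs, by linarith⟩).mul (hθs.differentiable (by simp) s).hasDerivAt
      have d2 : HasDerivAt k _ s := d1.congr_of_eventuallyEq e
      refine ⟨d2.differentiableAt, ?_⟩
      rw [d2.deriv]
      have h1 := (hb s ⟨hs, by linarith⟩)
      have h2 := hθb s
      have h3 : |deriv θ s| ≤ B := hB _ (mem_image_of_mem _ ⟨hs.le, h.le⟩)
      have e1 : s ^ (α - 1) = s ^ (α - 2) * s := by
        rw [← Real.rpow_add_one hs.ne']; congr 1; ring
      have hp : 0 ≤ s ^ (α - 2) := by positivity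
      calc |deriv K s * θ s + K s * deriv θ s| ≤ |deriv K s| * |θ s| + |K s| * |deriv θ s| := by
            rw [← abs_mul, ← abs_mul]; exact abs_add_le _ _
        _ ≤ (C * s ^ (α - 2)) * 1 + (C * s ^ (α - 1)) * B := by
          gcongr
          · exact h1.2.1
          · exact h1.1
        _ = C * s ^ (α - 2) + (C * B * s ^ (α - 2)) * s := by rw [e1]; ring
        _ ≤ C * s ^ (α - 2) + (C * B * s ^ (α - 2)) * 2 := by gcongr
        _ = E * s ^ (α - 2) := by rw [hE]; ring
    · have e := kloc2 s (by rw [abs_of_pos hs]; linarith)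
      refine ⟨(differentiableAt_const _).congr_of_eventuallyEq e, ?_⟩
      rw [e.deriv_eq]; simp; positivity
  have kmv : ∀ y h, 0 < y → 2 * |h| ≤ y → |k (y + h) - k y| ≤ 4 * E * |h| * y ^ (α - 2) := by
    intro y h hy hh
    have hI : ∀ s ∈ Icc (y / 2) (3 * y / 2), DifferentiableAt ℝ k s ∧ ‖deriv k s‖ ≤ 4 * E * y ^ (α - 2) := by
      intro s hs
      have hs0 : 0 < s := by linarith [hs.1]
      refine ⟨(kd s hs0).1, (kd s hs0).2.trans ?_⟩
      have h1 : s ^ (α - 2) ≤ (y / 2) ^ (α - 2) :=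
        Real.rpow_le_rpow_of_nonpos (by linarith) hs.1 (by linarith [hα.2])
      have h2 : (y / 2) ^ (α - 2) ≤ 4 * y ^ (α - 2) := by
        rw [Real.div_rpow hy.le (by norm_num), div_eq_mul_inv, ← Real.rpow_neg (by norm_num), mul_comm]
        refine mul_le_mul_of_nonneg_right ?_ (by positivity)
        calc (2:ℝ) ^ (-(α - 2)) ≤ 2 ^ (2:ℝ) :=
              Real.rpow_le_rpow_of_exponent_le (by norm_num) (by linarith [hα.1])
          _ = 4 := by norm_num
      calc E * s ^ (α - 2) ≤ E * (4 * y ^ (α - 2)) := mul_le_mul_of_nonneg_left (h1.trans h2) hE0.le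
        _ = _ := by ring
    have hab := abs_le.1 (le_refl |h|)
    have := (convex_Icc (y / 2) (3 * y / 2)).norm_image_sub_le_of_norm_deriv_le
      (fun s hs => (hI s hs).1) (fun s hs => (hI s hs).2) (x := y) (y := y + h)
      ⟨by linarith, by linarith⟩ ⟨by linarith, by linarith⟩
    rw [add_sub_cancel_left] at this
    refine this.trans (le_of_eq ?_)
    rw [Real.norm_eq_abs]; ring
  have kmeas : Measurable k := by
    refine measurable_of_continuousOn_compl_singleton 0 fun y hy => ContinuousAt.continuousWithinAt ?_
    have hy : y ≠ 0 := hy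
    rcases lt_or_ge |y| 2 with h | h
    · have := ((hK.smoothAt (hcosne y hy h)).mul hθs.contDiffAt).continuousAt
      exact this.congr (kloc1 y h).symm
    · exact continuousAt_const.congr (kloc2 y (by linarith)).symm
  refine ⟨k, ⟨kmeas, ksupp, C + 4 * E, by positivity, ?_, ?_⟩, _, far_smooth hMs hv, fun x => ?_⟩
  · intro y hy
    have h1 : abs (k (abs y)) ≤ C * |y| ^ (α - 1) := kb0 _ (abs_pos.2 hy)
    have h2 : k (abs y) = k y := by
      rcases abs_choice y with h | h <;> rw [h]
      exact keven y
    rw [h2] at h1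
    refine h1.trans (mul_le_mul_of_nonneg_right (by linarith) (by positivity))
  · intro y h hy hh
    have h1 : |k (y + h) - k y| ≤ 4 * E * |h| * |y| ^ (α - 2) := by
      rcases lt_or_gt_of_ne hy with h0 | h0
      · have := kmv (-y) (-h) (by linarith) (by rw [abs_neg]; rwa [abs_of_neg h0] at hh)
        rw [← neg_add, keven, keven, abs_neg] at this
        rwa [abs_of_neg h0]
      · rw [abs_of_pos h0] at hh ⊢
        exact kmv y h h0 hh
    refine h1.trans ?_
    gcongr
    linarith
  · have hi := hK.int_sub hα.1 x (-π) π
    have hcc : Continuous (cut ε) := hgs.continuous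
    have hθc : Continuous θ := hθs.continuous
    have i1 : IntervalIntegrable (fun y => K (x - y) * θ (x - y) * v y) volume (-π) π := by
      have := hi.mul_continuousOn (g := fun y => θ (x - y) * v y)
        (by fun_prop : Continuous fun y => θ (x - y) * v y).continuousOn
      refine this.congr (fun y _ => ?_)
      ring
    have i2 : IntervalIntegrable (fun y => K (x - y) * cut ε (x - y) * v y) volume (-π) π := by
      have := hi.mul_continuousOn (g := fun y => cut ε (x - y) * v y)
        (by fun_prop : Continuous fun y => cut ε (x - y) * v y).continuousOn
      refine this.congr (fun y _ => ?_)
      ring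
    have e1 : TT K v x = (∫ y in (-π)..π, K (x - y) * θ (x - y) * v y) +
        ∫ y in (-π)..π, K (x - y) * cut ε (x - y) * v y := by
      rw [← intervalIntegral.integral_add i1 i2, TT]
      congr 1; ext y; simp only [hθ]; ring
    rw [e1]
    congr 1
    set f : ℝ → ℝ := fun y => K y * θ y * v (x - y) with hf
    have hfp : Function.Periodic f (2 * π) := by
      intro y
      simp only [hf]
      rw [hθp, show K (y + 2 * π) = K y from hK.per y]
      congr 1
      rw [← hvp]; congr 1; ring
    have e2 : (∫ y in (-π)..π, K (x - y) * θ (x - y) * v y) = ∫ y in (-π)..π, f y := by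
      have h1 := intervalIntegral.integral_comp_sub_left (a := -π) (b := π) f x
      have h2 := hfp.intervalIntegral_add_eq (x - π) (-π)
      rw [show x - π + 2 * π = x - -π by ring, show -π + 2 * π = π by ring] at h2
      rw [← h2, ← h1]
      congr 1; ext y; simp only [hf]; congr 2; ring
    rw [e2, cv, intervalIntegral.integral_of_le (by linarith), ← integral_indicator measurableSet_Ioc]
    congr 1; ext y
    by_cases hy : y ∈ Ioc (-π) π
    · rw [indicator_of_mem hy, kpi y (abs_le.2 ⟨hy.1.le, hy.2⟩)]
    · rw [indicator_of_notMem hy, ksupp y, zero_mul]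
      by_contra hc
      push Not at hc
      have := abs_lt.1 hc
      exact hy ⟨by linarith, by linarith⟩

end
end HW

namespace HW
section
variable {α : ℝ} {K : ℝ → ℝ} {p : ℝ} {τ : ℝ} {v : ℝ → ℝ}

lemma gg_smooth {w : ℝ} (hw : w ≠ 1) : ContDiffAt ℝ (⊤ : ℕ∞) (gg p) w := by
  have h1 : (1 - w) ≠ 0 := sub_ne_zero.2 hw.symm
  have h2 : ContDiffAt ℝ (⊤ : ℕ∞) (fun w : ℝ => |1 - w|) w :=
    (contDiffAt_abs h1).comp w (by fun_prop : ContDiffAt ℝ (⊤ : ℕ∞) (fun w : ℝ => 1 - w) w)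
  have h3 : ContDiffAt ℝ (⊤ : ℕ∞) (fun w : ℝ => |1 - w| ^ p) w :=
    h2.rpow_const_of_ne (abs_ne_zero.2 h1)
  have h4 : ContDiffAt ℝ (⊤ : ℕ∞) (fun w : ℝ => p * w - 1) w := by fun_prop
  exact h4.add h3

lemma gg_inv (hp : 1 < p) {w : ℝ} (hw0 : 0 < w) (hw : w ≠ 1) : ∃ G : ℝ → ℝ,
    ContDiffAt ℝ (⊤ : ℕ∞) G (gg p w) ∧ ∀ᶠ z in 𝓝 w, G (gg p z) = z := by
  have hs := gg_smooth (p := p) hw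
  have hd := gg_hasDeriv hp w
  have hne : dg p w ≠ 0 := (dg_pos hp hw0).ne'
  set e := ContinuousLinearEquiv.unitsEquivAut ℝ (Units.mk0 _ hne) with he
  have hf : HasFDerivAt (gg p) (e : ℝ →L[ℝ] ℝ) w := by
    have e1 : (e : ℝ →L[ℝ] ℝ) = ContinuousLinearMap.toSpanSingleton ℝ (dg p w) := by
      ext; simp [he]
    rw [e1]
    exact hd.hasFDerivAt
  have h0 : ((⊤ : ℕ∞) : WithTop ℕ∞) ≠ 0 := by simp
  refine ⟨hs.localInverse hf h0, hs.to_localInverse hf h0, ?_⟩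
  exact (hs.hasStrictFDerivAt' hf h0).eventually_left_inverse

lemma Sol.back (hp : 1 < p) (h : Sol K p 0 τ v) {x0 : ℝ} (h0 : 0 < v x0) (h1 : v x0 ≠ 1)
    {n : ℕ} {β : ℝ} (hβ : β ∈ Ioc (0:ℝ) 1) (hT : HC n β (TT K v) x0) : HC n β v x0 := by
  obtain ⟨G, hG, hl⟩ := gg_inv hp h0 h1
  have hc : ContDiffAt ℝ (⊤ : ℕ∞) (fun t => G (τ * (t - TT K v 0))) (TT K v x0) := by
    refine ContDiffAt.comp (TT K v x0) (g := G) (f := fun t => τ * (t - TT K v 0)) ?_ (by fun_prop)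
    rw [← h.eqn0]; exact hG
  refine HC_congr ?_ (HC_comp hβ hT hc)
  filter_upwards [h.prof.cont.continuousAt.eventually hl] with y hy
  rw [← h.eqn0]; exact hy

theorem Sol.boot (hK : GK α K) (hα : α ∈ Ioo (0:ℝ) 1) (hp : 1 < p) (h : Sol K p 0 τ v) {x0 : ℝ}
    (h0 : 0 < v x0) (h1 : v x0 ≠ 1) (n : ℕ) : HC n (α / 2) v x0 := by
  have hα0 := hα.1
  have hα1 := hα.2
  have hvm : Measurable v := h.prof.cont.measurable
  -- transfer from near part
  have near : ∀ m : ℕ, ∀ γ ∈ Ioc (0:ℝ) 1, (∃ r0 > 0, ∀ r k, 0 < r → r ≤ r0 → NK α r k → HC m γ (cv k v) x0) →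
      HC m γ v x0 := by
    rintro m γ hγ ⟨r0, hr0, hh⟩
    obtain ⟨k, hk, F, hF, hT⟩ := near_exists hK hα (r := min r0 1) (by positivity) (min_le_right _ _)
      h.prof.cont h.prof.per
    refine h.back hp h0 h1 hγ (HC_congr (f := fun x => cv k v x + F x) (Eventually.of_forall fun x => (hT x).symm) ?_)
    exact HC_add (hh _ k (by positivity) (min_le_left _ _) hk) (HC_smooth hγ hF.contDiffAt)
  induction n with
  | zero =>
    obtain ⟨H, hH, hh⟩ := h.holder hK hα hp
    exact HC_mono (β := α) (by linarith) (by linarith) ⟨H, hH.le, 1, one_pos, fun y _ z _ => hh y z⟩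
  | succ n ih =>
    have all : ∀ j : ℕ, HC n (min 1 ((j + 1) * (α / 2))) v x0 := by
      intro j
      induction j with
      | zero => simpa [min_eq_right (by linarith : α / 2 ≤ 1)] using ih
      | succ j ihj =>
        have hj : (0:ℝ) ≤ j := Nat.cast_nonneg j
        have q : (0:ℝ) < ((j:ℝ) + 1) * (α / 2) := by positivity
        refine near n _ ⟨lt_min one_pos (by positivity), min_le_left _ _⟩
          (HC_gain hα0 (lt_min one_pos q) ?_ (min_le_left _ _) ?_ hvm ihj)
        · refine min_le_min le_rfl ?_
          push_cast; nlinarith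
        · push_cast
          rcases le_total 1 (((j:ℝ) + 1) * (α / 2)) with hc | hc
          · rw [min_eq_left hc]
            exact (min_le_left _ _).trans_lt (by linarith)
          · rw [min_eq_right hc]
            refine (min_le_right _ _).trans_lt (by nlinarith)
    obtain ⟨j, hj⟩ := exists_nat_ge (2 / α)
    have hone := all j
    rw [min_eq_left] at hone
    · exact near (n + 1) _ ⟨by linarith, by linarith⟩ (HC_gain_one hα hvm hone)
    · have : 2 / α * (α / 2) = 1 := by field_simp
      nlinarith

theorem Sol.smoothAt (hK : GK α K) (hα : α ∈ Ioo (0:ℝ) 1) (hp : 1 < p) (h : Sol K p 0 τ v) {x0 : ℝ}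
    (h0 : 0 < v x0) (h1 : v x0 ≠ 1) : ContDiffAt ℝ (⊤ : ℕ∞) v x0 := by
  rw [contDiffAt_infty]
  intro n
  exact HC_contDiffAt ⟨by linarith [hα.1], by linarith [hα.2]⟩ (h.boot hK hα hp h0 h1 n)

end
end HW

namespace HW
section
variable {α : ℝ} {K : ℝ → ℝ} {p : ℝ} {τ : ℝ} {v : ℝ → ℝ}

lemma one_sub_rpow (w : ℝ) : |1 - w| ^ p = gg p w - p * w + 1 := by simp only [gg]; ring

theorem Sol.steady (hK : GK α K) (hα : α ∈ Ioo (0:ℝ) 1) (hp : 1 < p) (h : Sol K p 0 τ v) {μ : ℝ}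
    (hμ : 0 < μ) (hμp : μ ^ (p - 1) = 1 / τ) (x : ℝ) :
    (∫ y in (-π)..π, K (x - y) * (μ * (1 - v y))) =
    p / τ * (μ * (1 - v x)) - |μ * (1 - v x)| ^ p
      + (1 / (2 * π)) * ∫ y in (-π)..π, |μ * (1 - v y)| ^ p := by
  have hτ := h.pos
  have hpi := pi_pos
  have hvc := h.prof.cont
  have e1 : (∫ y in (-π)..π, K (x - y) * (μ * (1 - v y))) = μ * ((∫ y in (-π)..π, K y) - TT K v x) := by
    have h1 := TT_sub hK hα.1 (continuous_const (y := (1:ℝ))) hvc x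
    rw [TT_one hK] at h1
    rw [← h1, TT, ← intervalIntegral.integral_const_mul]
    congr 1; ext y; ring
  have hpow : ∀ w, |μ * (1 - w)| ^ p = (μ / τ) * (gg p w - p * w + 1) := by
    intro w
    rw [abs_mul, abs_of_pos hμ, Real.mul_rpow hμ.le (abs_nonneg _), one_sub_rpow]
    congr 1
    rw [show p = (p - 1) + 1 by ring, Real.rpow_add_one hμ.ne', hμp]; ring
  have e2 : ∫ y in (-π)..π, |μ * (1 - v y)| ^ p = (μ / τ) * (2 * π * (τ * ((∫ y in (-π)..π, K y) - TT K v 0))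
      - p * (2 * π) + 2 * π) := by
    simp only [hpow]
    have hgc : Continuous fun y => gg p (v y) := (gg_cont hp).comp hvc
    rw [intervalIntegral.integral_const_mul, intervalIntegral.integral_add, intervalIntegral.integral_sub,
      h.mean_gg hK hα, intervalIntegral.integral_const_mul, h.mean, intervalIntegral.integral_const]
    · simp only [smul_eq_mul]; ring
    · exact hgc.intervalIntegrable _ _
    · exact (continuous_const.mul hvc).intervalIntegrable _ _
    · exact (hgc.sub (continuous_const.mul hvc)).intervalIntegrable _ _
    · exact continuous_const.intervalIntegrable _ _
  rw [e1, e2, hpow, h.eqn0]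
  field_simp
  ring

theorem main (hK : GK α K) (hα : α ∈ Ioo (0:ℝ) 1) (hp : 1 < p) :
    ∃ (c : ℝ) (φ : ℝ → ℝ),
      0 < c ∧ c < (p / (p - 1)) * (∫ x in (-π)..π, |K x|) ∧
      (Continuous φ ∧ Function.Periodic φ (2 * π) ∧
        (∫ y in (-π)..π, φ y) = 0 ∧
        ∀ x : ℝ, (∫ y in (-π)..π, K (x - y) * φ y) =
          c * φ x - |φ x| ^ p + (1 / (2 * π)) * ∫ y in (-π)..π, |φ y| ^ p) ∧
      (∃ x, φ x ≠ 0) ∧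
      (∀ x, φ (-x) = φ x) ∧
      φ 0 = (c / p) ^ (1 / (p - 1)) ∧
      (∀ x, φ x ≤ (c / p) ^ (1 / (p - 1))) ∧
      (∃ C > 0, ∀ x y : ℝ, |φ x - φ y| ≤ C * |x - y| ^ α) ∧
      StrictMonoOn φ (Set.Ioo (-π) 0) ∧
      (∃ U : Set ℝ, IsOpen U ∧ -π ∈ U ∧ ContDiffOn ℝ (⊤ : ℕ∞) φ U) ∧
      (∀ x ∈ Set.Ioo (-π) 0 ∪ Set.Ioo 0 π, φ x ≠ 0 → ContDiffAt ℝ (⊤ : ℕ∞) φ x) ∧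
      (∃ δ > 0, ∃ c₁ > 0, ∃ c₂ > 0, ∀ x : ℝ, |x| ≤ δ →
        c₁ * |x| ^ α ≤ (c / p) ^ (1 / (p - 1)) - φ x ∧
        (c / p) ^ (1 / (p - 1)) - φ x ≤ c₂ * |x| ^ α) := by
  obtain ⟨τ, v, h⟩ := exists_sol hK hα hp
  have hτ := h.pos
  have hpi := pi_gt_three
  have hp1 : 0 < p - 1 := by linarith
  have hp0 : 0 < p := by linarith
  have hvc := h.prof.cont
  have hve := h.prof.even
  set μ := (1 / τ) ^ (1 / (p - 1)) with hμ
  have hμ0 : 0 < μ := by positivity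
  have hcp : p / τ / p = 1 / τ := by field_simp
  have hμp : μ ^ (p - 1) = 1 / τ := by
    rw [hμ, ← Real.rpow_mul (by positivity), one_div_mul_cancel hp1.ne', Real.rpow_one]
  have hφs : ∀ x, 0 < v x → v x ≠ 1 → ContDiffAt ℝ (⊤ : ℕ∞) (fun x => μ * (1 - v x)) x :=
    fun x h0 h1 => contDiffAt_const.mul (contDiffAt_const.sub (h.smoothAt hK hα hp h0 h1))
  have habs : ∀ x, v |x| = v x := by
    intro x
    rcases abs_choice x with h | h <;> rw [h]
    exact hve x
  refine ⟨p / τ, fun x => μ * (1 - v x), by positivity, ?_, ⟨by fun_prop, ?_, ?_, ?_⟩, ⟨0, ?_⟩, ?_, ?_, ?_, ?_, ?_,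
    ?_, ?_, ?_⟩
  · have := h.tau_bound hK hα hp
    rw [L1] at this
    rw [div_mul_eq_mul_div, div_lt_div_iff₀ hτ hp1]
    nlinarith
  · intro x
    simp only
    rw [h.prof.per]
  · rw [intervalIntegral.integral_const_mul, intervalIntegral.integral_sub
      (continuous_const.intervalIntegrable _ _) (hvc.intervalIntegrable _ _), h.mean]
    simp; right; ring
  · exact h.steady hK hα hp hμ0 hμp
  · simp only [h.zero]; simpa using hμ0.ne'
  · intro x; simp only [hve]
  · rw [hcp]; simp [h.zero, hμ]
  · intro x
    rw [hcp, ← hμ]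
    have := h.nonneg x
    nlinarith
  · obtain ⟨H, hH, hh⟩ := h.holder hK hα hp
    refine ⟨μ * H, by positivity, fun x y => ?_⟩
    have e : μ * (1 - v x) - μ * (1 - v y) = - (μ * (v x - v y)) := by ring
    simp only [e, abs_neg, abs_mul, abs_of_pos hμ0, mul_assoc]
    exact mul_le_mul_of_nonneg_left (hh x y) hμ0.le
  · intro x hx y hy hxy
    have := h.strict hK hα hp (a := -y) (b := -x) ⟨by linarith [hy.2], by linarith [hy.1]⟩
      ⟨by linarith [hx.2], by linarith [hx.1]⟩ (by linarith)
    rw [hve, hve] at this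
    simp only
    nlinarith
  · refine ⟨{x | 1 < v x}, isOpen_lt continuous_const hvc, ?_, fun x hx => ?_⟩
    · show 1 < v (-π)
      rw [hve]; exact h.one_lt_pi
    · have hx : 1 < v x := hx
      exact (hφs x (by linarith) hx.ne').contDiffWithinAt
  · intro x hx hne
    have hx0 : |x| ∈ Ioc 0 π := by
      rcases hx with hx | hx
      · rw [abs_of_neg hx.2]; exact ⟨by linarith [hx.2], by linarith [hx.1]⟩
      · rw [abs_of_pos hx.1]; exact ⟨hx.1, hx.2.le⟩
    have hpos := h.pos' hK hα hp hx0
    rw [habs] at hpos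
    refine hφs x hpos fun h1 => hne ?_
    simp [h1]
  · obtain ⟨A, hA, hu⟩ := h.upper hK hα hp
    obtain ⟨c, hc, δ, hδ, hδ1, hl⟩ := h.lower hK hα hp
    refine ⟨δ, hδ, μ * c, by positivity, μ * A, by positivity, fun x hx => ?_⟩
    rw [hcp, ← hμ]
    have e : μ - μ * (1 - v x) = μ * v x := by ring
    rw [e]
    rcases eq_or_ne x 0 with rfl | hx0
    · simp [h.zero, Real.zero_rpow hα.1.ne']
    · have hxp := abs_pos.2 hx0
      have h1 := hl |x| ⟨hxp, hx⟩
      have h2 := hu |x| ⟨hxp, by linarith⟩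
      rw [habs] at h1 h2
      rw [mul_assoc, mul_assoc]
      exact ⟨mul_le_mul_of_nonneg_left h1 hμ0.le, mul_le_mul_of_nonneg_left h2 hμ0.le⟩

end
end HW

/-- Existence of a highest, cusped, exactly `α`-Hölder periodic
travelling wave for the nonlinearity `n(x) = |x|^p`. -/
theorem statement0 (α p : ℝ) (hα : α ∈ Set.Ioo (0:ℝ) 1) (hp : 1 < p) :
    ∃ (c : ℝ) (φ : ℝ → ℝ),
      0 < c ∧ c < (p / (p - 1)) * (∫ x in (-π)..π, |Kker α x|) ∧
      IsSteadySolution α c (nAbs p) φ ∧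
      (∃ x, φ x ≠ 0) ∧
      (∀ x, φ (-x) = φ x) ∧
      φ 0 = (c / p) ^ (1 / (p - 1)) ∧
      (∀ x, φ x ≤ (c / p) ^ (1 / (p - 1))) ∧
      (∃ C > 0, ∀ x y : ℝ, |φ x - φ y| ≤ C * |x - y| ^ α) ∧
      StrictMonoOn φ (Set.Ioo (-π) 0) ∧
      (∃ U : Set ℝ, IsOpen U ∧ -π ∈ U ∧ ContDiffOn ℝ (⊤ : ℕ∞) φ U) ∧
      (∀ x ∈ Set.Ioo (-π) 0 ∪ Set.Ioo 0 π, φ x ≠ 0 → ContDiffAt ℝ (⊤ : ℕ∞) φ x) ∧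
      (∃ δ > 0, ∃ c₁ > 0, ∃ c₂ > 0, ∀ x : ℝ, |x| ≤ δ →
        c₁ * |x| ^ α ≤ (c / p) ^ (1 / (p - 1)) - φ x ∧
        (c / p) ^ (1 / (p - 1)) - φ x ≤ c₂ * |x| ^ α) := by
  exact HW.main (HW.Kker_GK α hα) hα hp
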